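/- arXiv:0812.4328 — 6 statements merged into one kernel-verified Lean document; each statement's English description precedes it below -/
import Mathlib

section
/- Fix integers m ≥ 2 and k ≥ 1, set p = 2(m+k)/(m+k−2), and let λ be a real number with λ > m/(p−2). Then there exist a real number α > 1 and a solution u of the Yamabe ODE such that u(0) = α, u'(0) = 0, u(t) > 0 for all t ∈ [0,π], u is strictly decreasing on [0,π], and u'(π) = 0. -/
open Real Set

/-- `u` is a solution of the Yamabe ODE
`u'' + (m-1) (cos t / sin t) u' + λ (u^(p-1) - u) = 0` on `(0, π)`,
where `u^(p-1)` denotes the real power. -/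
def IsYamabeSolution (m : ℕ) (p lam : ℝ) (u : ℝ → ℝ) : Prop :=
  ContinuousOn u (Set.Icc 0 π) ∧
  (∀ t ∈ Set.Icc (0 : ℝ) π, DifferentiableAt ℝ u t) ∧
  (∀ t ∈ Set.Ioo (0 : ℝ) π, DifferentiableAt ℝ (deriv u) t) ∧
  ∀ t ∈ Set.Ioo (0 : ℝ) π,
    deriv (deriv u) t + ((m : ℝ) - 1) * (Real.cos t / Real.sin t) * deriv u t
      + lam * (u t ^ (p - 1) - u t) = 0

/-- `(u, v)` solves `u' = v`, `v' = -n cot t v - g u` on `(0, π)` with `u 0 = α`, `v 0 = 0`,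
and is continuous on `[0, π)`. -/
structure IsShot (n : ℕ) (g : ℝ → ℝ) (α : ℝ) (u v : ℝ → ℝ) : Prop where
  u_zero : u 0 = α
  v_zero : v 0 = 0
  contu : ContinuousOn u (Ico 0 π)
  contv : ContinuousOn v (Ico 0 π)
  deru : ∀ t ∈ Ioo 0 π, HasDerivAt u (v t) t
  derv : ∀ t ∈ Ioo 0 π, HasDerivAt v (-(n * (cos t / sin t) * v t) - g (u t)) t

theorem le_of_hasDerivAt_nonpos {F F' : ℝ → ℝ} {a b : ℝ} (hab : a ≤ b)
    (hc : ContinuousOn F (Icc a b)) (hd : ∀ t ∈ Ioo a b, HasDerivAt F (F' t) t)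
    (h : ∀ t ∈ Ioo a b, F' t ≤ 0) : F b ≤ F a := by
  have : AntitoneOn F (Icc a b) := by
    apply antitoneOn_of_deriv_nonpos (convex_Icc a b) hc
    · intro t ht
      rw [interior_Icc] at ht
      exact (hd t ht).differentiableAt.differentiableWithinAt
    · intro t ht
      rw [interior_Icc] at ht
      rw [(hd t ht).deriv]
      exact h t ht
  exact this (left_mem_Icc.2 hab) (right_mem_Icc.2 hab) hab

theorem le_of_hasDerivAt_nonneg {F F' : ℝ → ℝ} {a b : ℝ} (hab : a ≤ b)
    (hc : ContinuousOn F (Icc a b)) (hd : ∀ t ∈ Ioo a b, HasDerivAt F (F' t) t)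
    (h : ∀ t ∈ Ioo a b, 0 ≤ F' t) : F a ≤ F b := by
  have := le_of_hasDerivAt_nonpos (F := fun t => -F t) (F' := fun t => -F' t) hab hc.neg
    (fun t ht => (hd t ht).neg) (fun t ht => by linarith [h t ht])
  linarith

theorem lt_of_hasDerivAt_neg {F F' : ℝ → ℝ} {a b : ℝ} (hab : a < b)
    (hc : ContinuousOn F (Icc a b)) (hd : ∀ t ∈ Ioo a b, HasDerivAt F (F' t) t)
    (h : ∀ t ∈ Ioo a b, F' t < 0) : F b < F a := by
  obtain ⟨c, hc', h'⟩ := exists_hasDerivAt_eq_slope F F' hab hc hd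
  have := h c hc'
  rw [h', div_neg_iff] at this
  rcases this with h | h <;> linarith [h.1, h.2]

theorem sin_pow_le (n : ℕ) {r s : ℝ} (hr : 0 ≤ r) (hrs : r ≤ s) (hs : s < π) :
    sin r ^ n * cos (s / 2) ^ n ≤ sin s ^ n := by
  have hc : 0 < cos (s / 2) := cos_pos_of_mem_Ioo ⟨by linarith [pi_pos], by linarith⟩
  have hr0 : 0 ≤ sin r := sin_nonneg_of_nonneg_of_le_pi hr (by linarith)
  rw [← mul_pow]
  apply pow_le_pow_left₀ (mul_nonneg hr0 hc.le)
  rcases le_total s (π / 2) with h | h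
  · calc sin r * cos (s / 2) ≤ sin r * 1 := by
          gcongr; exact cos_le_one _
      _ ≤ sin s := by
          rw [mul_one]; exact sin_le_sin_of_le_of_le_pi_div_two (by linarith) h hrs
  · calc sin r * cos (s / 2) ≤ 1 * cos (s / 2) := by
          gcongr; exact sin_le_one _
      _ ≤ 2 * sin (s / 2) * cos (s / 2) := by
          have : sin (π / 6) ≤ sin (s / 2) :=
            sin_le_sin_of_le_of_le_pi_div_two (by linarith) (by linarith) (by linarith)
          rw [sin_pi_div_six] at this
          gcongr; linarith
      _ = sin s := by rw [← sin_two_mul]; congr 1; ring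

theorem hasDerivAt_sin_pow (n : ℕ) {t : ℝ} (ht : sin t ≠ 0) :
    HasDerivAt (fun t => sin t ^ n) (n * (cos t / sin t) * sin t ^ n) t := by
  refine ((hasDerivAt_sin t).fun_pow n).congr_deriv ?_
  rcases n with _ | n
  · simp
  · field_simp
    simp only [Nat.add_sub_cancel]
    ring

/-- The average of `φ` over `[0, s]` with weight `sin ^ n`, normalised by `sin s ^ n`. -/
noncomputable def sinAvg (n : ℕ) (φ : ℝ → ℝ) (s : ℝ) : ℝ :=
  (∫ r in (0 : ℝ)..s, sin r ^ n * φ r) / sin s ^ n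

theorem abs_sinAvg_le {n : ℕ} {φ : ℝ → ℝ} {s B : ℝ} (hs : s ∈ Ico 0 π)
    (hB : ∀ r ∈ Icc 0 s, |φ r| ≤ B) : |sinAvg n φ s| ≤ s * (B / cos (s / 2) ^ n) := by
  have hc : 0 < cos (s / 2) := cos_pos_of_mem_Ioo ⟨by linarith [pi_pos, hs.1], by linarith [hs.2]⟩
  have hc' : 0 < cos (s / 2) ^ n := pow_pos hc n
  have hB0 : 0 ≤ B := (abs_nonneg _).trans (hB 0 ⟨le_rfl, hs.1⟩)
  have hs0 : 0 ≤ sin s := sin_nonneg_of_nonneg_of_le_pi hs.1 hs.2.le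
  have h1 : ‖∫ r in (0 : ℝ)..s, sin r ^ n * φ r‖ ≤ (sin s ^ n / cos (s / 2) ^ n * B) * |s - 0| := by
    apply intervalIntegral.norm_integral_le_of_norm_le_const
    intro r hr
    rw [uIoc_of_le hs.1] at hr
    have hr0 : 0 ≤ sin r := sin_nonneg_of_nonneg_of_le_pi hr.1.le (by linarith [hr.2, hs.2])
    rw [norm_mul, norm_pow, norm_eq_abs, norm_eq_abs, abs_of_nonneg hr0]
    gcongr
    · rw [le_div_iff₀ hc']
      exact sin_pow_le n hr.1.le hr.2 hs.2
    · exact hB r ⟨hr.1.le, hr.2⟩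
  rw [norm_eq_abs, sub_zero, abs_of_nonneg hs.1] at h1
  have hh : 0 ≤ sin s ^ n := pow_nonneg hs0 n
  rw [sinAvg, abs_div, abs_of_nonneg hh]
  apply div_le_of_le_mul₀ hh (by have := hs.1; positivity)
  calc _ ≤ _ := h1
    _ = _ := by ring

theorem hasDerivAt_sinAvg {n : ℕ} {φ : ℝ → ℝ} (hφ : ContinuousOn φ (Ico 0 π)) {t : ℝ}
    (ht : t ∈ Ioo 0 π) :
    HasDerivAt (sinAvg n φ) (φ t - n * (cos t / sin t) * sinAvg n φ t) t := by
  have hs0 : 0 < sin t := sin_pos_of_mem_Ioo ht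
  have hF : ContinuousOn (fun r => sin r ^ n * φ r) (Ico 0 π) :=
    ((continuous_sin.pow n).continuousOn).mul hφ
  have h1 : HasDerivAt (fun s => ∫ r in (0 : ℝ)..s, sin r ^ n * φ r) (sin t ^ n * φ t) t := by
    apply intervalIntegral.integral_hasDerivAt_right
    · apply ContinuousOn.intervalIntegrable
      rw [uIcc_of_le ht.1.le]
      exact hF.mono fun x hx => ⟨hx.1, hx.2.trans_lt ht.2⟩
    · apply (hF.mono Ioo_subset_Ico_self).stronglyMeasurableAtFilter isOpen_Ioo t ht
    · exact hF.continuousAt (Ico_mem_nhds ht.1 ht.2)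
  refine (h1.fun_div (hasDerivAt_sin_pow n hs0.ne') (pow_pos hs0 n).ne').congr_deriv ?_
  have := (pow_pos hs0 n).ne'
  rw [sinAvg]
  field_simp

theorem continuousOn_sinAvg {n : ℕ} {φ : ℝ → ℝ} (hφ : ContinuousOn φ (Ico 0 π)) {B : ℝ}
    (hB : ∀ r ∈ Ico 0 π, |φ r| ≤ B) : ContinuousOn (sinAvg n φ) (Ico 0 π) := by
  intro t ht
  rcases ht.1.eq_or_lt with h | h
  · subst h
    have h0 : sinAvg n φ 0 = 0 := by simp [sinAvg]
    rw [ContinuousWithinAt, h0]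
    have hc : ContinuousAt (fun s => s * (B / cos (s / 2) ^ n)) 0 := by
      apply ContinuousAt.mul continuousAt_id
      apply ContinuousAt.div continuousAt_const
      · fun_prop
      · simp
    have hc' := hc.continuousWithinAt (s := Ico 0 π)
    rw [ContinuousWithinAt] at hc'
    simp only [zero_mul] at hc'
    apply squeeze_zero_norm' _ hc'
    filter_upwards [self_mem_nhdsWithin] with s hs
    exact abs_sinAvg_le hs fun r hr => hB r ⟨hr.1, hr.2.trans_lt hs.2⟩
  · exact (hasDerivAt_sinAvg hφ ⟨h, ht.2⟩).continuousAt.continuousWithinAt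

theorem abs_integral_le_of_le_weight {ℓ W q : ℝ → ℝ} {c B : ℝ} (hc : 0 < c) (hB : 0 ≤ B)
    (hℓ : ContinuousOn ℓ (Ico 0 π)) (hW : ∀ t ∈ Ico 0 π, HasDerivAt W (c * ℓ t * W t) t)
    (hW0 : 0 ≤ W 0)
    (hq : ∀ t ∈ Ico 0 π, |q t| ≤ B * (ℓ t * W t)) {t : ℝ} (ht : t ∈ Ico 0 π) :
    |∫ s in (0 : ℝ)..t, q s| ≤ B / c * W t := by
  have hsub : Icc 0 t ⊆ Ico 0 π := fun x hx => ⟨hx.1, hx.2.trans_lt ht.2⟩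
  have hWc : ContinuousOn W (Ico 0 π) := fun x hx => (hW x hx).continuousAt.continuousWithinAt
  have hint : ∫ s in (0 : ℝ)..t, B * (ℓ s * W s) = B / c * W t - B / c * W 0 := by
    apply intervalIntegral.integral_eq_sub_of_hasDerivAt (f := fun s => B / c * W s)
    · intro x hx
      rw [uIcc_of_le ht.1] at hx
      refine ((hW x (hsub hx)).const_mul (B / c)).congr_deriv ?_
      field_simp
    · apply ContinuousOn.intervalIntegrable
      rw [uIcc_of_le ht.1]
      exact (continuousOn_const.mul (hℓ.mul hWc)).mono hsub
  have h := intervalIntegral.norm_integral_le_of_norm_le (f := q) (g := fun s => B * (ℓ s * W s))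
    (μ := MeasureTheory.volume) ht.1
    (Filter.Eventually.of_forall fun s hs => hq s (hsub ⟨hs.1.le, hs.2⟩))
    (by
      apply ContinuousOn.intervalIntegrable
      rw [uIcc_of_le ht.1]
      exact (continuousOn_const.mul (hℓ.mul hWc)).mono hsub)
  rw [hint, norm_eq_abs] at h
  have : 0 ≤ B / c * W 0 := by positivity
  linarith

/-- A weight growing fast enough at `π` to make the integral operator a contraction. -/
theorem exists_weight (n : ℕ) {c : ℝ} (hc : 0 ≤ c) : ∃ W : ℝ → ℝ, W 0 = 1 ∧
    (∀ t ∈ Ico 0 π, HasDerivAt W (c * (π / cos (t / 2) ^ n) * W t) t) ∧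
    (∀ t ∈ Ico 0 π, 1 ≤ W t) ∧ MonotoneOn W (Ico 0 π) := by
  have hpos : ∀ t ∈ Ioo (-π) π, 0 < cos (t / 2) ^ n := fun t ht =>
    pow_pos (cos_pos_of_mem_Ioo ⟨by linarith [ht.1], by linarith [ht.2]⟩) n
  have hcont : ContinuousOn (fun t => c * (π / cos (t / 2) ^ n)) (Ioo (-π) π) := by
    apply ContinuousOn.mul continuousOn_const
    apply ContinuousOn.div continuousOn_const (by fun_prop)
    exact fun t ht => (hpos t ht).ne'
  have hd : ∀ t ∈ Ico 0 π, HasDerivAt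
      (fun t => ∫ s in (0 : ℝ)..t, c * (π / cos (s / 2) ^ n)) (c * (π / cos (t / 2) ^ n)) t := by
    intro t ht
    have ht' : t ∈ Ioo (-π) π := ⟨by linarith [ht.1, pi_pos], ht.2⟩
    apply intervalIntegral.integral_hasDerivAt_right
    · apply ContinuousOn.intervalIntegrable
      rw [uIcc_of_le ht.1]
      exact hcont.mono fun x hx => ⟨by linarith [hx.1, pi_pos], hx.2.trans_lt ht.2⟩
    · exact hcont.stronglyMeasurableAtFilter isOpen_Ioo t ht'
    · exact hcont.continuousAt (Ioo_mem_nhds ht'.1 ht'.2)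
  have hW : ∀ t ∈ Ico 0 π, HasDerivAt
      (fun t => exp (∫ s in (0 : ℝ)..t, c * (π / cos (s / 2) ^ n)))
      (c * (π / cos (t / 2) ^ n) * exp (∫ s in (0 : ℝ)..t, c * (π / cos (s / 2) ^ n))) t :=
    fun t ht => (hd t ht).exp.congr_deriv (mul_comm _ _)
  have hmono : MonotoneOn (fun t => exp (∫ s in (0 : ℝ)..t, c * (π / cos (s / 2) ^ n)))
      (Ico 0 π) := by
    apply monotoneOn_of_hasDerivWithinAt_nonneg (convex_Ico 0 π)
      (fun x hx => (hW x hx).continuousAt.continuousWithinAt)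
      (fun x hx => (hW x (interior_subset hx)).hasDerivWithinAt)
    intro x hx
    have hx' := interior_subset hx
    have := hpos x ⟨by linarith [hx'.1, pi_pos], hx'.2⟩
    have := pi_pos
    positivity
  refine ⟨_, by simp, hW, fun t ht => ?_, hmono⟩
  have := hmono ⟨le_rfl, pi_pos⟩ ht ht.1
  simpa using this

theorem exists_isShot {n : ℕ} {g : ℝ → ℝ} {L : NNReal} {G : ℝ} (hL : LipschitzWith L g)
    (hG : ∀ x, |g x| ≤ G) (α : ℝ) : ∃ u v, IsShot n g α u v := by
  classical
  have hG0 : 0 ≤ G := (abs_nonneg _).trans (hG 0)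
  set c : ℝ := 2 * (L + 1) with hcdef
  have hc : 0 < c := by positivity
  obtain ⟨W, hW0, hW, hW1, hWm⟩ := exists_weight n hc.le
  set ℓ : ℝ → ℝ := fun t => π / cos (t / 2) ^ n with hℓdef
  have hcos : ∀ t ∈ Ico 0 π, 0 < cos (t / 2) ^ n := fun t ht =>
    pow_pos (cos_pos_of_mem_Ioo ⟨by linarith [ht.1, pi_pos], by linarith [ht.2]⟩) n
  have hℓ : ContinuousOn ℓ (Ico 0 π) :=
    ContinuousOn.div continuousOn_const (by fun_prop) fun t ht => (hcos t ht).ne'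
  have hℓ0 : ∀ t ∈ Ico 0 π, 0 ≤ ℓ t := fun t ht => div_nonneg pi_pos.le (hcos t ht).le
  have hWc : ContinuousOn W (Ico 0 π) := fun x hx => (hW x hx).continuousAt.continuousWithinAt
  have hWpos : ∀ t ∈ Ico 0 π, 0 < W t := fun t ht => one_pos.trans_le (hW1 t ht)
  let X := BoundedContinuousFunction (Ico (0 : ℝ) π) ℝ
  let ext : X → ℝ → ℝ := fun w s => if h : s ∈ Ico 0 π then w ⟨s, h⟩ else 0
  have hext : ∀ w, ContinuousOn (ext w) (Ico 0 π) := by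
    intro w
    rw [continuousOn_iff_continuous_domRestrict]
    convert w.continuous using 1
    ext s
    simp [ext, s.2.1, s.2.2]
  let U : X → ℝ → ℝ := fun w s => W s * ext w s
  have hU : ∀ w, ContinuousOn (U w) (Ico 0 π) := fun w => hWc.mul (hext w)
  have hgU : ∀ w, ContinuousOn (fun s => g (U w s)) (Ico 0 π) := fun w =>
    hL.continuous.comp_continuousOn (hU w)
  let q : X → ℝ → ℝ := fun w => sinAvg n fun s => g (U w s)
  have hq : ∀ w, ContinuousOn (q w) (Ico 0 π) := fun w =>
    continuousOn_sinAvg (hgU w) fun r _ => hG _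
  have hqint : ∀ w, ∀ t ∈ Ico 0 π, IntervalIntegrable (q w) MeasureTheory.volume 0 t := by
    intro w t ht
    apply ContinuousOn.intervalIntegrable
    rw [uIcc_of_le ht.1]
    exact (hq w).mono fun x hx => ⟨hx.1, hx.2.trans_lt ht.2⟩
  have hI : ∀ w, ContinuousOn (fun t => ∫ s in (0 : ℝ)..t, q w s) (Ico 0 π) := by
    intro w t ht
    have hT : (t + π) / 2 ∈ Ico 0 π := ⟨by linarith [ht.1, pi_pos], by linarith [ht.2]⟩
    have h := intervalIntegral.continuousOn_primitive_interval' (hqint w _ hT) left_mem_uIcc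
    rw [uIcc_of_le hT.1] at h
    refine (h t ⟨ht.1, by linarith [ht.2]⟩).mono_of_mem_nhdsWithin ?_
    filter_upwards [self_mem_nhdsWithin, mem_nhdsWithin_of_mem_nhds
      (Iio_mem_nhds (show t < (t + π) / 2 by linarith [ht.2]))] with x hx hx'
    exact ⟨hx.1, hx'.le⟩
  have hqb : ∀ w, ∀ t ∈ Ico 0 π, |q w t| ≤ G * (ℓ t * W t) := by
    intro w t ht
    refine (abs_sinAvg_le ht fun r _ => hG _).trans ?_
    have := hcos t ht
    have := hW1 t ht
    calc t * (G / cos (t / 2) ^ n) ≤ π * (G / cos (t / 2) ^ n) := by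
          gcongr; exact ht.2.le
      _ = G * (ℓ t * 1) := by simp only [hℓdef]; ring
      _ ≤ _ := by
        have := hℓ0 t ht
        gcongr
  let K : X → X := fun w => BoundedContinuousFunction.ofNormedAddCommGroup
    (fun t : Ico (0 : ℝ) π => (α - ∫ s in (0 : ℝ)..t, q w s) / W t)
    (by
      have : ContinuousOn (fun t => (α - ∫ s in (0 : ℝ)..t, q w s) / W t) (Ico 0 π) :=
        (continuousOn_const.sub (hI w)).div hWc fun t ht => (hWpos t ht).ne'
      exact continuousOn_iff_continuous_domRestrict.1 this)
    (|α| + G / c)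
    (by
      rintro ⟨t, ht⟩
      have h1 := hW1 t ht
      have := abs_integral_le_of_le_weight hc hG0 hℓ hW (by rw [hW0]; exact zero_le_one)
        (hqb w) ht
      rw [norm_eq_abs, abs_div, abs_of_pos (hWpos t ht), div_le_iff₀ (hWpos t ht)]
      calc _ ≤ |α| + |∫ s in (0 : ℝ)..t, q w s| := abs_sub _ _
        _ ≤ |α| * W t + G / c * W t := by
          gcongr
          exact le_mul_of_one_le_right (abs_nonneg _) h1
        _ = _ := by ring)
  have hK : ContractingWith (1 / 2) K := by
    refine ⟨by rw [← NNReal.coe_lt_coe]; norm_num, LipschitzWith.of_dist_le_mul fun w z => ?_⟩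
    rw [BoundedContinuousFunction.dist_le (by positivity)]
    rintro ⟨t, ht⟩
    have hd : (0 : ℝ) ≤ L * dist w z := by positivity
    have hdq : ∀ s ∈ Ico 0 π, |q w s - q z s| ≤ (L * dist w z) * (ℓ s * W s) := by
      intro s hs
      have hcs := hcos s hs
      have hsub : q w s - q z s = sinAvg n (fun r => g (U w r) - g (U z r)) s := by
        simp only [q, sinAvg]
        rw [← sub_div, ← intervalIntegral.integral_sub]
        · simp only [mul_sub]
        all_goals
          apply ContinuousOn.intervalIntegrable
          rw [uIcc_of_le hs.1]
          apply ContinuousOn.mul (by fun_prop)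
        · exact (hgU w).mono fun x hx => ⟨hx.1, hx.2.trans_lt hs.2⟩
        · exact (hgU z).mono fun x hx => ⟨hx.1, hx.2.trans_lt hs.2⟩
      rw [hsub]
      refine (abs_sinAvg_le (B := L * dist w z * W s) hs ?_).trans ?_
      · intro r hr
        have hr' : r ∈ Ico 0 π := ⟨hr.1, hr.2.trans_lt hs.2⟩
        calc |g (U w r) - g (U z r)| ≤ L * |U w r - U z r| := by
              have := hL.dist_le_mul (U w r) (U z r)
              rwa [Real.dist_eq, Real.dist_eq] at this
          _ = L * (W r * |w ⟨r, hr'⟩ - z ⟨r, hr'⟩|) := by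
              simp only [U, ext, dif_pos hr']
              rw [← mul_sub, abs_mul, abs_of_pos (hWpos r hr')]
          _ ≤ L * (W s * dist w z) := by
              have := hWpos s hs
              gcongr
              · exact hWm hr' hs hr.2
              · exact BoundedContinuousFunction.dist_coe_le_dist (f := w) (g := z) ⟨r, hr'⟩
          _ = _ := by ring
      · have := hWpos s hs
        calc s * (L * dist w z * W s / cos (s / 2) ^ n)
            ≤ π * (L * dist w z * W s / cos (s / 2) ^ n) := by
              gcongr; exact hs.2.le
          _ = _ := by simp only [hℓdef]; ring
    have h := abs_integral_le_of_le_weight hc hd hℓ hW (by rw [hW0]; exact zero_le_one) hdq ht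
    rw [intervalIntegral.integral_sub (hqint w t ht) (hqint z t ht)] at h
    have hWt := hWpos t ht
    have e : dist (K w ⟨t, ht⟩) (K z ⟨t, ht⟩)
        = |(∫ s in (0 : ℝ)..t, q w s) - ∫ s in (0 : ℝ)..t, q z s| / W t := by
      change dist ((α - ∫ s in (0 : ℝ)..t, q w s) / W t) ((α - ∫ s in (0 : ℝ)..t, q z s) / W t) = _
      rw [Real.dist_eq, ← sub_div, abs_div, abs_of_pos hWt, abs_sub_comm]
      congr 2
      ring
    rw [e, div_le_iff₀ hWt]
    refine h.trans ?_
    have : (L : ℝ) * dist w z / c ≤ 1 / 2 * dist w z := by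
      rw [div_le_iff₀ hc, hcdef]
      nlinarith [dist_nonneg (x := w) (y := z)]
    push_cast
    gcongr
  have hfix := hK.fixedPoint_isFixedPt
  set w := ContractingWith.fixedPoint K hK with hw
  have hUw : ∀ t ∈ Ico 0 π, U w t = α - ∫ s in (0 : ℝ)..t, q w s := by
    intro t ht
    have h1 : w ⟨t, ht⟩ = (α - ∫ s in (0 : ℝ)..t, q w s) / W t := by
      conv_lhs => rw [← hfix]
      rfl
    simp only [U, ext, dif_pos ht]
    rw [h1, mul_div_cancel₀ _ (hWpos t ht).ne']
  refine ⟨U w, fun t => -q w t, ?_, ?_, hU w, (hq w).neg, ?_, ?_⟩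
  · rw [hUw 0 ⟨le_rfl, pi_pos⟩]; simp
  · simp [q, sinAvg]
  · intro t ht
    have h1 : HasDerivAt (fun t => α - ∫ s in (0 : ℝ)..t, q w s) (-q w t) t := by
      apply HasDerivAt.const_sub
      apply intervalIntegral.integral_hasDerivAt_right (hqint w t ⟨ht.1.le, ht.2⟩)
      · exact ((hq w).mono Ioo_subset_Ico_self).stronglyMeasurableAtFilter isOpen_Ioo t ht
      · exact (hq w).continuousAt (Ico_mem_nhds ht.1 ht.2)
    apply h1.congr_of_eventuallyEq
    filter_upwards [Ico_mem_nhds ht.1 ht.2] with s hs using hUw s hs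
  · intro t ht
    refine (hasDerivAt_sinAvg (n := n) (hgU w) ht).fun_neg.congr_deriv ?_
    simp only [q]
    ring

namespace IsShot

variable {n : ℕ} {g : ℝ → ℝ} {α : ℝ} {u v : ℝ → ℝ}

theorem continuousOn_Icc_u (h : IsShot n g α u v) {a b : ℝ} (ha : 0 ≤ a) (hb : b < π) :
    ContinuousOn u (Icc a b) :=
  h.contu.mono fun _ hx => ⟨ha.trans hx.1, hx.2.trans_lt hb⟩

theorem continuousOn_Icc_v (h : IsShot n g α u v) {a b : ℝ} (ha : 0 ≤ a) (hb : b < π) :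
    ContinuousOn v (Icc a b) :=
  h.contv.mono fun _ hx => ⟨ha.trans hx.1, hx.2.trans_lt hb⟩

theorem hasDerivAt_flux (h : IsShot n g α u v) {t : ℝ} (ht : t ∈ Ioo 0 π) :
    HasDerivAt (fun t => sin t ^ n * v t) (-(sin t ^ n * g (u t))) t := by
  have hs := sin_pos_of_mem_Ioo ht
  refine ((hasDerivAt_sin_pow n hs.ne').fun_mul (h.derv t ht)).congr_deriv ?_
  ring

theorem continuousOn_flux (h : IsShot n g α u v) {a b : ℝ} (ha : 0 ≤ a) (hb : b < π) :
    ContinuousOn (fun t => sin t ^ n * v t) (Icc a b) :=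
  ((continuous_sin.pow n).continuousOn).mul (h.continuousOn_Icc_v ha hb)

theorem exists_dist_le {L : NNReal} (hL : LipschitzWith L g) {T : ℝ} (hT : T ∈ Ioo 0 π) :
    ∃ C : ℝ, 0 < C ∧ ∀ α β u v y z, IsShot n g α u v → IsShot n g β y z →
      ∀ t ∈ Icc 0 T, |u t - y t| ≤ C * |α - β| ∧ |v t - z t| ≤ C * |α - β| := by
  have hsT : 0 < sin T := sin_pos_of_mem_Ioo hT
  set K : ℝ := 1 + L + 2 * n / sin T with hK
  refine ⟨exp (K * T), exp_pos _, fun α β u v y z h1 h2 t ht => ?_⟩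
  have hcot : ∀ s ∈ Ioo 0 T, -(cos s / sin s) ≤ 1 / sin T := by
    intro s hs
    have hss : 0 < sin s := sin_pos_of_mem_Ioo ⟨hs.1, hs.2.trans hT.2⟩
    rcases le_total s (π / 2) with h | h
    · have : 0 ≤ cos s := cos_nonneg_of_mem_Icc ⟨by linarith [pi_pos, hs.1], h⟩
      have : 0 ≤ cos s / sin s := by positivity
      have : 0 ≤ 1 / sin T := by positivity
      linarith
    · have h3 : sin T ≤ sin s := by
        rw [← sin_pi_sub T, ← sin_pi_sub s]
        exact sin_le_sin_of_le_of_le_pi_div_two (by linarith [pi_pos, hT.2]) (by linarith)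
          (by linarith [hs.2])
      rw [← neg_div]
      gcongr
      linarith [neg_one_le_cos s]
  have hd : ∀ s ∈ Ioo 0 t,
      HasDerivAt (fun s => ((u s - y s) ^ 2 + (v s - z s) ^ 2) * exp (-(K * s)))
      ((2 * (u s - y s) * (v s - z s) + 2 * (v s - z s) *
        (-(n * (cos s / sin s)) * (v s - z s) - (g (u s) - g (y s))) -
        K * ((u s - y s) ^ 2 + (v s - z s) ^ 2)) * exp (-(K * s))) s := by
    intro s hs
    have hs' : s ∈ Ioo 0 π := ⟨hs.1, by linarith [hs.2, ht.2, hT.2]⟩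
    have hu := ((h1.deru s hs').fun_sub (h2.deru s hs')).fun_pow 2
    have hv := ((h1.derv s hs').fun_sub (h2.derv s hs')).fun_pow 2
    have he : HasDerivAt (fun s => exp (-(K * s))) (exp (-(K * s)) * (-(K * 1))) s :=
      (((hasDerivAt_id s).const_mul K).fun_neg).exp
    refine ((hu.fun_add hv).fun_mul he).congr_deriv ?_
    norm_num
    ring
  have hle := le_of_hasDerivAt_nonpos
    (F := fun s => ((u s - y s) ^ 2 + (v s - z s) ^ 2) * exp (-(K * s)))
    ht.1 (by
      have a1 := h1.continuousOn_Icc_u (b := t) le_rfl (by linarith [ht.2, hT.2])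
      have a2 := h2.continuousOn_Icc_u (b := t) le_rfl (by linarith [ht.2, hT.2])
      have a3 := h1.continuousOn_Icc_v (b := t) le_rfl (by linarith [ht.2, hT.2])
      have a4 := h2.continuousOn_Icc_v (b := t) le_rfl (by linarith [ht.2, hT.2])
      fun_prop) hd (by
      intro s hs
      apply mul_nonpos_of_nonpos_of_nonneg _ (exp_pos _).le
      have hc := hcot s ⟨hs.1, hs.2.trans_le ht.2⟩
      have hg : |g (u s) - g (y s)| ≤ L * |u s - y s| := by
        have := hL.dist_le_mul (u s) (y s)
        rwa [Real.dist_eq, Real.dist_eq] at this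
      set a := u s - y s
      set b := v s - z s
      set d := g (u s) - g (y s)
      have e1 : 2 * a * b ≤ a ^ 2 + b ^ 2 := by nlinarith [sq_nonneg (a - b)]
      have e2 : -(2 * b * d) ≤ L * (a ^ 2 + b ^ 2) := by
        calc -(2 * b * d) ≤ |2 * b * d| := neg_le_abs _
          _ = 2 * |b| * |d| := by rw [abs_mul, abs_mul, abs_two]
          _ ≤ 2 * |b| * (L * |a|) := by gcongr
          _ = L * (2 * |a| * |b|) := by ring
          _ ≤ L * (|a| ^ 2 + |b| ^ 2) := by
            gcongr; nlinarith [sq_nonneg (|a| - |b|)]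
          _ = _ := by rw [sq_abs, sq_abs]
      have e3 : 2 * b * (-(n * (cos s / sin s)) * b) ≤ 2 * n / sin T * (a ^ 2 + b ^ 2) := by
        calc 2 * b * (-(n * (cos s / sin s)) * b) = 2 * n * b ^ 2 * (-(cos s / sin s)) := by ring
          _ ≤ 2 * n * b ^ 2 * (1 / sin T) := by gcongr
          _ = 2 * n / sin T * (b ^ 2) := by ring
          _ ≤ _ := by gcongr; nlinarith [sq_nonneg a]
      have : K * (a ^ 2 + b ^ 2) = (a ^ 2 + b ^ 2) + L * (a ^ 2 + b ^ 2)
        + 2 * n / sin T * (a ^ 2 + b ^ 2) := by rw [hK]; ring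
      linarith)
  simp only [h1.u_zero, h2.u_zero, h1.v_zero, h2.v_zero] at hle
  rw [exp_neg, ← div_eq_mul_inv, div_le_iff₀ (exp_pos _)] at hle
  have hK0 : 0 ≤ K := by positivity
  have hKt : K * t ≤ K * T := by gcongr; exact ht.2
  have h1e : (1 : ℝ) ≤ exp (K * T) := one_le_exp (by have := hT.1; positivity)
  have hle2 : (u t - y t) ^ 2 + (v t - z t) ^ 2 ≤ (exp (K * T) * |α - β|) ^ 2 := by
    rw [mul_pow, sq_abs]
    calc _ ≤ _ := hle
      _ = (α - β) ^ 2 * exp (K * t) := by simp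
      _ ≤ (α - β) ^ 2 * exp (K * T) ^ 2 := by
        gcongr
        calc exp (K * t) ≤ exp (K * T) := exp_le_exp.2 hKt
          _ ≤ _ := by nlinarith
      _ = _ := by ring
  have hnn : 0 ≤ exp (K * T) * |α - β| := by positivity
  constructor
  · apply abs_le_of_sq_le_sq _ hnn
    nlinarith [sq_nonneg (v t - z t)]
  · apply abs_le_of_sq_le_sq _ hnn
    nlinarith [sq_nonneg (u t - y t)]

theorem eq_of_eq_of_eq_zero {L : NNReal} (hL : LipschitzWith L g) (h : IsShot n g α u v)
    {s t c : ℝ} (hs : 0 < s) (hst : s ≤ t) (ht : t < π) (hc : g c = 0) (hut : u t = c)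
    (hvt : v t = 0) : u s = c := by
  have hπs : 0 < sin s := sin_pos_of_mem_Ioo ⟨hs, by linarith⟩
  have hπt : 0 < sin t := sin_pos_of_mem_Ioo ⟨by linarith, by linarith⟩
  set μ := min (sin s) (sin t) with hμ
  have hμ0 : 0 < μ := lt_min hπs hπt
  have hsin : ∀ r ∈ Icc s t, μ ≤ sin r := by
    intro r hr
    rcases le_total r (π / 2) with h | h
    · exact (min_le_left _ _).trans
        (sin_le_sin_of_le_of_le_pi_div_two (by linarith [pi_pos]) h hr.1)
    · refine (min_le_right _ _).trans ?_
      rw [← sin_pi_sub t, ← sin_pi_sub r]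
      exact sin_le_sin_of_le_of_le_pi_div_two (by linarith [pi_pos]) (by linarith)
          (by linarith [hr.2])
  set K : ℝ := 1 + L + 2 * n / μ with hK
  have hle := le_of_hasDerivAt_nonneg (F := fun r => ((u r - c) ^ 2 + (v r) ^ 2) * exp (K * r))
    (F' := fun r => (2 * (u r - c) * v r + 2 * v r *
        (-(n * (cos r / sin r)) * v r - (g (u r) - g c)) +
        K * ((u r - c) ^ 2 + (v r) ^ 2)) * exp (K * r)) hst (by
      have a1 := h.continuousOn_Icc_u hs.le ht
      have a3 := h.continuousOn_Icc_v hs.le ht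
      fun_prop) (by
      intro r hr
      have hr' : r ∈ Ioo 0 π := ⟨hs.trans hr.1, hr.2.trans ht⟩
      have hu := ((h.deru r hr').sub_const c).fun_pow 2
      have hv := (h.derv r hr').fun_pow 2
      have he : HasDerivAt (fun s => exp (K * s)) (exp (K * r) * (K * 1)) r :=
        ((hasDerivAt_id r).const_mul K).exp
      refine ((hu.fun_add hv).fun_mul he).congr_deriv ?_
      rw [hc]
      norm_num
      ring) (by
      intro r hr
      apply mul_nonneg _ (exp_pos _).le
      have hg : |g (u r) - g c| ≤ L * |u r - c| := by
        have := hL.dist_le_mul (u r) c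
        rwa [Real.dist_eq, Real.dist_eq] at this
      have hsr := hsin r ⟨hr.1.le, hr.2.le⟩
      have hcot : cos r / sin r ≤ 1 / μ := by
        have : 0 < sin r := hμ0.trans_le hsr
        rw [div_le_div_iff₀ this hμ0]
        nlinarith [cos_le_one r]
      set a := u r - c
      set b := v r
      set d := g (u r) - g c
      have e1 : -(2 * a * b) ≤ a ^ 2 + b ^ 2 := by nlinarith [sq_nonneg (a + b)]
      have e2 : 2 * b * d ≤ L * (a ^ 2 + b ^ 2) := by
        calc 2 * b * d ≤ |2 * b * d| := le_abs_self _
          _ = 2 * |b| * |d| := by rw [abs_mul, abs_mul, abs_two]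
          _ ≤ 2 * |b| * (L * |a|) := by gcongr
          _ = L * (2 * |a| * |b|) := by ring
          _ ≤ L * (|a| ^ 2 + |b| ^ 2) := by
            gcongr; nlinarith [sq_nonneg (|a| - |b|)]
          _ = _ := by rw [sq_abs, sq_abs]
      have e3 : 2 * b * (n * (cos r / sin r) * b) ≤ 2 * n / μ * (a ^ 2 + b ^ 2) := by
        calc 2 * b * (n * (cos r / sin r) * b) = 2 * n * b ^ 2 * (cos r / sin r) := by ring
          _ ≤ 2 * n * b ^ 2 * (1 / μ) := by gcongr
          _ = 2 * n / μ * (b ^ 2) := by ring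
          _ ≤ _ := by gcongr; nlinarith [sq_nonneg a]
      have : K * (a ^ 2 + b ^ 2) = (a ^ 2 + b ^ 2) + L * (a ^ 2 + b ^ 2)
        + 2 * n / μ * (a ^ 2 + b ^ 2) := by rw [hK]; ring
      linarith)
  simp only [hut, hvt, sub_self] at hle
  norm_num at hle
  have h2 : (u s - c) ^ 2 + v s ^ 2 ≤ 0 := nonpos_of_mul_nonpos_left hle (exp_pos _)
  nlinarith [sq_nonneg (u s - c), sq_nonneg (v s), pow_eq_zero_iff (two_ne_zero) |>.1
    (le_antisymm (by nlinarith [sq_nonneg (v s)]) (sq_nonneg (u s - c)) : (u s - c) ^ 2 = 0)]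

/-- While `u > 1` on `[0, s]`, the solution is decreasing. -/
theorem v_neg_of_one_lt (h : IsShot n g α u v) (hg : ∀ x, 1 < x → 0 < g x) {s : ℝ}
    (hs : s ∈ Ioo 0 π) (hu : ∀ r ∈ Icc 0 s, 1 < u r) : v s < 0 := by
  have := lt_of_hasDerivAt_neg hs.1 (h.continuousOn_flux le_rfl hs.2)
    (fun t ht => h.hasDerivAt_flux ⟨ht.1, ht.2.trans hs.2⟩) (by
      intro t ht
      have := pow_pos (sin_pos_of_mem_Ioo ⟨ht.1, ht.2.trans hs.2⟩) n
      have := hg _ (hu t ⟨ht.1.le, ht.2.le⟩)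
      have := mul_pos ‹0 < sin t ^ n› this
      linarith)
  rw [h.v_zero, mul_zero] at this
  exact (pos_iff_neg_of_mul_neg this).1 (pow_pos (sin_pos_of_mem_Ioo hs) n)

end IsShot

theorem exists_Icc_subset_of_mem_nhds {x : ℝ} {S : Set ℝ} (hS : S ∈ nhds x) :
    ∃ ε > 0, Icc (x - ε) (x + ε) ⊆ S := by
  obtain ⟨ε, hε, h⟩ := Metric.nhds_basis_closedBall.mem_iff.1 hS
  exact ⟨ε, hε, by rwa [← Real.closedBall_eq_Icc]⟩

theorem exists_pos_forall_le {f : ℝ → ℝ} {a b : ℝ} (hab : a ≤ b) (hf : ContinuousOn f (Icc a b))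
    (hpos : ∀ x ∈ Icc a b, 0 < f x) : ∃ ε > 0, ∀ x ∈ Icc a b, ε ≤ f x := by
  obtain ⟨x, hx, hmin⟩ := isCompact_Icc.exists_isMinOn (nonempty_Icc.2 hab) hf
  exact ⟨f x, hpos x hx, fun y hy => hmin hy⟩

/-- The derivative becomes positive while the function is still positive. -/
def Turns (u v : ℝ → ℝ) : Prop :=
  ∃ a ∈ Ioo 0 π, 0 < v a ∧ ∀ s ∈ Icc 0 a, 0 < u s

/-- The function starts above `1` and becomes negative while it is still decreasing. -/
def Crosses (u v : ℝ → ℝ) : Prop :=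
  ∃ s b, 0 < s ∧ s < b ∧ b < π ∧ (∀ r ∈ Icc 0 s, 1 < u r) ∧ (∀ r ∈ Icc s b, v r < 0) ∧ u b < 0

/-- The function is positive and decreasing on the whole interval. -/
def Descends (u v : ℝ → ℝ) : Prop :=
  ∀ t ∈ Ioo 0 π, 0 < u t ∧ v t < 0

/-- The sign pattern of `x ^ (p - 1) - x`. -/
structure IsBistable (g : ℝ → ℝ) : Prop where
  zero : g 0 = 0
  one : g 1 = 0
  neg : ∀ x ∈ Ioo (0 : ℝ) 1, g x < 0
  pos : ∀ x, 1 < x → 0 < g x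

namespace IsShot

variable {n : ℕ} {g : ℝ → ℝ} {α : ℝ} {u v : ℝ → ℝ}

theorem continuousAt_u (h : IsShot n g α u v) {t : ℝ} (ht : t ∈ Ioo 0 π) : ContinuousAt u t :=
  (h.deru t ht).continuousAt

theorem continuousAt_v (h : IsShot n g α u v) {t : ℝ} (ht : t ∈ Ioo 0 π) : ContinuousAt v t :=
  (h.derv t ht).continuousAt

theorem exists_one_lt (h : IsShot n g α u v) (hα : 1 < α) :
    ∃ s ∈ Ioo 0 π, ∀ r ∈ Icc 0 s, 1 < u r := by
  have h0 := h.contu 0 ⟨le_rfl, pi_pos⟩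
  rw [ContinuousWithinAt, nhdsWithin_Ico_eq_nhdsGE pi_pos, h.u_zero] at h0
  obtain ⟨s, hs, hsub⟩ := mem_nhdsGE_iff_exists_Icc_subset.1 (h0.eventually (lt_mem_nhds hα))
  have hs : 0 < s := hs
  refine ⟨min s (π / 2), ⟨lt_min hs (by linarith [pi_pos]), ?_⟩, fun r hr => hsub ⟨hr.1, ?_⟩⟩
  · exact (min_le_right _ _).trans_lt (by linarith [pi_pos])
  · exact hr.2.trans (min_le_left _ _)

/-- At the first zero of `v`, the reaction term is nonpositive. -/
theorem reaction_nonpos (h : IsShot n g α u v) (hg : Continuous g) {s t : ℝ} (hs : 0 ≤ s)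
    (hst : s < t) (ht : t < π) (hv : ∀ r ∈ Ioo s t, v r < 0) (hvt : v t = 0) : g (u t) ≤ 0 := by
  by_contra! hpos
  have hπ : t ∈ Ioo 0 π := ⟨hs.trans_lt hst, ht⟩
  obtain ⟨ε, hε, hsub⟩ := exists_Icc_subset_of_mem_nhds
    (Filter.inter_mem ((hg.continuousAt.comp (h.continuousAt_u hπ)).eventually (lt_mem_nhds hpos))
      (Ioo_mem_nhds hst ht))
  have hm : t - ε ∈ Icc (t - ε) (t + ε) := ⟨le_rfl, by linarith⟩
  have h1 := (hsub hm).2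
  have := lt_of_hasDerivAt_neg (show t - ε < t by linarith)
    (h.continuousOn_flux (hs.trans h1.1.le) ht)
    (fun r hr => h.hasDerivAt_flux ⟨by linarith [hr.1, h1.1], hr.2.trans ht⟩) (by
      intro r hr
      have := pow_pos (sin_pos_of_mem_Ioo ⟨by linarith [hr.1, h1.1], hr.2.trans ht⟩) n
      have h2 : 0 < g (u r) := (hsub ⟨hr.1.le, by linarith [hr.2]⟩).1
      have := mul_pos ‹0 < sin r ^ n› h2
      linarith)
  rw [hvt, mul_zero] at this
  have h3 := hv _ ⟨h1.1, by linarith⟩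
  have := pow_pos (sin_pos_of_mem_Ioo ⟨by linarith [h1.1], h1.2⟩) n
  nlinarith

theorem turns_or_crosses_or_descends {L : NNReal} (hL : LipschitzWith L g) (hg : IsBistable g)
    (h : IsShot n g α u v) (hα : 1 < α) : Turns u v ∨ Crosses u v ∨ Descends u v := by
  by_contra! ⟨hA, hB, hC⟩
  obtain ⟨s, hs, hus⟩ := h.exists_one_lt hα
  have hvs : ∀ r ∈ Ioc 0 s, v r < 0 := fun r hr =>
    h.v_neg_of_one_lt hg.pos ⟨hr.1, hr.2.trans_lt hs.2⟩ fun x hx => hus x ⟨hx.1, hx.2.trans hr.2⟩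
  obtain ⟨t, ht, hbad⟩ : ∃ t ∈ Ioo 0 π, u t ≤ 0 ∨ 0 ≤ v t := by
    by_contra! hh
    exact hC fun t ht => hh t ht
  have hst : s < t := by
    by_contra! hts
    rcases hbad with hb | hb
    · linarith [hus t ⟨ht.1.le, hts⟩]
    · linarith [hvs t ⟨ht.1, hts⟩]
  have huc := h.continuousOn_Icc_u hs.1.le ht.2
  have hvc := h.continuousOn_Icc_v hs.1.le ht.2
  have hcpt : IsCompact (Icc s t ∩ u ⁻¹' Iic 0 ∪ Icc s t ∩ v ⁻¹' Ici 0) :=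
    (isCompact_Icc.of_isClosed_subset (huc.preimage_isClosed_of_isClosed isClosed_Icc isClosed_Iic)
      inter_subset_left).union
    (isCompact_Icc.of_isClosed_subset (hvc.preimage_isClosed_of_isClosed isClosed_Icc isClosed_Ici)
      inter_subset_left)
  obtain ⟨τ, hτ, hleast⟩ := hcpt.exists_isLeast (by
    rcases hbad with hb | hb
    · exact ⟨t, Or.inl ⟨⟨hst.le, le_rfl⟩, hb⟩⟩
    · exact ⟨t, Or.inr ⟨⟨hst.le, le_rfl⟩, hb⟩⟩)
  have hτI : τ ∈ Icc s t := by rcases hτ with h | h <;> exact h.1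
  have hτb : u τ ≤ 0 ∨ 0 ≤ v τ := by
    rcases hτ with h | h
    · exact Or.inl h.2
    · exact Or.inr h.2
  have hsτ : s < τ := by
    rcases hτI.1.eq_or_lt with he | he
    · rw [← he] at hτb
      rcases hτb with hb | hb
      · linarith [hus s ⟨hs.1.le, le_rfl⟩]
      · linarith [hvs s ⟨hs.1, le_rfl⟩]
    · exact he
  have hτπ : τ < π := hτI.2.trans_lt ht.2
  have hτ' : τ ∈ Ioo 0 π := ⟨hs.1.trans hsτ, hτπ⟩
  have hbefore : ∀ r ∈ Ico s τ, 0 < u r ∧ v r < 0 := by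
    intro r hr
    have hrI : r ∈ Icc s t := ⟨hr.1, hr.2.le.trans hτI.2⟩
    constructor
    · by_contra! hh
      exact absurd (hleast (Or.inl ⟨hrI, hh⟩)) (not_le.2 hr.2)
    · by_contra! hh
      exact absurd (hleast (Or.inr ⟨hrI, hh⟩)) (not_le.2 hr.2)
  have hu0 : 0 ≤ u τ := by
    have hlim : Filter.Tendsto u (nhdsWithin τ (Iio τ)) (nhds (u τ)) :=
      (h.continuousAt_u hτ').tendsto.mono_left nhdsWithin_le_nhds
    refine ge_of_tendsto hlim ?_
    filter_upwards [Ioo_mem_nhdsLT hsτ] with r hr using (hbefore r ⟨hr.1.le, hr.2⟩).1.le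
  have hv0 : v τ ≤ 0 := by
    have hlim : Filter.Tendsto v (nhdsWithin τ (Iio τ)) (nhds (v τ)) :=
      (h.continuousAt_v hτ').tendsto.mono_left nhdsWithin_le_nhds
    refine le_of_tendsto hlim ?_
    filter_upwards [Ioo_mem_nhdsLT hsτ] with r hr using (hbefore r ⟨hr.1.le, hr.2⟩).2.le
  rcases hv0.lt_or_eq with hvτ | hvτ
  · obtain ⟨ε, hε, hsub⟩ := exists_Icc_subset_of_mem_nhds
      (Filter.inter_mem ((h.continuousAt_v hτ').eventually (gt_mem_nhds hvτ))
        (Ioo_mem_nhds hsτ hτπ))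
    have huτ : u τ = 0 := le_antisymm (hτb.resolve_right (not_le.2 hvτ)) hu0
    have h1 := (hsub (show τ + ε ∈ Icc (τ - ε) (τ + ε) from ⟨by linarith, le_rfl⟩)).2
    have hv' : ∀ r ∈ Icc τ (τ + ε), v r < 0 := fun r hr =>
      (hsub ⟨by linarith [hr.1], hr.2⟩).1
    refine hB ⟨s, τ + ε, hs.1, h1.1, h1.2, hus, fun r hr => ?_, ?_⟩
    · rcases lt_or_ge r τ with h | h
      · exact (hbefore r ⟨hr.1, h⟩).2
      · exact hv' r ⟨h, hr.2⟩
    · rw [← huτ]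
      exact lt_of_hasDerivAt_neg (by linarith) (h.continuousOn_Icc_u hτ'.1.le h1.2)
        (fun r hr => h.deru r ⟨hτ'.1.trans hr.1, hr.2.trans h1.2⟩)
        (fun r hr => hv' r ⟨hr.1.le, hr.2.le⟩)
  · have hgτ := h.reaction_nonpos hL.continuous hs.1.le hsτ hτπ
      (fun r hr => (hbefore r ⟨hr.1.le, hr.2⟩).2) hvτ
    have hu1 : u τ ≤ 1 := by
      by_contra! hh
      exact absurd (hg.pos _ hh) (not_lt.2 hgτ)
    have hs1 := hus s ⟨hs.1.le, le_rfl⟩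
    rcases hu0.eq_or_lt with he | hu0
    · have := h.eq_of_eq_of_eq_zero hL hs.1 hsτ.le hτπ hg.zero he.symm hvτ
      linarith
    rcases hu1.eq_or_lt with he | hu1
    · have := h.eq_of_eq_of_eq_zero hL hs.1 hsτ.le hτπ hg.one he hvτ
      linarith
    obtain ⟨ε, hε, hsub⟩ := exists_Icc_subset_of_mem_nhds
      (Filter.inter_mem ((h.continuousAt_u hτ').eventually (Ioo_mem_nhds hu0 hu1))
        (Ioo_mem_nhds hsτ hτπ))
    have h1 := (hsub (show τ + ε ∈ Icc (τ - ε) (τ + ε) from ⟨by linarith, le_rfl⟩)).2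
    have hu' : ∀ r ∈ Icc τ (τ + ε), u r ∈ Ioo 0 1 := fun r hr =>
      (hsub ⟨by linarith [hr.1], hr.2⟩).1
    have h1π : τ + ε ∈ Ioo 0 π := ⟨by linarith [hτ'.1], h1.2⟩
    refine hA ⟨τ + ε, h1π, ?_, fun r hr => ?_⟩
    · have := lt_of_hasDerivAt_neg (F := fun t => -(sin t ^ n * v t))
        (show τ < τ + ε by linarith) (h.continuousOn_flux hτ'.1.le h1.2).neg
        (fun r hr => (h.hasDerivAt_flux ⟨hτ'.1.trans hr.1, hr.2.trans h1.2⟩).fun_neg) (by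
          intro r hr
          have := pow_pos (sin_pos_of_mem_Ioo ⟨hτ'.1.trans hr.1, hr.2.trans h1.2⟩) n
          have := hg.neg _ (hu' r ⟨hr.1.le, hr.2.le⟩)
          have := mul_neg_of_pos_of_neg ‹0 < sin r ^ n› this
          linarith)
      rw [hvτ, mul_zero, neg_zero, neg_lt_zero] at this
      exact (pos_iff_pos_of_mul_pos this).1 (pow_pos (sin_pos_of_mem_Ioo h1π) n)
    · rcases le_or_gt r s with h | h
      · linarith [hus r ⟨hr.1, h⟩]
      · rcases lt_or_ge r τ with h' | h'
        · exact (hbefore r ⟨h.le, h'⟩).1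
        · exact (hu' r ⟨h', hr.2⟩).1

theorem not_crosses_of_turns (hg : IsBistable g) (h : IsShot n g α u v) (hA : Turns u v) :
    ¬ Crosses u v := by
  rintro ⟨s, b, hs, hsb, hb, hus, hvs, hub⟩
  obtain ⟨a, ha, hva, hua⟩ := hA
  rcases le_or_gt b a with h1 | h1
  · linarith [hua b ⟨by linarith, h1⟩]
  · rcases le_or_gt a s with h2 | h2
    · have := h.v_neg_of_one_lt hg.pos ha fun r hr => hus r ⟨hr.1, hr.2.trans h2⟩
      linarith
    · linarith [hvs a ⟨h2.le, h1.le⟩]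

end IsShot

section Family

variable {n : ℕ} {g : ℝ → ℝ} {U V : ℝ → ℝ → ℝ} {L : NNReal}

theorem isOpen_turns (hL : LipschitzWith L g) (h : ∀ α, IsShot n g α (U α) (V α)) :
    IsOpen {α | Turns (U α) (V α)} := by
  rw [Metric.isOpen_iff]
  rintro α ⟨a, ha, hva, hua⟩
  obtain ⟨C, hC, hdist⟩ := IsShot.exists_dist_le (n := n) hL ha
  obtain ⟨ε, hε, hle⟩ := exists_pos_forall_le ha.1.le ((h α).continuousOn_Icc_u le_rfl ha.2) hua
  refine ⟨min ε (V α a) / C, by positivity, fun β hβ => ?_⟩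
  rw [Metric.mem_ball, Real.dist_eq, lt_div_iff₀ hC, mul_comm, abs_sub_comm, lt_min_iff] at hβ
  refine ⟨a, ha, ?_, fun s hs => ?_⟩
  · have := (hdist α β _ _ _ _ (h α) (h β) a ⟨ha.1.le, le_rfl⟩).2
    linarith [le_abs_self (V α a - V β a)]
  · have := (hdist α β _ _ _ _ (h α) (h β) s hs).1
    linarith [le_abs_self (U α s - U β s), hle s hs]

theorem isOpen_crosses (hL : LipschitzWith L g) (h : ∀ α, IsShot n g α (U α) (V α)) :
    IsOpen {α | Crosses (U α) (V α)} := by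
  rw [Metric.isOpen_iff]
  rintro α ⟨s, b, hs, hsb, hb, hus, hvs, hub⟩
  obtain ⟨C, hC, hdist⟩ := IsShot.exists_dist_le (n := n) hL ⟨hs.trans hsb, hb⟩
  obtain ⟨ε, hε, hle⟩ := exists_pos_forall_le (f := fun r => U α r - 1) hs.le
    (((h α).continuousOn_Icc_u le_rfl (hsb.trans hb)).sub continuousOn_const)
    fun r hr => sub_pos.2 (hus r hr)
  obtain ⟨δ, hδ, hle'⟩ := exists_pos_forall_le (f := fun r => -V α r) hsb.le
    ((h α).continuousOn_Icc_v hs.le hb).neg fun r hr => neg_pos.2 (hvs r hr)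
  have hub' : 0 < -U α b := neg_pos.2 hub
  refine ⟨min ε (min δ (-U α b)) / C, by positivity, fun β hβ => ?_⟩
  rw [Metric.mem_ball, Real.dist_eq, lt_div_iff₀ hC, mul_comm, abs_sub_comm, lt_min_iff,
    lt_min_iff] at hβ
  have hd := hdist α β _ _ _ _ (h α) (h β)
  refine ⟨s, b, hs, hsb, hb, fun r hr => ?_, fun r hr => ?_, ?_⟩
  · have := (hd r ⟨hr.1, hr.2.trans hsb.le⟩).1
    linarith [le_abs_self (U α r - U β r), hle r hr]
  · have := (hd r ⟨hs.le.trans hr.1, hr.2⟩).2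
    linarith [neg_abs_le (V α r - V β r), hle' r hr]
  · have := (hd b ⟨(hs.trans hsb).le, le_rfl⟩).1
    linarith [neg_abs_le (U α b - U β b)]

theorem exists_descends (hL : LipschitzWith L g) (hg : IsBistable g)
    (h : ∀ α, IsShot n g α (U α) (V α)) {a b : ℝ} (ha : 1 < a) (hab : a ≤ b)
    (hA : Turns (U a) (V a)) (hB : Crosses (U b) (V b)) :
    ∃ α ∈ Icc a b, Descends (U α) (V α) := by
  by_contra! hno
  obtain ⟨x, -, hx1, hx2⟩ := isPreconnected_Icc (a := a) (b := b) _ _ (isOpen_turns hL h)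
    (isOpen_crosses hL h) (by
      intro α hα
      rcases (h α).turns_or_crosses_or_descends hL hg (ha.trans_le hα.1) with h | h | h
      · exact Or.inl h
      · exact Or.inr h
      · exact absurd h (hno α hα))
    ⟨a, left_mem_Icc.2 hab, hA⟩ ⟨b, right_mem_Icc.2 hab, hB⟩
  exact (h x).not_crosses_of_turns hg hx1 hx2

end Family

namespace IsShot

variable {n : ℕ} {g : ℝ → ℝ} {α : ℝ} {u v : ℝ → ℝ}

theorem u_le_of_v_nonpos (h : IsShot n g α u v) {s t : ℝ} (hs : 0 ≤ s) (hst : s ≤ t) (ht : t < π)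
    (hv : ∀ r ∈ Ioo s t, v r ≤ 0) : u t ≤ u s :=
  le_of_hasDerivAt_nonpos hst (h.continuousOn_Icc_u hs ht)
    (fun r hr => h.deru r ⟨hs.trans_lt hr.1, hr.2.trans ht⟩) hv

theorem v_lower_bound {L : NNReal} (hL : LipschitzWith L g) (hg0 : g 0 = 0)
    (h : IsShot n g α u v) (hn : 1 ≤ n) (hd : Descends u v) {t : ℝ} (ht : t ∈ Ico (π / 2) π) :
    -(2 * L * u t * (π - t)) ≤ v t := by
  by_contra! hlt
  have hπ := pi_pos
  have ht0 : 0 < t := by linarith [ht.1]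
  have hsint : 0 < sin t ^ n := pow_pos (sin_pos_of_mem_Ioo ⟨ht0, ht.2⟩) n
  have hut := (hd t ⟨ht0, ht.2⟩).1
  have hvt := (hd t ⟨ht0, ht.2⟩).2
  set k := -(sin t ^ n * v t / 2) with hk
  have hk0 : 0 < k := by
    rw [hk]; nlinarith
  have hmono : ∀ s ∈ Ico t π, u s ≤ u t := fun s hs =>
    h.u_le_of_v_nonpos ht0.le hs.1 hs.2 fun r hr => (hd r ⟨ht0.trans hr.1, hr.2.trans hs.2⟩).2.le
  have hsin : ∀ s ∈ Ico t π, sin s ≤ sin t := by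
    intro s hs
    rw [← sin_pi_sub t, ← sin_pi_sub s]
    exact sin_le_sin_of_le_of_le_pi_div_two (by linarith [hs.2]) (by linarith [ht.1])
      (by linarith [hs.1])
  have hflux : ∀ s ∈ Ico t π, sin s ^ n * v s ≤ -k := by
    intro s hs
    have := le_of_hasDerivAt_nonpos
      (F := fun r => sin r ^ n * v r - L * u t * sin t ^ n * r)
      (F' := fun r => -(sin r ^ n * g (u r)) - L * u t * sin t ^ n * 1) hs.1
      ((h.continuousOn_flux ht0.le hs.2).sub (by fun_prop))
      (fun r hr => (h.hasDerivAt_flux ⟨ht0.trans hr.1, hr.2.trans hs.2⟩).sub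
        ((hasDerivAt_id r).const_mul _)) (by
        intro r hr
        have hr' : r ∈ Ico t π := ⟨hr.1.le, hr.2.trans hs.2⟩
        have hur := (hd r ⟨ht0.trans hr.1, hr'.2⟩).1
        have h1 : |g (u r)| ≤ L * u t := by
          have := hL.dist_le_mul (u r) 0
          rw [Real.dist_eq, Real.dist_eq, hg0, sub_zero, sub_zero, abs_of_pos hur] at this
          exact this.trans (by gcongr; exact hmono r hr')
        have h2 : sin r ^ n ≤ sin t ^ n := by
          have := sin_pos_of_mem_Ioo ⟨ht0.trans hr.1, hr'.2⟩
          gcongr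
          exact hsin r hr'
        have h3 : 0 ≤ sin r ^ n :=
          pow_nonneg (sin_pos_of_mem_Ioo ⟨ht0.trans hr.1, hr'.2⟩).le n
        calc -(sin r ^ n * g (u r)) - L * u t * sin t ^ n * 1
            = sin r ^ n * (-g (u r)) - L * u t * sin t ^ n := by ring
          _ ≤ sin t ^ n * (L * u t) - L * u t * sin t ^ n := by
            have h4 : -g (u r) ≤ L * u t := (neg_le_abs _).trans h1
            have h5 : (0 : ℝ) ≤ L * u t := (abs_nonneg _).trans h1
            exact sub_le_sub_right ((mul_le_mul_of_nonneg_left h4 h3).trans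
              (mul_le_mul_of_nonneg_right h2 h5)) _
          _ = 0 := by ring)
    have h4 : (L : ℝ) * u t * sin t ^ n * (s - t) ≤ L * u t * sin t ^ n * (π - t) := by
      gcongr
      exact hs.2.le
    have h5 : sin t ^ n * (2 * L * u t * (π - t)) ≤ sin t ^ n * (-v t) := by
      gcongr
      linarith
    rw [hk]
    nlinarith
  have hvs : ∀ s ∈ Ico t π, v s + k / (π - s) ≤ 0 := by
    intro s hs
    have hs0 : 0 < sin s := sin_pos_of_mem_Ioo ⟨ht0.trans_le hs.1, hs.2⟩
    have hps : 0 < π - s := by linarith [hs.2]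
    have h1 : sin s ^ n ≤ π - s := by
      calc sin s ^ n ≤ sin s := pow_le_of_le_one hs0.le (sin_le_one _) (by omega)
        _ = sin (π - s) := (sin_pi_sub s).symm
        _ ≤ π - s := sin_le hps.le
    have h2 := hflux s hs
    have h3 := (hd s ⟨ht0.trans_le hs.1, hs.2⟩).2
    have h4 : k ≤ -v s * (π - s) := by nlinarith
    have : k / (π - s) ≤ -v s := by rwa [div_le_iff₀ hps]
    linarith
  set s := π - (π - t) * exp (-((u t + 1) / k)) with hs
  have hpt : 0 < π - t := by linarith [ht.2]
  have hexp : exp (-((u t + 1) / k)) ≤ 1 := exp_le_one_iff.2 (by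
    have : 0 ≤ (u t + 1) / k := by positivity
    linarith)
  have hsI : s ∈ Ico t π := by
    constructor
    · rw [hs]; nlinarith
    · rw [hs]
      have : 0 < (π - t) * exp (-((u t + 1) / k)) := by positivity
      linarith
  have hfin := le_of_hasDerivAt_nonpos (F := fun r => u r - k * log (π - r))
    (F' := fun r => v r + k / (π - r)) hsI.1
    ((h.continuousOn_Icc_u ht0.le hsI.2).sub (by
      apply ContinuousOn.mul continuousOn_const
      apply ContinuousOn.log (by fun_prop)
      intro x hx
      linarith [hx.2, hsI.2]))
    (by
      intro r hr
      have hr' : r < π := hr.2.trans hsI.2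
      refine ((h.deru r ⟨ht0.trans hr.1, hr'⟩).sub
        ((((hasDerivAt_id r).const_sub π).log (by simp; linarith)).const_mul k)).congr_deriv ?_
      simp
      ring)
    (fun r hr => hvs r ⟨hr.1.le, hr.2.trans hsI.2⟩)
  have hlog : log (π - s) = log (π - t) - (u t + 1) / k := by
    rw [hs, sub_sub_cancel, log_mul hpt.ne' (exp_pos _).ne', log_exp]
    ring
  simp only [hlog] at hfin
  have hus := (hd s ⟨ht0.trans_le hsI.1, hsI.2⟩).1
  have : k * ((u t + 1) / k) = u t + 1 := by field_simp
  nlinarith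

theorem exists_pos_le {L : NNReal} (hL : LipschitzWith L g) (hg0 : g 0 = 0)
    (h : IsShot n g α u v) (hn : 1 ≤ n) (hd : Descends u v) :
    ∃ c > 0, ∀ t ∈ Ico (π / 2) π, c ≤ u t := by
  have hπ := pi_pos
  have hu2 := (hd (π / 2) ⟨by linarith, by linarith⟩).1
  set K := 2 * L * π with hK
  refine ⟨u (π / 2) * exp (K * (π / 2)) / exp (K * π), by positivity, fun t ht => ?_⟩
  have ht0 : 0 < t := by linarith [ht.1]
  have hut := (hd t ⟨ht0, ht.2⟩).1
  have := le_of_hasDerivAt_nonneg (F := fun t => u t * exp (K * t))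
    (F' := fun t => (v t + K * u t) * exp (K * t)) ht.1
    ((h.continuousOn_Icc_u (by linarith) ht.2).mul (by fun_prop))
    (by
      intro r hr
      refine ((h.deru r ⟨by linarith [hr.1], hr.2.trans ht.2⟩).fun_mul
        (((hasDerivAt_id r).const_mul K).exp)).congr_deriv ?_
      simp only [id]
      ring)
    (by
      intro r hr
      apply mul_nonneg _ (exp_pos _).le
      have h1 := h.v_lower_bound hL hg0 hn hd ⟨hr.1.le, hr.2.trans ht.2⟩
      have h2 := (hd r ⟨by linarith [hr.1], hr.2.trans ht.2⟩).1
      have h3 : 2 * L * u r * (π - r) ≤ 2 * L * u r * π := by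
        gcongr; linarith [hr.1]
      rw [hK]
      linarith)
  rw [div_le_iff₀ (exp_pos _)]
  refine this.trans ?_
  gcongr
  exact ht.2.le

theorem exists_extension {L : NNReal} (hL : LipschitzWith L g) (hg0 : g 0 = 0)
    (h : IsShot n g α u v) (hn : 1 ≤ n) (hd : Descends u v) :
    ∃ w : ℝ → ℝ, w 0 = α ∧ (∀ t ∈ Ioo 0 π, w t = u t) ∧ (∀ t ∈ Ioo 0 π, HasDerivAt w (v t) t) ∧
      HasDerivAt w 0 0 ∧ HasDerivAt w 0 π ∧ (∀ t ∈ Icc 0 π, 0 < w t) ∧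
      StrictAntiOn w (Icc 0 π) := by
  have hπ := pi_pos
  obtain ⟨c, hc, hcu⟩ := h.exists_pos_le hL hg0 hn hd
  have hanti : AntitoneOn u (Ico 0 π) := fun x hx y hy hxy =>
    h.u_le_of_v_nonpos hx.1 hxy hy.2 fun r hr => (hd r ⟨hx.1.trans_lt hr.1, hr.2.trans hy.2⟩).2.le
  have huα : ∀ t ∈ Ico 0 π, u t ≤ α := fun t ht => by
    rw [← h.u_zero]; exact hanti ⟨le_rfl, hπ⟩ ht ht.1
  have hlim := (hanti.mono Ioo_subset_Ico_self).tendsto_nhdsWithin_Ioo_left (nonempty_Ioo.2 hπ)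
    ⟨0, by rintro _ ⟨t, ht, rfl⟩; exact (hd t ht).1.le⟩
  set l := sInf (u '' Ioo 0 π)
  have hnear : Ioo (π / 2) π ∈ nhdsWithin π (Iio π) := Ioo_mem_nhdsLT (by linarith)
  have hcl : c ≤ l := by
    refine ge_of_tendsto hlim ?_
    filter_upwards [hnear] with t ht using hcu t ⟨ht.1.le, ht.2⟩
  have hvlim : Filter.Tendsto v (nhdsWithin π (Iio π)) (nhds 0) := by
    have h1 : Filter.Tendsto (fun t => -(2 * L * α * (π - t))) (nhdsWithin π (Iio π)) (nhds 0) := by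
      have : Continuous fun t => -(2 * L * α * (π - t)) := by fun_prop
      have := this.tendsto π
      simp only [sub_self, mul_zero, neg_zero] at this
      exact this.mono_left nhdsWithin_le_nhds
    refine tendsto_of_tendsto_of_tendsto_of_le_of_le' h1 tendsto_const_nhds ?_ ?_
    · filter_upwards [hnear] with t ht
      refine le_trans ?_ (h.v_lower_bound hL hg0 hn hd ⟨ht.1.le, ht.2⟩)
      have h2 := huα t ⟨by linarith [ht.1], ht.2⟩
      have h3 : 0 ≤ π - t := by linarith [ht.2]
      gcongr
    · filter_upwards [hnear] with t ht using (hd t ⟨by linarith [ht.1], ht.2⟩).2.le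
  set w : ℝ → ℝ := fun t => if t ≤ 0 then α else if t < π then u t else l with hw
  have hw0 : ∀ t ≤ 0, w t = α := fun t ht => by simp [hw, ht]
  have hwu : ∀ t ∈ Ioo 0 π, w t = u t := fun t ht => by simp [hw, ht.1, ht.2]
  have hwπ : ∀ t, π ≤ t → w t = l := fun t ht => by
    simp [hw, show ¬ t ≤ 0 by linarith, not_lt.2 ht]
  have hwd : ∀ t ∈ Ioo 0 π, HasDerivAt w (v t) t := fun t ht =>
    (h.deru t ht).congr_of_eventuallyEq (by
      filter_upwards [Ioo_mem_nhds ht.1 ht.2] with s hs using hwu s hs)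
  have hdiff : DifferentiableOn ℝ w (Ioo 0 π) := fun t ht =>
    (hwd t ht).differentiableAt.differentiableWithinAt
  have hd0 : HasDerivAt w 0 0 := by
    have hl : HasDerivWithinAt w 0 (Iic 0) 0 :=
      (hasDerivWithinAt_const 0 (Iic 0) α).congr (fun t ht => hw0 t ht) (hw0 0 le_rfl)
    have hmem : Ioo 0 π ∈ nhdsWithin (0 : ℝ) (Ioi 0) := Ioo_mem_nhdsGT hπ
    have hr : HasDerivWithinAt w 0 (Ici 0) 0 := by
      apply hasDerivWithinAt_Ici_of_tendsto_deriv hdiff _ hmem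
      · have := (h.contv 0 ⟨le_rfl, hπ⟩).mono Ioo_subset_Ico_self
        rw [ContinuousWithinAt, h.v_zero, nhdsWithin_Ioo_eq_nhdsGT hπ] at this
        apply this.congr'
        filter_upwards [hmem] with t ht using (hwd t ht).deriv.symm
      · have := (h.contu 0 ⟨le_rfl, hπ⟩).mono Ioo_subset_Ico_self
        exact this.congr hwu (by rw [hw0 0 le_rfl, h.u_zero])
    simpa using hl.union hr
  have hdπ : HasDerivAt w 0 π := by
    have hr : HasDerivWithinAt w 0 (Ici π) π :=
      (hasDerivWithinAt_const π (Ici π) l).congr (fun t ht => hwπ t ht) (hwπ π le_rfl)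
    have hmem : Ioo 0 π ∈ nhdsWithin π (Iio π) := Ioo_mem_nhdsLT hπ
    have hl : HasDerivWithinAt w 0 (Iic π) π := by
      apply hasDerivWithinAt_Iic_of_tendsto_deriv hdiff _ hmem
      · apply hvlim.congr'
        filter_upwards [hmem] with t ht using (hwd t ht).deriv.symm
      · rw [ContinuousWithinAt, hwπ π le_rfl, nhdsWithin_Ioo_eq_nhdsLT hπ]
        apply hlim.congr'
        filter_upwards [hmem] with t ht using (hwu t ht).symm
    simpa using hl.union hr
  have hα : 0 < α := by
    have h2 : π / 2 ∈ Ioo 0 π := ⟨by linarith, by linarith⟩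
    exact (hd _ h2).1.trans_le (huα _ (Ioo_subset_Ico_self h2))
  refine ⟨w, hw0 0 le_rfl, hwu, hwd, hd0, hdπ, fun t ht => ?_, ?_⟩
  · rcases ht.1.eq_or_lt with h1 | h1
    · rw [← h1, hw0 0 le_rfl]; exact hα
    rcases ht.2.eq_or_lt with h2 | h2
    · rw [h2, hwπ π le_rfl]; linarith
    · rw [hwu t ⟨h1, h2⟩]; exact (hd t ⟨h1, h2⟩).1
  · apply strictAntiOn_of_deriv_neg (convex_Icc 0 π)
    · intro t ht
      rcases ht.1.eq_or_lt with h1 | h1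
      · rw [← h1]; exact hd0.continuousAt.continuousWithinAt
      rcases ht.2.eq_or_lt with h2 | h2
      · rw [h2]; exact hdπ.continuousAt.continuousWithinAt
      · exact (hwd t ⟨h1, h2⟩).continuousAt.continuousWithinAt
    · intro t ht
      rw [interior_Icc] at ht
      rw [(hwd t ht).deriv]
      exact (hd t ht).2

end IsShot

namespace IsShot

variable {n : ℕ} {g : ℝ → ℝ} {α : ℝ} {u v : ℝ → ℝ}

/-- The derivative of `-(n + 1) cos t sin ^ n t v t - g (u t) sin ^ (n + 1) t`. -/
theorem hasDerivAt_weighted_wronskian (h : IsShot n g α u v) {t d : ℝ} (ht : t ∈ Ioo 0 π)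
    (hd : HasDerivAt g d (u t)) :
    HasDerivAt
      (fun t => -((n + 1) * (cos t * (sin t ^ n * v t)) + g (u t) * sin t ^ (n + 1)))
      ((d - (n + 1)) * sin t ^ (n + 1) * (-v t)) t := by
  have h1 := (hasDerivAt_cos t).mul (h.hasDerivAt_flux ht)
  have h2 := (hd.comp t (h.deru t ht)).mul ((hasDerivAt_sin t).pow (n + 1))
  refine (((h1.const_mul ((n : ℝ) + 1)).add h2).neg).congr_deriv ?_
  simp only [Function.comp, Nat.add_sub_cancel, Nat.cast_add, Nat.cast_one, Pi.pow_apply]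
  ring

theorem hasDerivAt_neg_v_div_sin (h : IsShot n g α u v) {t : ℝ} (ht : t ∈ Ioo 0 π) :
    HasDerivAt (fun t => -v t / sin t)
      (-(-((n + 1) * (cos t * (sin t ^ n * v t)) + g (u t) * sin t ^ (n + 1)))
        / sin t ^ (n + 2)) t := by
  have hs := (sin_pos_of_mem_Ioo ht).ne'
  refine ((h.derv t ht).neg.div (hasDerivAt_sin t) hs).congr_deriv ?_
  rw [Pi.neg_apply]
  field_simp
  ring

/-- If the reaction is steep along the solution, then `v` cannot stay negative for long:
a Sturm comparison with the first nonconstant spherical harmonic. -/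
theorem not_forall_v_neg (h : IsShot n g α u v) (hg : Continuous g) {g' : ℝ → ℝ} {κ : ℝ}
    (hκ : 0 < κ) {T : ℝ} (hT : T = π / 2 + arctan ((n + 3) / κ))
    (hd : ∀ t ∈ Ioo 0 T, HasDerivAt g (g' (u t)) (u t) ∧ n + 1 + κ ≤ g' (u t)) :
    ¬ ∀ t ∈ Ioc 0 T, v t < 0 := by
  intro hv
  have hπ := pi_pos
  have hTπ : T < π := by rw [hT]; linarith [arctan_lt_pi_div_two ((n + 3) / κ)]
  have hT2 : π / 2 < T := by
    have : 0 < arctan (((n : ℝ) + 3) / κ) := arctan_pos.2 (by positivity)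
    linarith
  have hcot : cos T / sin T = -((n + 3) / κ) := by
    rw [hT, add_comm, cos_add_pi_div_two, sin_add_pi_div_two, neg_div, ← tan_eq_sin_div_cos,
      tan_arctan]
  have hsin : ∀ t ∈ Ioc 0 T, 0 < sin t := fun t ht =>
    sin_pos_of_mem_Ioo ⟨ht.1, ht.2.trans_lt hTπ⟩
  set W : ℝ → ℝ :=
    fun t => -((n + 1) * (cos t * (sin t ^ n * v t)) + g (u t) * sin t ^ (n + 1)) with hW
  set ψ : ℝ → ℝ := fun t => -v t / sin t with hψ
  have hWc : ∀ s t, 0 ≤ s → t ≤ T → ContinuousOn W (Icc s t) := by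
    intro s t hs ht
    have h1 := h.continuousOn_flux hs (ht.trans_lt hTπ)
    have h2 := hg.comp_continuousOn (h.continuousOn_Icc_u hs (ht.trans_lt hTπ))
    exact ((continuousOn_const.mul (continuous_cos.continuousOn.mul h1)).add
      (h2.mul (by fun_prop))).neg
  have hW' : ∀ t ∈ Ioo 0 T, κ * sin t ^ (n + 1) * (-v t) ≤
      (g' (u t) - (n + 1)) * sin t ^ (n + 1) * (-v t) := by
    intro t ht
    have h1 := hv t ⟨ht.1, ht.2.le⟩
    have h2 := hsin t ⟨ht.1, ht.2.le⟩
    have h3 := (hd t ht).2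
    have : 0 ≤ -v t := by linarith
    gcongr
    linarith
  have hWmono : ∀ s t, 0 ≤ s → s ≤ t → t ≤ T → W s ≤ W t := by
    intro s t hs hst ht
    refine le_of_hasDerivAt_nonneg hst (hWc s t hs ht) (fun r hr =>
      h.hasDerivAt_weighted_wronskian ⟨hs.trans_lt hr.1, hr.2.trans_le (ht.trans hTπ.le)⟩
        (hd r ⟨hs.trans_lt hr.1, hr.2.trans_le ht⟩).1) (fun r hr => ?_)
    have hr' : r ∈ Ioo 0 T := ⟨hs.trans_lt hr.1, hr.2.trans_le ht⟩
    refine le_trans ?_ (hW' r hr')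
    have h1 := hv r ⟨hr'.1, hr'.2.le⟩
    have h2 := hsin r ⟨hr'.1, hr'.2.le⟩
    have : 0 ≤ -v r := by linarith
    positivity
  have hW0 : W 0 = 0 := by simp [hW, h.v_zero]
  have hWnn : ∀ t ∈ Ioc 0 T, 0 ≤ W t := fun t ht =>
    hW0 ▸ hWmono 0 t le_rfl ht.1.le ht.2
  have hψc : ∀ s t, 0 < s → t ≤ T → ContinuousOn ψ (Icc s t) := by
    intro s t hs ht
    exact (h.continuousOn_Icc_v hs.le (ht.trans_lt hTπ)).neg.div continuous_sin.continuousOn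
      fun r hr => (hsin r ⟨hs.trans_le hr.1, hr.2.trans ht⟩).ne'
  have hψd : ∀ t ∈ Ioo 0 T, HasDerivAt ψ (-W t / sin t ^ (n + 2)) t := fun t ht =>
    h.hasDerivAt_neg_v_div_sin ⟨ht.1, ht.2.trans hTπ⟩
  have hψanti : ∀ s t, 0 < s → s ≤ t → t ≤ T → ψ t ≤ ψ s := by
    intro s t hs hst ht
    refine le_of_hasDerivAt_nonpos hst (hψc s t hs ht)
      (fun r hr => hψd r ⟨hs.trans hr.1, hr.2.trans_le ht⟩) (fun r hr => ?_)
    have hr' : r ∈ Ioc 0 T := ⟨hs.trans hr.1, hr.2.le.trans ht⟩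
    have := hsin r hr'
    exact div_nonpos_of_nonpos_of_nonneg (by linarith [hWnn r hr']) (by positivity)
  set ψ0 := ψ (π / 2) with hψ0
  set w0 := κ * ψ0 / (n + 3) with hw0
  have hψ0nn : 0 < ψ0 := by
    have h1 := hv (π / 2) ⟨by linarith, hT2.le⟩
    simp only [hψ0, hψ, sin_pi_div_two]
    linarith
  have hw0pos : 0 < w0 := by positivity
  have hWhalf : w0 ≤ W (π / 2) := by
    have := le_of_hasDerivAt_nonneg (F := fun t => W t - w0 * sin t ^ (n + 3))
      (F' := fun t => (g' (u t) - (n + 1)) * sin t ^ (n + 1) * (-v t)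
        - w0 * ((n + 3) * sin t ^ (n + 2) * cos t)) (show (0 : ℝ) ≤ π / 2 by linarith)
      ((hWc 0 _ le_rfl hT2.le).sub (by fun_prop))
      (fun r hr => by
        refine (h.hasDerivAt_weighted_wronskian ⟨hr.1, by linarith [hr.2]⟩
          (hd r ⟨hr.1, hr.2.trans hT2⟩).1).sub ?_
        refine (((hasDerivAt_sin r).pow (n + 3)).const_mul w0).congr_deriv ?_
        push_cast
        rfl)
      (fun r hr => by
        have hr' : r ∈ Ioo 0 T := ⟨hr.1, hr.2.trans hT2⟩
        have h1 := hW' r hr'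
        have h2 := hsin r ⟨hr'.1, hr'.2.le⟩
        have h3 : ψ0 ≤ ψ r := hψanti r (π / 2) hr.1 hr.2.le hT2.le
        have h4 : ψ0 * sin r ≤ -v r := by rwa [hψ, le_div_iff₀ h2] at h3
        have h5 : cos r ≤ 1 := cos_le_one r
        have h6 : w0 * ((n + 3) * sin r ^ (n + 2) * cos r)
            = κ * sin r ^ (n + 1) * (ψ0 * sin r) * cos r := by
          rw [hw0]; field_simp; ring
        have h7 : κ * sin r ^ (n + 1) * (ψ0 * sin r) * cos r
            ≤ κ * sin r ^ (n + 1) * (ψ0 * sin r) * 1 := by gcongr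
        have h8 : κ * sin r ^ (n + 1) * (ψ0 * sin r) ≤ κ * sin r ^ (n + 1) * (-v r) := by gcongr
        linarith)
    simp only [hW0, sin_zero, sin_pi_div_two, one_pow, mul_one, ne_eq, Nat.add_eq_zero_iff,
      OfNat.ofNat_ne_zero, and_false, not_false_eq_true, zero_pow, mul_zero, sub_zero] at this
    linarith
  have hend := le_of_hasDerivAt_nonpos (F := fun t => ψ t - w0 * (cos t / sin t))
    (F' := fun t => -W t / sin t ^ (n + 2) - w0 * (-1 / sin t ^ 2)) hT2.le
    ((hψc _ _ (by linarith) le_rfl).sub (continuousOn_const.mul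
      (continuous_cos.continuousOn.div continuous_sin.continuousOn
        fun r hr => (hsin r ⟨by linarith [hr.1], hr.2⟩).ne')))
    (fun r hr => by
      have hr' : r ∈ Ioo 0 T := ⟨by linarith [hr.1], hr.2⟩
      have h2 := hsin r ⟨hr'.1, hr'.2.le⟩
      refine (hψd r hr').sub ((((hasDerivAt_cos r).div (hasDerivAt_sin r) h2.ne').congr_deriv
        ?_).const_mul w0)
      congr 1
      linarith [sin_sq_add_cos_sq r])
    (fun r hr => by
      have hr' : r ∈ Ioo 0 T := ⟨by linarith [hr.1], hr.2⟩
      have h2 := hsin r ⟨hr'.1, hr'.2.le⟩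
      have h3 : w0 ≤ W r := hWhalf.trans (hWmono _ _ (by linarith) hr.1.le hr.2.le)
      have h4 : sin r ^ (n + 2) ≤ sin r ^ 2 :=
        pow_le_pow_of_le_one h2.le (sin_le_one r) (by omega)
      have hWr : 0 ≤ W r := hw0pos.le.trans h3
      have h5 : w0 / sin r ^ 2 ≤ W r / sin r ^ (n + 2) := by gcongr
      have h6 : -W r / sin r ^ (n + 2) - w0 * (-1 / sin r ^ 2)
        = w0 / sin r ^ 2 - W r / sin r ^ (n + 2) := by ring
      linarith)
  rw [hcot, cos_pi_div_two, zero_div, mul_zero, sub_zero] at hend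
  have h1 : w0 * -((n + 3) / κ) = -ψ0 := by rw [hw0]; field_simp
  have h2 : 0 < ψ T := div_pos (by linarith [hv T ⟨by linarith, le_rfl⟩])
    (hsin T ⟨by linarith, le_rfl⟩)
  have h3 : ψ T - w0 * -((n + 3) / κ) ≤ ψ0 := hend
  linarith

/-- If `g' 1 > n + 1`, shots starting slightly above `1` turn. -/
theorem exists_turns {L : NNReal} (hL : LipschitzWith L g) (hg : IsBistable g) {g' : ℝ → ℝ}
    {κ η M : ℝ} (hκ : 0 < κ) (hη : 0 < η) (hη1 : η < 1) (hM : 1 < M)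
    (hd : ∀ x, |x - 1| ≤ η → HasDerivAt g (g' x) x ∧ n + 1 + κ ≤ g' x)
    {U V : ℝ → ℝ → ℝ} (h : ∀ α, IsShot n g α (U α) (V α)) :
    ∃ α, 1 < α ∧ α ≤ M ∧ Turns (U α) (V α) := by
  have hπ := pi_pos
  set T := π / 2 + arctan (((n : ℝ) + 3) / κ) with hT
  have hTI : T ∈ Ioo 0 π := by
    have h1 : 0 < arctan (((n : ℝ) + 3) / κ) := arctan_pos.2 (by positivity)
    have h2 := arctan_lt_pi_div_two (((n : ℝ) + 3) / κ)
    constructor <;> linarith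
  have hone : IsShot n g 1 (fun _ => 1) (fun _ => 0) :=
    { u_zero := rfl
      v_zero := rfl
      contu := continuousOn_const
      contv := continuousOn_const
      deru := fun t _ => hasDerivAt_const t 1
      derv := fun t _ => (hasDerivAt_const t 0).congr_deriv (by simp [hg.one]) }
  obtain ⟨C, hC, hdist⟩ := exists_dist_le (n := n) hL hTI
  refine ⟨1 + min (η / C) (M - 1), ?_, ?_, ?_⟩
  · have : 0 < min (η / C) (M - 1) := lt_min (by positivity) (by linarith)
    linarith
  · linarith [min_le_right (η / C) (M - 1)]
  set α := 1 + min (η / C) (M - 1) with hα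
  have hpos : 0 < min (η / C) (M - 1) := lt_min (by positivity) (by linarith)
  have hclose : ∀ t ∈ Icc 0 T, |U α t - 1| ≤ η := by
    intro t ht
    have h1 := (hdist α 1 _ _ _ _ (h α) hone t ht).1
    have h2 : |α - 1| = min (η / C) (M - 1) := by
      rw [hα, add_sub_cancel_left, abs_of_pos hpos]
    rw [h2] at h1
    calc _ ≤ C * min (η / C) (M - 1) := h1
      _ ≤ C * (η / C) := by gcongr; exact min_le_left _ _
      _ = η := by field_simp
  have hnot := (h α).not_forall_v_neg hL.continuous hκ hT
    fun t ht => hd _ (hclose t ⟨ht.1.le, ht.2.le⟩)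
  rcases (h α).turns_or_crosses_or_descends hL hg (by linarith) with ht | hc | hde
  · exact ht
  · exfalso
    obtain ⟨s, b, hs, hsb, hb, hu, hv, hub⟩ := hc
    have hTb : T < b := by
      by_contra! hle
      have := (abs_le.1 (hclose b ⟨by linarith, hle⟩)).1
      linarith
    refine hnot fun t ht => ?_
    rcases le_total t s with hts | hts
    · exact (h α).v_neg_of_one_lt hg.pos ⟨ht.1, ht.2.trans_lt hTI.2⟩
        fun r hr => hu r ⟨hr.1, hr.2.trans hts⟩
    · exact hv t ⟨hts, ht.2.trans hTb.le⟩
  · exact absurd (fun t ht => (hde t ⟨ht.1, ht.2.trans_lt hTI.2⟩).2) hnot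

end IsShot

/-- The nonlinearity of the Yamabe ODE. -/
noncomputable def reaction (lam p x : ℝ) : ℝ := lam * (x ^ (p - 1) - x)

/-- The primitive of `reaction lam p` vanishing at `0`. -/
noncomputable def potential (lam p x : ℝ) : ℝ := lam * (x ^ p / p - x ^ 2 / 2)

/-- The Pohozaev functional along a curve `(u, v)`. -/
noncomputable def pohozaev (n : ℕ) (lam p : ℝ) (u v : ℝ → ℝ) (t : ℝ) : ℝ :=
  sin t ^ (n + 1) * (v t ^ 2 / 2 + potential lam p (u t))
    + (n - 1) / 2 * (cos t * u t * (sin t ^ n * v t))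

theorem hasDerivAt_potential {lam p x : ℝ} (hp : 2 < p) :
    HasDerivAt (potential lam p) (reaction lam p x) x := by
  have h1 := (hasDerivAt_rpow_const (x := x) (p := p) (Or.inr (by linarith))).div_const p
  have h2 := ((hasDerivAt_id x).pow 2).div_const 2
  refine ((h1.sub h2).const_mul lam).congr_deriv ?_
  simp only [reaction, id]
  field_simp
  norm_num
  ring

/-- A shot for the Yamabe nonlinearity that stays positive and decreases on `[0, T]`. -/
structure IsDescent (n : ℕ) (lam p : ℝ) (g : ℝ → ℝ) (α : ℝ) (u v : ℝ → ℝ) (T : ℝ) : Prop where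
  shot : IsShot n g α u v
  eq_reaction : ∀ x ∈ Icc 0 α, g x = reaction lam p x
  pos : ∀ t ∈ Icc 0 T, 0 < u t
  neg : ∀ t ∈ Ioo 0 T, v t < 0
  le_one : T ≤ 1

namespace IsDescent

variable {n : ℕ} {lam p α T : ℝ} {g u v : ℝ → ℝ}

theorem lt_pi_div_two (h : IsDescent n lam p g α u v T) : T < π / 2 := by
  linarith [h.le_one, pi_gt_three]

theorem u_anti (h : IsDescent n lam p g α u v T) {s t : ℝ} (hs : 0 ≤ s) (hst : s ≤ t)
    (ht : t ≤ T) : u t ≤ u s :=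
  h.shot.u_le_of_v_nonpos hs hst (by linarith [h.lt_pi_div_two, pi_pos])
    fun r hr => (h.neg r ⟨hs.trans_lt hr.1, hr.2.trans_le ht⟩).le

theorem u_le (h : IsDescent n lam p g α u v T) {t : ℝ} (ht : t ∈ Icc 0 T) : u t ≤ α :=
  h.shot.u_zero ▸ h.u_anti le_rfl ht.1 ht.2

theorem g_eq (h : IsDescent n lam p g α u v T) {t : ℝ} (ht : t ∈ Icc 0 T) :
    g (u t) = reaction lam p (u t) :=
  h.eq_reaction _ ⟨(h.pos t ht).le, h.u_le ht⟩

theorem mem_Ioo_zero_pi (h : IsDescent n lam p g α u v T) {t : ℝ} (h0 : 0 < t) (ht : t ≤ T) :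
    t ∈ Ioo 0 π :=
  ⟨h0, by linarith [h.lt_pi_div_two, pi_pos]⟩

theorem sin_pos (h : IsDescent n lam p g α u v T) {t : ℝ} (h0 : 0 < t) (ht : t ≤ T) :
    0 < sin t :=
  sin_pos_of_mem_Ioo (h.mem_Ioo_zero_pi h0 ht)

theorem cos_pos (h : IsDescent n lam p g α u v T) {t : ℝ} (h0 : 0 ≤ t) (ht : t ≤ T) :
    0 < cos t :=
  cos_pos_of_mem_Ioo ⟨by linarith [pi_pos], by linarith [h.lt_pi_div_two]⟩

theorem continuousOn_u (h : IsDescent n lam p g α u v T) {a b : ℝ} (ha : 0 ≤ a) (hb : b ≤ T) :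
    ContinuousOn u (Icc a b) :=
  h.shot.continuousOn_Icc_u ha (by linarith [h.lt_pi_div_two, pi_pos])

theorem continuousOn_v (h : IsDescent n lam p g α u v T) {a b : ℝ} (ha : 0 ≤ a) (hb : b ≤ T) :
    ContinuousOn v (Icc a b) :=
  h.shot.continuousOn_Icc_v ha (by linarith [h.lt_pi_div_two, pi_pos])

theorem continuousOn_flux (h : IsDescent n lam p g α u v T) {a b : ℝ} (ha : 0 ≤ a)
    (hb : b ≤ T) : ContinuousOn (fun t => sin t ^ n * v t) (Icc a b) :=
  h.shot.continuousOn_flux ha (by linarith [h.lt_pi_div_two, pi_pos])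

theorem continuousOn_energy (hp : 2 < p) (h : IsDescent n lam p g α u v T) {a b : ℝ}
    (ha : 0 ≤ a) (hb : b ≤ T) :
    ContinuousOn (fun t => v t ^ 2 / 2 + potential lam p (u t)) (Icc a b) := by
  have hF : Continuous (potential lam p) :=
    continuous_iff_continuousAt.2 fun x => (hasDerivAt_potential hp).continuousAt
  exact (((h.continuousOn_v ha hb).pow 2).div_const 2).add
    (hF.comp_continuousOn (h.continuousOn_u ha hb))

theorem hasDerivAt_energy (hp : 2 < p) (h : IsDescent n lam p g α u v T) {t : ℝ} (h0 : 0 < t)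
    (ht : t ≤ T) :
    HasDerivAt (fun t => v t ^ 2 / 2 + potential lam p (u t))
      (-(n * (cos t / sin t) * v t ^ 2)) t := by
  have hI := h.mem_Ioo_zero_pi h0 ht
  have h1 := ((h.shot.derv t hI).pow 2).div_const 2
  have h2 := (hasDerivAt_potential (lam := lam) hp).comp t (h.shot.deru t hI)
  refine (h1.add h2).congr_deriv ?_
  rw [h.g_eq ⟨h0.le, ht⟩]
  push_cast
  ring

theorem hasDerivAt_pohozaev (hp : 2 < p) (h : IsDescent n lam p g α u v T) {t : ℝ} (h0 : 0 < t)
    (ht : t ≤ T) :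
    HasDerivAt (pohozaev n lam p u v)
      (lam * (((n + 1) / p - (n - 1) / 2) * u t ^ p - u t ^ 2) * (sin t ^ n * cos t)
        - (n - 1) / 2 * (sin t ^ (n + 1) * u t * v t)) t := by
  have hI := h.mem_Ioo_zero_pi h0 ht
  have hs := (h.sin_pos h0 ht).ne'
  have h1 := ((hasDerivAt_sin t).pow (n + 1)).mul (h.hasDerivAt_energy hp h0 ht)
  have h2 := ((hasDerivAt_cos t).mul (h.shot.deru t hI)).mul (h.shot.hasDerivAt_flux hI)
  refine (h1.add (h2.const_mul (((n : ℝ) - 1) / 2))).congr_deriv ?_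
  have hrp : u t ^ p = u t ^ (p - 1) * u t := by
    rw [← rpow_add_one (h.pos t ⟨h0.le, ht⟩).ne', sub_add_cancel]
  have hp0 : p ≠ 0 := by linarith
  rw [h.g_eq ⟨h0.le, ht⟩]
  simp only [Pi.pow_apply, Pi.mul_apply, reaction, potential, hrp, Nat.add_sub_cancel, Nat.cast_add,
    Nat.cast_one]
  field_simp
  ring

/-- Monotonicity of the Pohozaev functional. -/
theorem pohozaev_sub_ge (hp : 2 < p) (hlam : 0 < lam) (hn : 1 ≤ n)
    (h : IsDescent n lam p g α u v T) {a b N : ℝ} (ha : 0 ≤ a) (hab : a ≤ b) (hb : b ≤ T)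
    (hN : ∀ t ∈ Ioo a b, N ≤ ((n + 1) / p - (n - 1) / 2) * u t ^ p - u t ^ 2) :
    lam * N / (n + 1) * (sin b ^ (n + 1) - sin a ^ (n + 1)) ≤
      pohozaev n lam p u v b - pohozaev n lam p u v a := by
  have hc : ContinuousOn (pohozaev n lam p u v) (Icc a b) :=
    ((continuous_sin.pow (n + 1)).continuousOn.mul (h.continuousOn_energy hp ha hb)).add
      (continuousOn_const.mul ((continuous_cos.continuousOn.mul (h.continuousOn_u ha hb)).mul
        (h.continuousOn_flux ha hb)))
  have hn1 : (1 : ℝ) ≤ n := by exact_mod_cast hn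
  have := le_of_hasDerivAt_nonneg
    (F := fun t => pohozaev n lam p u v t - lam * N / (n + 1) * sin t ^ (n + 1)) hab
    (hc.sub (by fun_prop))
    (fun t ht => (h.hasDerivAt_pohozaev hp (ha.trans_lt ht.1) (ht.2.le.trans hb)).sub
      (((hasDerivAt_sin t).pow (n + 1)).const_mul _))
    (fun t ht => by
      have h0 := ha.trans_lt ht.1
      have hT := ht.2.trans_le hb
      have h1 := h.sin_pos h0 hT.le
      have h2 := h.cos_pos h0.le hT.le
      have h3 := h.pos t ⟨h0.le, hT.le⟩
      have h4 := h.neg t ⟨h0, hT⟩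
      have h5 : 0 ≤ (n - 1) / 2 * (sin t ^ (n + 1) * u t * (-v t)) := by
        have : 0 ≤ -v t := by linarith
        have : 0 ≤ ((n : ℝ) - 1) / 2 := by linarith
        positivity
      have h6 : lam * N * (sin t ^ n * cos t) ≤
          lam * (((n + 1) / p - (n - 1) / 2) * u t ^ p - u t ^ 2) * (sin t ^ n * cos t) := by
        gcongr
        exact hN t ht
      have h7 : lam * N / (n + 1) * (((n + 1 : ℕ) : ℝ) * sin t ^ (n + 1 - 1) * cos t)
          = lam * N * (sin t ^ n * cos t) := by
        rw [Nat.add_sub_cancel]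
        push_cast
        field_simp
      linarith)
  linarith

/-- The solution stays above `α / 2` for a time of order `α ^ (-(p - 2) / 2)`. -/
theorem half_le (hp : 2 < p) (hlam : 0 < lam) (h : IsDescent n lam p g α u v T) {t : ℝ}
    (h0 : 0 ≤ t) (ht : t ≤ T) (hτ : lam * α ^ (p - 1) * t ^ 2 ≤ α / 2) : α / 2 ≤ u t := by
  have hA : 0 ≤ lam * α ^ (p - 1) := by
    have : 0 < α := h.shot.u_zero ▸ h.pos 0 ⟨le_rfl, h0.trans ht⟩
    positivity
  have hv : ∀ s ∈ Ioo 0 t, -(lam * α ^ (p - 1) * t) ≤ v s := by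
    intro s hs
    have hsT := hs.2.le.trans ht
    have hsin := h.sin_pos hs.1 hsT
    have := le_of_hasDerivAt_nonneg
      (F := fun r => sin r ^ n * v r + lam * α ^ (p - 1) * sin s ^ n * r) hs.1.le
      ((h.continuousOn_flux le_rfl hsT).add (by fun_prop))
      (fun r hr => (h.shot.hasDerivAt_flux
        (h.mem_Ioo_zero_pi hr.1 (hr.2.le.trans hsT))).add
          ((hasDerivAt_id r).const_mul (lam * α ^ (p - 1) * sin s ^ n)))
      (fun r hr => by
        have hrT := hr.2.le.trans hsT
        have hu := h.pos r ⟨hr.1.le, hrT⟩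
        have hr0 := h.sin_pos hr.1 hrT
        have h1 : g (u r) ≤ lam * α ^ (p - 1) := by
          rw [h.g_eq ⟨hr.1.le, hrT⟩, reaction]
          have : u r ^ (p - 1) ≤ α ^ (p - 1) :=
            rpow_le_rpow hu.le (h.u_le ⟨hr.1.le, hrT⟩) (by linarith)
          gcongr
          linarith
        have h2 : sin r ^ n ≤ sin s ^ n := by
          gcongr
          exact sin_le_sin_of_le_of_le_pi_div_two (by linarith [hr.1, pi_pos])
            (by linarith [h.lt_pi_div_two]) hr.2.le
        have h3 : sin r ^ n * g (u r) ≤ sin s ^ n * (lam * α ^ (p - 1)) :=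
          (mul_le_mul_of_nonneg_left h1 (by positivity)).trans
            (mul_le_mul_of_nonneg_right h2 hA)
        linarith)
    simp only [h.shot.v_zero, mul_zero, add_zero] at this
    have h4 : 0 ≤ sin s ^ n * (v s + lam * α ^ (p - 1) * s) := by linarith
    have h5 := nonneg_of_mul_nonneg_right h4 (pow_pos hsin n)
    have h6 : lam * α ^ (p - 1) * s ≤ lam * α ^ (p - 1) * t := by
      gcongr
      exact hs.2.le
    linarith
  have := le_of_hasDerivAt_nonneg (F := fun r => u r + lam * α ^ (p - 1) * t * r) h0
    ((h.continuousOn_u le_rfl ht).add (by fun_prop))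
    (fun r hr => (h.shot.deru r (h.mem_Ioo_zero_pi hr.1 (hr.2.le.trans ht))).add
      ((hasDerivAt_id r).const_mul _))
    (fun r hr => by linarith [hv r hr])
  simp only [h.shot.u_zero, mul_zero, add_zero] at this
  nlinarith

end IsDescent

theorem le_rpow_inv_of_le_rpow_of_neg {x y z : ℝ} (hx : 0 < x) (hy : 0 < y) (hz : z < 0)
    (h : y ≤ x ^ z) : x ≤ y ^ z⁻¹ := by
  calc x = (x ^ z) ^ z⁻¹ := by rw [← rpow_mul hx.le, mul_inv_cancel₀ hz.ne, rpow_one]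
    _ ≤ y ^ z⁻¹ := rpow_le_rpow_of_nonpos hy h (inv_lt_zero.2 hz).le

theorem reaction_ge {lam p x : ℝ} (hp : 2 < p) (hlam : 0 < lam) (hx : 2 ≤ x) :
    lam * (1 - 2 ^ (2 - p)) * x ^ (p - 1) ≤ reaction lam p x := by
  have hx0 : 0 < x := by linarith
  have h1 : x ^ (2 - p) ≤ 2 ^ (2 - p) := rpow_le_rpow_of_nonpos (by norm_num) hx (by linarith)
  have h2 : x ^ (2 - p) * x ^ (p - 1) = x := by
    rw [← rpow_add hx0]
    norm_num
  have h3 : x ^ (2 - p) * x ^ (p - 1) ≤ 2 ^ (2 - p) * x ^ (p - 1) := by gcongr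
  rw [h2] at h3
  rw [reaction, mul_assoc]
  gcongr
  linarith

theorem potential_le {lam p x C : ℝ} (hp : 2 < p) (hlam : 0 < lam) (hx : 0 ≤ x) (hC : x ≤ C) :
    potential lam p x ≤ lam * (C ^ p / p) := by
  have : x ^ p ≤ C ^ p := rpow_le_rpow hx hC (by linarith)
  have : x ^ p / p ≤ C ^ p / p := by gcongr
  rw [potential]
  gcongr
  nlinarith

theorem potential_nonpos {lam p x : ℝ} (hp : 2 < p) (hlam : 0 < lam) (hx : 0 ≤ x) (hx1 : x ≤ 1) :
    potential lam p x ≤ 0 := by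
  have h1 : x ^ p ≤ x ^ (2 : ℝ) := by
    rcases hx.eq_or_lt with rfl | h
    · rw [zero_rpow (by linarith), zero_rpow (by norm_num)]
    · exact rpow_le_rpow_of_exponent_ge h hx1 hp.le
  rw [rpow_two] at h1
  have h2 : x ^ p / p ≤ x ^ 2 / 2 := by gcongr
  rw [potential]
  nlinarith

namespace IsDescent

variable {n : ℕ} {lam p α T : ℝ} {g u v : ℝ → ℝ}

/-- An upper bound at time `1 / 2` which does not depend on the initial height. -/
theorem u_half_le (hp : 2 < p) (hlam : 0 < lam) (h : IsDescent n lam p g α u v 1) :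
    u (1 / 2) ≤ max 2
      (((p - 2) * (lam * (1 - 2 ^ (2 - p)) / (n + 1) * sin (1 / 4)) * (1 / 4)) ^ (2 - p)⁻¹) := by
  rcases le_or_gt (u (1 / 2)) 2 with h2 | h2
  · exact h2.trans (le_max_left _ _)
  refine le_trans ?_ (le_max_right _ _)
  have h2p : (2 : ℝ) ^ (2 - p) < 1 := rpow_lt_one_of_one_lt_of_neg (by norm_num) (by linarith)
  set κ := lam * (1 - (2 : ℝ) ^ (2 - p)) with hκ
  have hκ0 : 0 < κ := mul_pos hlam (by linarith)
  have hs4 : 0 < sin (1 / 4) := h.sin_pos (by norm_num) (by norm_num)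
  have hu2 : ∀ t ∈ Icc (0 : ℝ) (1 / 2), 2 < u t := fun t ht =>
    h2.trans_le (h.u_anti ht.1 ht.2 (by norm_num))
  have hv : ∀ t ∈ Ioc (0 : ℝ) (1 / 2), v t ≤ -(κ * u t ^ (p - 1) / (n + 1) * sin t) := by
    intro t ht
    have ht1 : t ≤ 1 := ht.2.trans (by norm_num)
    have hst := h.sin_pos ht.1 ht1
    have hut := hu2 t ⟨ht.1.le, ht.2⟩
    have := le_of_hasDerivAt_nonpos
      (F := fun r => sin r ^ n * v r + κ * u t ^ (p - 1) / (n + 1) * sin r ^ (n + 1)) ht.1.le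
      ((h.continuousOn_flux le_rfl ht1).add (by fun_prop))
      (fun r hr => (h.shot.hasDerivAt_flux (h.mem_Ioo_zero_pi hr.1 (hr.2.le.trans ht1))).add
        (((hasDerivAt_sin r).pow (n + 1)).const_mul (κ * u t ^ (p - 1) / (n + 1))))
      (fun r hr => by
        have hr1 := hr.2.le.trans ht1
        have hsr := h.sin_pos hr.1 hr1
        have h3 : κ * u t ^ (p - 1) ≤ g (u r) := by
          rw [h.g_eq ⟨hr.1.le, hr1⟩]
          refine le_trans ?_ (reaction_ge hp hlam (hu2 r ⟨hr.1.le, hr.2.le.trans ht.2⟩).le)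
          have : u t ^ (p - 1) ≤ u r ^ (p - 1) :=
            rpow_le_rpow (by linarith) (h.u_anti hr.1.le hr.2.le ht1) (by linarith)
          gcongr
        have h4 : sin r ^ n * (κ * u t ^ (p - 1)) * cos r ≤
            sin r ^ n * (κ * u t ^ (p - 1)) * 1 := by
          have : 0 ≤ u t := by linarith
          have := cos_le_one r
          gcongr
        have h5 : sin r ^ n * (κ * u t ^ (p - 1)) ≤ sin r ^ n * g (u r) := by gcongr
        have h6 : κ * u t ^ (p - 1) / (n + 1) * (((n + 1 : ℕ) : ℝ) * sin r ^ (n + 1 - 1) * cos r)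
            = sin r ^ n * (κ * u t ^ (p - 1)) * cos r := by
          rw [Nat.add_sub_cancel]
          push_cast
          field_simp
        linarith)
    simp only [h.shot.v_zero, sin_zero, mul_zero, zero_add, ne_eq, Nat.add_eq_zero_iff,
      one_ne_zero, and_false, not_false_eq_true, zero_pow] at this
    have h7 : sin t ^ n * (v t + κ * u t ^ (p - 1) / (n + 1) * sin t) ≤ 0 := by
      rw [pow_succ] at this
      linarith
    have := nonpos_of_mul_nonpos_right h7 (pow_pos hst n)
    linarith
  set B := (p - 2) * (κ / (n + 1) * sin (1 / 4)) with hB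
  have hB0 : 0 < B := mul_pos (by linarith) (by positivity)
  have hmain := le_of_hasDerivAt_nonneg (F := fun r => u r ^ (2 - p) - B * r)
    (F' := fun r => v r * (2 - p) * u r ^ (2 - p - 1) - B) (show (1 / 4 : ℝ) ≤ 1 / 2 by norm_num)
    (((h.continuousOn_u (by norm_num) (by norm_num)).rpow_const fun x hx =>
      Or.inl (by linarith [hu2 x ⟨by linarith [hx.1], hx.2⟩])).sub (by fun_prop))
    (fun r hr => by
      have hr0 : (0 : ℝ) < r := by linarith [hr.1]
      have hr1 : r ≤ 1 := by linarith [hr.2]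
      exact (((h.shot.deru r (h.mem_Ioo_zero_pi hr0 hr1)).rpow_const
        (Or.inl (h.pos r ⟨hr0.le, hr1⟩).ne')).sub
        ((hasDerivAt_id r).const_mul B)).congr_deriv (by simp))
    (fun r hr => by
      have hr0 : (0 : ℝ) < r := by linarith [hr.1]
      have hr1 : r ≤ 1 := by linarith [hr.2]
      have hu := h.pos r ⟨hr0.le, hr1⟩
      have h3 := hv r ⟨hr0, hr.2.le⟩
      have h4 : sin (1 / 4) ≤ sin r :=
        sin_le_sin_of_le_of_le_pi_div_two (by linarith [pi_pos]) (by linarith [pi_gt_three]) hr.1.le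
      have h5 : u r ^ (p - 1) * u r ^ (2 - p - 1) = 1 := by
        rw [← rpow_add hu, show p - 1 + (2 - p - 1) = 0 by ring, rpow_zero]
      have h6 : κ / (n + 1) * sin (1 / 4) ≤ κ / (n + 1) * sin r := by gcongr
      have h7 : κ / (n + 1) * sin r ≤ -v r * u r ^ (2 - p - 1) := by
        calc κ / (n + 1) * sin r
            = κ / (n + 1) * sin r * (u r ^ (p - 1) * u r ^ (2 - p - 1)) := by rw [h5, mul_one]
          _ = (κ * u r ^ (p - 1) / (n + 1) * sin r) * u r ^ (2 - p - 1) := by ring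
          _ ≤ -v r * u r ^ (2 - p - 1) := by
            gcongr
            linarith
      have h8 : B ≤ (p - 2) * (-v r * u r ^ (2 - p - 1)) := by
        rw [hB]
        exact mul_le_mul_of_nonneg_left (h6.trans h7) (by linarith)
      linarith)
  have h9 : 0 < u (1 / 4) ^ (2 - p) := rpow_pos_of_pos (h.pos _ ⟨by norm_num, by norm_num⟩) _
  exact le_rpow_inv_of_le_rpow_of_neg (by linarith) (by positivity) (by linarith) (by linarith)

/-- A bound on the Pohozaev functional at time `1` which does not depend on the initial height. -/
theorem pohozaev_one_le (hp : 2 < p) (hlam : 0 < lam) (hn : 1 ≤ n)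
    (h : IsDescent n lam p g α u v 1) (hv1 : v 1 ≤ 0) {C : ℝ} (hC : u (1 / 2) ≤ C) :
    pohozaev n lam p u v 1 ≤ 2 * C ^ 2 + lam * (C ^ p / p) := by
  have hn1 : (1 : ℝ) ≤ n := by exact_mod_cast hn
  obtain ⟨ξ, hξ, hslope⟩ := exists_hasDerivAt_eq_slope u v (show (1 / 2 : ℝ) < 1 by norm_num)
    (h.continuousOn_u (by norm_num) le_rfl)
    (fun r hr => h.shot.deru r (h.mem_Ioo_zero_pi (by linarith [hr.1]) hr.2.le))
  have hξ0 : 0 < ξ := by linarith [hξ.1]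
  have hu1 := h.pos 1 ⟨by norm_num, le_rfl⟩
  have huξ := h.pos ξ ⟨hξ0.le, hξ.2.le⟩
  have huh := h.pos (1 / 2) ⟨by norm_num, by norm_num⟩
  have hv : -v ξ ≤ 2 * C := by
    rw [hslope]
    norm_num
    linarith
  have hvξ := h.neg ξ ⟨hξ0, hξ.2⟩
  have hE : v 1 ^ 2 / 2 + potential lam p (u 1) ≤ v ξ ^ 2 / 2 + potential lam p (u ξ) :=
    le_of_hasDerivAt_nonpos (F := fun t => v t ^ 2 / 2 + potential lam p (u t)) hξ.2.le
      (h.continuousOn_energy hp hξ0.le le_rfl)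
      (fun r hr => h.hasDerivAt_energy hp (hξ0.trans hr.1) hr.2.le) (fun r hr => by
        have h1 := h.sin_pos (hξ0.trans hr.1) hr.2.le
        have h2 := h.cos_pos (hξ0.trans hr.1).le hr.2.le
        have : 0 ≤ n * (cos r / sin r) * v r ^ 2 := by positivity
        linarith)
  have hF := potential_le hp hlam huξ.le ((h.u_anti (by norm_num) hξ.1.le hξ.2.le).trans hC)
  have hs := h.sin_pos one_pos le_rfl
  have hc := h.cos_pos one_pos.le le_rfl
  have h1 : v 1 ^ 2 / 2 + potential lam p (u 1) ≤ 2 * C ^ 2 + lam * (C ^ p / p) := by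
    nlinarith
  have h0 : 0 ≤ 2 * C ^ 2 + lam * (C ^ p / p) := by
    have : 0 < C := huh.trans_le hC
    positivity
  have h2 : sin 1 ^ (n + 1) ≤ 1 := pow_le_one₀ hs.le (sin_le_one 1)
  have h3 : 0 ≤ (n - 1) / 2 * (cos 1 * u 1 * (sin 1 ^ n * (-v 1))) := by
    have : 0 ≤ -v 1 := by linarith
    have : 0 ≤ ((n : ℝ) - 1) / 2 := by linarith
    positivity
  have h4 : sin 1 ^ (n + 1) * (v 1 ^ 2 / 2 + potential lam p (u 1)) ≤
      1 * (2 * C ^ 2 + lam * (C ^ p / p)) :=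
    (mul_le_mul_of_nonneg_left h1 (by positivity)).trans (mul_le_mul_of_nonneg_right h2 h0)
  rw [pohozaev]
  linarith

/-- A lower bound for the Pohozaev functional after the initial layer `[0, τ]`. -/
theorem pohozaev_ge (hp : 2 < p) (hlam : 0 < lam) (hn : 1 ≤ n)
    (h : IsDescent n lam p g α u v T) {τ K : ℝ} (hτ : 0 ≤ τ) (hτT : τ ≤ T) (hK : 0 ≤ K)
    (hδ : 0 ≤ ((n : ℝ) + 1) / p - (n - 1) / 2)
    (hτα : lam * α ^ (p - 1) * τ ^ 2 ≤ α / 2)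
    (hKle : ∀ x : ℝ, 0 < x → -K ≤ (((n : ℝ) + 1) / p - (n - 1) / 2) * x ^ p - x ^ 2) :
    lam / (n + 1) * (((((n : ℝ) + 1) / p - (n - 1) / 2) * (α / 2) ^ p - α ^ 2)
      * sin τ ^ (n + 1) - K) ≤ pohozaev n lam p u v T := by
  have hα : 0 < α := h.shot.u_zero ▸ h.pos 0 ⟨le_rfl, hτ.trans hτT⟩
  have h1 := h.pohozaev_sub_ge hp hlam hn le_rfl hτ hτT
    (N := (((n : ℝ) + 1) / p - (n - 1) / 2) * (α / 2) ^ p - α ^ 2) (fun t ht => by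
      have htT := ht.2.le.trans hτT
      have h2 : α / 2 ≤ u t := h.half_le hp hlam ht.1.le htT (by
        refine le_trans ?_ hτα
        have := ht.1
        have := ht.2
        gcongr)
      have h3 : (α / 2) ^ p ≤ u t ^ p := rpow_le_rpow (by positivity) h2 (by linarith)
      have h4 : u t ≤ α := h.u_le ⟨ht.1.le, htT⟩
      have h5 := h.pos t ⟨ht.1.le, htT⟩
      gcongr)
  have h2 := h.pohozaev_sub_ge hp hlam hn hτ hτT le_rfl (N := -K)
    (fun t ht => hKle _ (h.pos t ⟨hτ.trans ht.1.le, ht.2.le⟩))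
  have h3 : pohozaev n lam p u v 0 = 0 := by simp [pohozaev, h.shot.v_zero]
  rw [h3, sin_zero, zero_pow (by omega), sub_zero, sub_zero] at h1
  have h4 : sin T ^ (n + 1) ≤ 1 := by
    rcases (hτ.trans hτT).eq_or_lt with h0 | h0
    · simp [← h0]
    · exact pow_le_one₀ (h.sin_pos h0 le_rfl).le (sin_le_one T)
  have h5 : 0 ≤ sin τ ^ (n + 1) := by
    have : 0 ≤ sin τ := sin_nonneg_of_nonneg_of_le_pi hτ
      (by linarith [h.lt_pi_div_two, pi_pos])
    positivity
  have h6 : lam * K / (n + 1) * (sin T ^ (n + 1) - sin τ ^ (n + 1)) ≤ lam * K / (n + 1) * 1 := by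
    gcongr
    linarith
  have h7 : lam * -K / (n + 1) * (sin T ^ (n + 1) - sin τ ^ (n + 1))
    = -(lam * K / (n + 1) * (sin T ^ (n + 1) - sin τ ^ (n + 1))) := by ring
  have h8 : lam / (n + 1) * (((((n : ℝ) + 1) / p - (n - 1) / 2) * (α / 2) ^ p - α ^ 2)
      * sin τ ^ (n + 1) - K) = lam * ((((n : ℝ) + 1) / p - (n - 1) / 2) * (α / 2) ^ p - α ^ 2)
      / (n + 1) * sin τ ^ (n + 1) - lam * K / (n + 1) * 1 := by ring
  linarith

end IsDescent

theorem exists_neg_le_mul_rpow_sub_sq {p δ : ℝ} (hp : 2 < p) (hδ : 0 < δ) :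
    ∃ K : ℝ, 0 ≤ K ∧ ∀ x : ℝ, 0 < x → -K ≤ δ * x ^ p - x ^ 2 := by
  set X := (1 / δ) ^ (p - 2)⁻¹ with hX
  have hX0 : 0 < X := by positivity
  refine ⟨X ^ 2, by positivity, fun x hx => ?_⟩
  have h1 : 0 < x ^ p := by positivity
  rcases le_total x X with h | h
  · have h2 : x ^ 2 ≤ X ^ 2 := by gcongr
    have h3 : 0 < δ * x ^ p := by positivity
    linarith
  · have h2 : X ^ (p - 2) = 1 / δ := by
      rw [hX, ← rpow_mul (by positivity), inv_mul_cancel₀ (by linarith), rpow_one]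
    have h3 : 1 / δ ≤ x ^ (p - 2) := h2 ▸ rpow_le_rpow hX0.le h (by linarith)
    have h4 : x ^ p = x ^ (p - 2) * x ^ 2 := by
      rw [← rpow_two, ← rpow_add hx, sub_add_cancel]
    have h5 : 1 ≤ δ * x ^ (p - 2) := by
      rw [div_le_iff₀ hδ] at h3
      linarith
    have h6 : 1 * x ^ 2 ≤ δ * x ^ (p - 2) * x ^ 2 := by gcongr
    have h7 : 0 ≤ X ^ 2 := by positivity
    rw [h4]
    linarith

/-- A height `M` whose initial layer contributes arbitrarily much to the Pohozaev functional. -/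
theorem exists_large_height (n : ℕ) {lam p : ℝ} (hp : 2 < p) (hlam : 0 < lam)
    (hδ : 0 < ((n : ℝ) + 1) / p - (n - 1) / 2) (C K : ℝ) :
    ∃ M τ : ℝ, 2 < M ∧ 0 ≤ τ ∧ τ ≤ 1 ∧ lam * M ^ (p - 1) * τ ^ 2 ≤ M / 2 ∧
      C < lam / (n + 1) * (((((n : ℝ) + 1) / p - (n - 1) / 2) * (M / 2) ^ p - M ^ 2)
        * sin τ ^ (n + 1) - K) := by
  set δ := ((n : ℝ) + 1) / p - (n - 1) / 2 with hδ_def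
  set s := √(1 / (2 * lam)) with hs
  have hs0 : 0 < s := by positivity
  set D := δ / 2 ^ p / 2 with hD
  have hD0 : 0 < D := by positivity
  set e := p - (p - 2) / 2 * (n + 1) with he
  have he0 : 0 < e := by
    have : e = p * δ := by
      rw [he, hδ_def]
      field_simp
      ring
    rw [this]
    exact mul_pos (by linarith) hδ
  have hev1 := (tendsto_rpow_neg_atTop (show 0 < (p - 2) / 2 by linarith)).eventually
    (ge_mem_nhds (show (0 : ℝ) < 1 / s by positivity))
  have hev2 := (tendsto_rpow_neg_atTop (show 0 < p - 2 by linarith)).eventually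
    (ge_mem_nhds hD0)
  have hev3 := (tendsto_rpow_atTop he0).eventually
    (Filter.eventually_gt_atTop ((C * (n + 1) / lam + K) / (D * (s / 2) ^ (n + 1))))
  obtain ⟨M, ⟨⟨hM1, hM2⟩, hM3⟩, hM4⟩ :=
    (((hev1.and hev2).and hev3).and (Filter.eventually_gt_atTop 2)).exists
  have hM0 : 0 < M := by linarith
  set τ := s * M ^ (-((p - 2) / 2)) with hτ
  have hτ0 : 0 < τ := by positivity
  have hτ1 : τ ≤ 1 := by
    calc τ ≤ s * (1 / s) := by rw [hτ]; gcongr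
      _ = 1 := by field_simp
  refine ⟨M, τ, hM4, hτ0.le, hτ1, ?_, ?_⟩
  · have h1 : M ^ (-((p - 2) / 2)) * M ^ (-((p - 2) / 2)) * M ^ (p - 1) = M := by
      rw [← rpow_add hM0, ← rpow_add hM0]
      ring_nf
      rw [rpow_one]
    have h2 : s ^ 2 = 1 / (2 * lam) := sq_sqrt (by positivity)
    have h3 : lam * M ^ (p - 1) * τ ^ 2
        = lam * s ^ 2 * (M ^ (-((p - 2) / 2)) * M ^ (-((p - 2) / 2)) * M ^ (p - 1)) := by
      rw [hτ]; ring
    rw [h3, h1, h2]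
    field_simp
    rfl
  · have h1 : τ / 2 ≤ sin τ := by
      refine le_trans ?_ (mul_le_sin hτ0.le (by linarith [pi_gt_three]))
      have : 1 / 2 ≤ 2 / π := by
        rw [div_le_div_iff₀ two_pos pi_pos]
        linarith [pi_le_four]
      nlinarith
    have h2 : (τ / 2) ^ (n + 1) ≤ sin τ ^ (n + 1) := by gcongr
    have h3 : M ^ p * D ≤ δ * (M / 2) ^ p - M ^ 2 := by
      have h4 : M ^ p * M ^ (-(p - 2)) = M ^ 2 := by
        rw [← rpow_add hM0, ← rpow_two]
        ring_nf
      have h5 : M ^ p * M ^ (-(p - 2)) ≤ M ^ p * D := by gcongr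
      have h6 : δ * (M / 2) ^ p = M ^ p * D * 2 := by
        rw [div_rpow hM0.le (by norm_num), hD]
        ring
      linarith
    have h7 : M ^ p * D * (τ / 2) ^ (n + 1) ≤ (δ * (M / 2) ^ p - M ^ 2) * sin τ ^ (n + 1) := by
      have h8 : 0 ≤ M ^ p * D := by positivity
      exact mul_le_mul h3 h2 (by positivity) (h8.trans h3)
    have h8 : M ^ p * D * (τ / 2) ^ (n + 1) = M ^ e * (D * (s / 2) ^ (n + 1)) := by
      have h9 : τ ^ (n + 1) = s ^ (n + 1) * M ^ (-((p - 2) / 2) * ((n + 1 : ℕ) : ℝ)) := by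
        rw [hτ, mul_pow, rpow_mul hM0.le, rpow_natCast]
      have h10 : M ^ e = M ^ p * M ^ (-((p - 2) / 2) * ((n + 1 : ℕ) : ℝ)) := by
        rw [← rpow_add hM0, he]
        push_cast
        ring_nf
      rw [div_pow, h9, h10, div_pow]
      ring
    rw [div_lt_iff₀ (by positivity)] at hM3
    have h9 : C * (n + 1) / lam < (δ * (M / 2) ^ p - M ^ 2) * sin τ ^ (n + 1) - K := by linarith
    rw [div_lt_iff₀ hlam] at h9
    rw [div_mul_eq_mul_div, lt_div_iff₀ (by positivity)]
    linarith

namespace IsShot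

variable {n : ℕ} {g : ℝ → ℝ} {α : ℝ} {u v : ℝ → ℝ}

/-- The first critical time of a shot that turns. -/
theorem exists_first_zero (h : IsShot n g α u v) (hg : IsBistable g) (hα : 1 < α)
    (ht : Turns u v) :
    ∃ T ∈ Ioo 0 π, v T = 0 ∧ (∀ r ∈ Ioo 0 T, v r < 0) ∧ ∀ r ∈ Icc 0 T, 0 < u r := by
  obtain ⟨a, ha, hva, hu⟩ := ht
  obtain ⟨s, hs, hs1⟩ := h.exists_one_lt hα
  have hneg : ∀ r ∈ Ioc 0 s, v r < 0 := fun r hr =>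
    h.v_neg_of_one_lt hg.pos ⟨hr.1, hr.2.trans_lt hs.2⟩ fun x hx => hs1 x ⟨hx.1, hx.2.trans hr.2⟩
  have hsa : s < a := by
    by_contra! hle
    linarith [hneg a ⟨ha.1, hle⟩]
  have hvs := hneg s ⟨hs.1, le_rfl⟩
  have hc := h.continuousOn_Icc_v hs.1.le ha.2
  obtain ⟨z, hz, hvz⟩ := intermediate_value_Icc hsa.le hc ⟨hvs.le, hva.le⟩
  have hcomp : IsCompact (Icc s a ∩ v ⁻¹' {0}) :=
    isCompact_Icc.of_isClosed_subset (hc.preimage_isClosed_of_isClosed isClosed_Icc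
      isClosed_singleton) inter_subset_left
  obtain ⟨T, ⟨hT, hvT⟩, hleast⟩ := hcomp.exists_isLeast ⟨z, hz, hvz⟩
  refine ⟨T, ⟨hs.1.trans_le hT.1, hT.2.trans_lt ha.2⟩, hvT, fun r hr => ?_,
    fun r hr => hu r ⟨hr.1, hr.2.trans hT.2⟩⟩
  rcases le_total r s with hrs | hrs
  · exact hneg r ⟨hr.1, hrs⟩
  · by_contra! hvr
    have hra : r ≤ a := hr.2.le.trans hT.2
    obtain ⟨y, hy, hvy⟩ := intermediate_value_Icc hrs (hc.mono (Icc_subset_Icc_right hra))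
      ⟨hvs.le, hvr⟩
    exact absurd (hleast ⟨⟨hy.1, hy.2.trans hra⟩, hvy⟩) (not_le.2 (hy.2.trans_lt hr.2))

end IsShot

/-- Shots from a sufficiently large height cross zero. -/
theorem exists_forall_crosses {n : ℕ} {lam p : ℝ} (hp : 2 < p) (hlam : 0 < lam) (hn : 1 ≤ n)
    (hδ : 0 < ((n : ℝ) + 1) / p - (n - 1) / 2) :
    ∃ M : ℝ, 2 < M ∧ ∀ (g : ℝ → ℝ) (L : NNReal) (u v : ℝ → ℝ), LipschitzWith L g → IsBistable g →
      (∀ x ∈ Icc 0 M, g x = reaction lam p x) → IsShot n g M u v → Crosses u v := by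
  obtain ⟨K, hK, hKle⟩ := exists_neg_le_mul_rpow_sub_sq hp hδ
  set C := max 2
      (((p - 2) * (lam * (1 - 2 ^ (2 - p)) / (n + 1) * sin (1 / 4)) * (1 / 4)) ^ (2 - p)⁻¹) with hC
  have hC0 : 0 < C := two_pos.trans_le (le_max_left _ _)
  obtain ⟨M, τ, hM, hτ0, hτ1, hτM, hbig⟩ :=
    exists_large_height n hp hlam hδ (2 * C ^ 2 + lam * (C ^ p / p)) K
  refine ⟨M, hM, fun g L u v hL hg hgf h => ?_⟩
  have hlong : IsDescent n lam p g M u v 1 → v 1 ≤ 0 → False := fun hd hv1 =>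
    absurd (hbig.trans_le (hd.pohozaev_ge hp hlam hn hτ0 hτ1 hK hδ.le hτM hKle))
      (not_lt.2 (hd.pohozaev_one_le hp hlam hn hv1 (hd.u_half_le hp hlam)))
  rcases h.turns_or_crosses_or_descends hL hg (by linarith) with ht | hc | hd
  · exfalso
    obtain ⟨T, hT, hvT, hneg, hpos⟩ := h.exists_first_zero hg (by linarith) ht
    rcases le_or_gt T 1 with hT1 | hT1
    · have hd : IsDescent n lam p g M u v T := ⟨h, hgf, hpos, hneg, hT1⟩
      have hgT := h.reaction_nonpos hL.continuous le_rfl hT.1 hT.2 hneg hvT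
      have huT : u T ≤ 1 := by
        by_contra! hlt
        linarith [hg.pos _ hlt]
      have hτT : τ ≤ T := by
        by_contra! hlt
        have := hd.half_le hp hlam hT.1.le le_rfl (by
          refine le_trans ?_ hτM
          have := hT.1
          gcongr)
        linarith
      have h1 := hd.pohozaev_ge hp hlam hn hτ0 hτT hK hδ.le hτM hKle
      have h2 := potential_nonpos hp hlam (hpos T ⟨hT.1.le, le_rfl⟩).le huT
      have h3 : 0 < sin T ^ (n + 1) := pow_pos (sin_pos_of_mem_Ioo hT) _
      have h4 : 0 ≤ 2 * C ^ 2 + lam * (C ^ p / p) := by positivity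
      rw [pohozaev, hvT] at h1
      nlinarith
    · exact hlong ⟨h, hgf, fun t ht => hpos t ⟨ht.1, ht.2.trans hT1.le⟩,
        fun t ht => hneg t ⟨ht.1, ht.2.trans hT1⟩, le_rfl⟩ (hneg 1 ⟨one_pos, hT1⟩).le
  · exact hc
  · exfalso
    have hπ := pi_gt_three
    refine hlong ⟨h, hgf, fun t ht => ?_, fun t ht => (hd t ⟨ht.1, by linarith [ht.2]⟩).2, le_rfl⟩
      (hd 1 ⟨one_pos, by linarith⟩).2.le
    rcases ht.1.eq_or_lt with rfl | h0
    · rw [h.u_zero]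
      linarith
    · exact (hd t ⟨h0, by linarith [ht.2]⟩).1

/-- The nonlinearity of the Yamabe ODE, frozen outside `[0, M]`. -/
noncomputable def truncReaction (lam p M x : ℝ) : ℝ := reaction lam p (max 0 (min x M))

theorem truncReaction_eq {lam p M x : ℝ} (hx : x ∈ Icc 0 M) :
    truncReaction lam p M x = reaction lam p x := by
  rw [truncReaction, min_eq_left hx.2, max_eq_right hx.1]

theorem hasDerivAt_reaction {lam p x : ℝ} (hp : 2 < p) :
    HasDerivAt (reaction lam p) (lam * ((p - 1) * x ^ (p - 2) - 1)) x := by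
  have h := hasDerivAt_rpow_const (x := x) (p := p - 1) (Or.inr (by linarith))
  refine ((h.sub (hasDerivAt_id x)).const_mul lam).congr_deriv ?_
  rw [show p - 1 - 1 = p - 2 by ring]

theorem exists_lipschitzWith_truncReaction {lam p M : ℝ} (hp : 2 < p) (hlam : 0 < lam)
    (hM : 0 ≤ M) : ∃ L : NNReal, LipschitzWith L (truncReaction lam p M) := by
  have hB : 0 ≤ lam * ((p - 1) * M ^ (p - 2) + 1) := by
    have : 0 ≤ p - 1 := by linarith
    positivity
  obtain ⟨B, hBeq⟩ : ∃ B : NNReal, (B : ℝ) = lam * ((p - 1) * M ^ (p - 2) + 1) :=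
    ⟨toNNReal _, coe_toNNReal _ hB⟩
  have hon : LipschitzOnWith B (reaction lam p) (Icc 0 M) := by
    refine (convex_Icc 0 M).lipschitzOnWith_of_nnnorm_hasDerivWithin_le
      (fun x _ => (hasDerivAt_reaction hp).hasDerivWithinAt) fun x hx => ?_
    rw [← NNReal.coe_le_coe, coe_nnnorm, norm_eq_abs, hBeq, abs_mul, abs_of_pos hlam]
    have h1 : 0 ≤ x ^ (p - 2) := rpow_nonneg hx.1 _
    have h2 : x ^ (p - 2) ≤ M ^ (p - 2) := rpow_le_rpow hx.1 hx.2 (by linarith)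
    have h3 : (p - 1) * x ^ (p - 2) ≤ (p - 1) * M ^ (p - 2) :=
      mul_le_mul_of_nonneg_left h2 (by linarith)
    have h4 : 0 ≤ (p - 1) * x ^ (p - 2) := mul_nonneg (by linarith) h1
    gcongr
    rw [abs_le]
    constructor <;> linarith
  have hclamp : LipschitzWith 1 fun x : ℝ => max 0 (min x M) :=
    (LipschitzWith.id.min_const M).const_max 0
  exact ⟨B * 1, lipschitzOnWith_univ.1 (hon.comp (lipschitzOnWith_univ.2 hclamp) fun x _ =>
    ⟨le_max_left _ _, max_le hM (min_le_right _ _)⟩)⟩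

theorem isBistable_truncReaction {lam p M : ℝ} (hp : 2 < p) (hlam : 0 < lam) (hM : 1 < M) :
    IsBistable (truncReaction lam p M) where
  zero := by
    rw [truncReaction_eq ⟨le_rfl, by linarith⟩, reaction, zero_rpow (by linarith)]
    ring
  one := by
    rw [truncReaction_eq ⟨zero_le_one, hM.le⟩, reaction, one_rpow]
    ring
  neg x hx := by
    rw [truncReaction_eq ⟨hx.1.le, by linarith [hx.2]⟩, reaction]
    have h := rpow_lt_rpow_of_exponent_gt hx.1 hx.2 (show (1 : ℝ) < p - 1 by linarith)
    rw [rpow_one] at h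
    nlinarith
  pos x hx := by
    have hy : 1 < max 0 (min x M) := lt_max_of_lt_right (lt_min hx hM)
    have h := rpow_lt_rpow_of_exponent_lt hy (show (1 : ℝ) < p - 1 by linarith)
    rw [rpow_one] at h
    rw [truncReaction, reaction]
    exact mul_pos hlam (by linarith)

theorem abs_le_of_lipschitzWith_truncReaction {lam p M : ℝ} (hp : 2 < p) (hM : 0 ≤ M)
    {L : NNReal} (hL : LipschitzWith L (truncReaction lam p M)) (x : ℝ) :
    |truncReaction lam p M x| ≤ L * M := by
  set y := max 0 (min x M) with hy
  have hyI : y ∈ Icc 0 M := ⟨le_max_left _ _, max_le hM (min_le_right _ _)⟩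
  have h0 : truncReaction lam p M 0 = 0 := by
    rw [truncReaction_eq ⟨le_rfl, hM⟩, reaction, zero_rpow (by linarith)]
    ring
  have h1 : truncReaction lam p M x = truncReaction lam p M y := by
    rw [truncReaction_eq hyI, truncReaction]
  have h2 := hL.dist_le_mul y 0
  rw [Real.dist_eq, Real.dist_eq, h0, sub_zero, sub_zero, abs_of_nonneg hyI.1] at h2
  rw [h1]
  exact h2.trans (mul_le_mul_of_nonneg_left hyI.2 L.2)

theorem exists_forall_hasDerivAt_truncReaction {lam p M c : ℝ} (hp : 2 < p) (hM : 2 < M)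
    (hc : c < lam * (p - 2)) :
    ∃ η : ℝ, 0 < η ∧ η < 1 ∧ ∀ x, |x - 1| ≤ η →
      HasDerivAt (truncReaction lam p M) (lam * ((p - 1) * x ^ (p - 2) - 1)) x ∧
        c ≤ lam * ((p - 1) * x ^ (p - 2) - 1) := by
  have hcont : ContinuousAt (fun x : ℝ => lam * ((p - 1) * x ^ (p - 2) - 1)) 1 :=
    (((continuousAt_rpow_const 1 (p - 2) (Or.inl one_ne_zero)).const_mul (p - 1)).sub
      continuousAt_const).const_mul lam
  have hone : c < lam * ((p - 1) * (1 : ℝ) ^ (p - 2) - 1) := by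
    rw [one_rpow]
    linarith
  have hev := hcont.eventually (le_mem_nhds hone)
  obtain ⟨ε, hε, hsub⟩ := exists_Icc_subset_of_mem_nhds hev
  refine ⟨min ε (1 / 2), lt_min hε (by norm_num),
    (min_le_right _ _).trans_lt (by norm_num), fun x hx => ?_⟩
  have h1 := abs_le.1 (hx.trans (min_le_left _ _))
  have h2 := abs_le.1 (hx.trans (min_le_right _ _))
  refine ⟨(hasDerivAt_reaction hp).congr_of_eventuallyEq ?_,
    hsub ⟨by linarith [h1.1], by linarith [h1.2]⟩⟩
  filter_upwards [Icc_mem_nhds (show 0 < x by linarith [h2.1]) (show x < M by linarith [h2.2])]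
    with y hy using truncReaction_eq hy

/-- The existence statement in terms of `n = m - 1`, for a subcritical exponent `p`. -/
theorem exists_strictAntiOn_solution {n : ℕ} {lam p : ℝ} (hp : 2 < p) (hlam : 0 < lam)
    (hn : 1 ≤ n) (hδ : 0 < ((n : ℝ) + 1) / p - (n - 1) / 2) (hsteep : n + 1 < lam * (p - 2)) :
    ∃ α : ℝ, 1 < α ∧ ∃ u : ℝ → ℝ, IsYamabeSolution (n + 1) p lam u ∧
      u 0 = α ∧ deriv u 0 = 0 ∧ (∀ t ∈ Icc (0 : ℝ) π, 0 < u t) ∧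
      StrictAntiOn u (Icc (0 : ℝ) π) ∧ deriv u π = 0 := by
  obtain ⟨M, hM, hcross⟩ := exists_forall_crosses hp hlam hn hδ
  obtain ⟨L, hL⟩ := exists_lipschitzWith_truncReaction hp hlam (show 0 ≤ M by linarith)
  have hg := isBistable_truncReaction hp hlam (show 1 < M by linarith)
  choose U V hUV using
    exists_isShot (n := n) hL (abs_le_of_lipschitzWith_truncReaction hp (by linarith) hL)
  obtain ⟨η, hη, hη1, hder⟩ := exists_forall_hasDerivAt_truncReaction (lam := lam) hp hM
    (show n + 1 + (lam * (p - 2) - (n + 1)) / 2 < lam * (p - 2) by linarith)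
  obtain ⟨a, ha, haM, hturn⟩ := IsShot.exists_turns hL hg
    (show 0 < (lam * (p - 2) - (n + 1)) / 2 by linarith) hη hη1 (show 1 < M by linarith) hder hUV
  obtain ⟨α, hα, hdesc⟩ := exists_descends hL hg hUV ha haM hturn
    (hcross _ L _ _ hL hg (fun x hx => truncReaction_eq hx) (hUV M))
  obtain ⟨w, hw0, hwU, hwd, hd0, hdπ, hpos, hanti⟩ :=
    (hUV α).exists_extension hL hg.zero hn hdesc
  refine ⟨α, ha.trans_le hα.1, w, ⟨?_, ?_, ?_, ?_⟩, hw0, hd0.deriv, hpos, hanti, hdπ.deriv⟩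
  all_goals
    have hdiff : ∀ t ∈ Icc (0 : ℝ) π, DifferentiableAt ℝ w t := by
      intro t ht
      rcases ht.1.eq_or_lt with rfl | h0
      · exact hd0.differentiableAt
      rcases ht.2.eq_or_lt with rfl | h1
      · exact hdπ.differentiableAt
      exact (hwd t ⟨h0, h1⟩).differentiableAt
    have hdd : ∀ t ∈ Ioo (0 : ℝ) π, HasDerivAt (deriv w)
        (-(n * (cos t / sin t) * V α t) - truncReaction lam p M (U α t)) t := by
      intro t ht
      refine ((hUV α).derv t ht).congr_of_eventuallyEq ?_
      filter_upwards [Ioo_mem_nhds ht.1 ht.2] with s hs using (hwd s hs).deriv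
  · exact fun t ht => (hdiff t ht).continuousAt.continuousWithinAt
  · exact hdiff
  · exact fun t ht => (hdd t ht).differentiableAt
  · intro t ht
    have hwt := hpos t ⟨ht.1.le, ht.2.le⟩
    have hle : w t ≤ M := by
      have := hanti.antitoneOn ⟨le_rfl, pi_pos.le⟩ ⟨ht.1.le, ht.2.le⟩ ht.1.le
      linarith [hα.2]
    rw [(hdd t ht).deriv, (hwd t ht).deriv, ← hwU t ht, truncReaction_eq ⟨hwt.le, hle⟩, reaction]
    push_cast
    ring

/-- If `λ > m / (p - 2)` with `p = 2(m+k)/(m+k-2)`, then there is a strictly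
decreasing positive solution of the Yamabe ODE starting at some `α > 1` with
`u'(0) = u'(π) = 0`. -/
theorem exists_strictly_decreasing_solution (m k : ℕ) (hm : 2 ≤ m)
    (hk : 1 ≤ k) (p lam : ℝ)
    (hp : p = 2 * ((m : ℝ) + (k : ℝ)) / ((m : ℝ) + (k : ℝ) - 2))
    (hlam : (m : ℝ) / (p - 2) < lam) :
    ∃ α : ℝ, 1 < α ∧ ∃ u : ℝ → ℝ, IsYamabeSolution m p lam u ∧
      u 0 = α ∧ deriv u 0 = 0 ∧ (∀ t ∈ Icc (0 : ℝ) π, 0 < u t) ∧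
      StrictAntiOn u (Icc (0 : ℝ) π) ∧ deriv u π = 0 := by
  obtain ⟨n, rfl⟩ : ∃ n, m = n + 1 := ⟨m - 1, by omega⟩
  have hn : (1 : ℝ) ≤ n := by exact_mod_cast (show 1 ≤ n by omega)
  have hk1 : (1 : ℝ) ≤ k := by exact_mod_cast hk
  push_cast at hp hlam
  have hd : 0 < (n : ℝ) + 1 + k - 2 := by linarith
  have hp2 : p - 2 = 4 / (n + 1 + k - 2) := by
    rw [hp]
    field_simp
    ring
  have hp2pos : 0 < p - 2 := hp2 ▸ by positivity
  have hδ : ((n : ℝ) + 1) / p - (n - 1) / 2 = k / (n + 1 + k) := by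
    rw [hp]
    field_simp
    ring
  refine exists_strictAntiOn_solution (by linarith) (lt_trans (by positivity) hlam) (by omega)
    (hδ ▸ by positivity) ?_
  rwa [div_lt_iff₀ hp2pos] at hlam
end

section
/- Let u be a solution of the Yamabe ODE with u(t) > 0 for all t ∈ (0,π), and let E(t) = u'(t)²/2 + λ·(u(t)^p/p − u(t)²/2) be its energy. Then for every t ∈ (0,π), E is differentiable at t with E'(t) = −(m−1)·(cos t/sin t)·u'(t)²; consequently E is nonincreasing (antitone) on (0,π/2]. -/
open Real Set

/-- The energy `E(t) = u'(t)²/2 + λ (u(t)^p / p - u(t)²/2)` of a positive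
solution of the Yamabe ODE satisfies
`E'(t) = -(m-1) (cos t / sin t) u'(t)²` on `(0, π)`; consequently `E` is
nonincreasing on `(0, π/2]`. -/
theorem energy_deriv_and_antitone (m : ℕ) (hm : 2 ≤ m) (p lam : ℝ)
    (hp : 2 < p) (hlam : 0 < lam) (u : ℝ → ℝ)
    (hu : IsYamabeSolution m p lam u)
    (hpos : ∀ t ∈ Ioo (0 : ℝ) π, 0 < u t)
    (E : ℝ → ℝ)
    (hE : E = fun t => (deriv u t) ^ 2 / 2
      + lam * (u t ^ p / p - (u t) ^ 2 / 2)) :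
    (∀ t ∈ Ioo (0 : ℝ) π,
      HasDerivAt E
        (-((m : ℝ) - 1) * (Real.cos t / Real.sin t) * (deriv u t) ^ 2) t) ∧
    AntitoneOn E (Ioc (0 : ℝ) (π / 2)) := by
  obtain ⟨-, hdiff, hdiff', hode⟩ := hu
  have hderiv : ∀ t ∈ Ioo (0 : ℝ) π,
      HasDerivAt E
        (-((m : ℝ) - 1) * (Real.cos t / Real.sin t) * (deriv u t) ^ 2) t := by
    intro t ht
    have hu₁ := (hdiff t (Ioo_subset_Icc_self ht)).hasDerivAt
    have hu₂ := (hdiff' t ht).hasDerivAt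
    have hrpow := hu₁.rpow_const (p := p) (Or.inl (hpos t ht).ne')
    have hp₀ : p ≠ 0 := by linarith
    rw [hE]
    refine (((hu₂.pow 2).div_const 2).add
      (((hrpow.div_const p).sub ((hu₁.pow 2).div_const 2)).const_mul lam)).congr_deriv ?_
    have hcancel : deriv u t * p * u t ^ (p - 1) / p = deriv u t * u t ^ (p - 1) := by
      field_simp
    rw [hcancel]
    push_cast
    linear_combination deriv u t * hode t ht
  refine ⟨hderiv, ?_⟩
  have hsub : Ioc (0 : ℝ) (π / 2) ⊆ Ioo 0 π := fun t ht =>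
    ⟨ht.1, by linarith [ht.2, Real.pi_pos]⟩
  refine antitoneOn_of_deriv_nonpos (convex_Ioc _ _)
    (fun t ht => (hderiv t (hsub ht)).continuousAt.continuousWithinAt)
    (fun t ht => (hderiv t (hsub (interior_subset ht))).differentiableAt.differentiableWithinAt)
    fun t ht => ?_
  have ht' := interior_subset ht
  rw [(hderiv t (hsub ht')).deriv]
  have hcos : 0 ≤ Real.cos t :=
    Real.cos_nonneg_of_neg_pi_div_two_le_of_le (by linarith [ht'.1, Real.pi_pos]) ht'.2
  have hsin : 0 ≤ Real.sin t :=
    (Real.sin_pos_of_mem_Ioo (hsub ht')).le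
  have hm' : (0 : ℝ) ≤ (m : ℝ) - 1 := by
    have : (2 : ℝ) ≤ m := by exact_mod_cast hm
    linarith
  have := mul_nonneg (mul_nonneg hm' (div_nonneg hcos hsin)) (sq_nonneg (deriv u t))
  linarith
end

section
/- Let u be a solution of the Yamabe ODE with u(t) > 0 for all t ∈ [0,π], and suppose u is not identically equal to 1 on [0,π]. If t₀ ∈ (0,π) is a local minimum of u, then u(t₀) < 1 and E(t₀) < 0, where E is the energy of u. -/
open Real Set

open Filter Topology

/-- The second derivative is nonnegative at a local minimum. -/
theorem IsLocalMin.deriv_deriv_nonneg {f : ℝ → ℝ} {a : ℝ} (h : IsLocalMin f a)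
    (hc : ContinuousAt f a) : 0 ≤ deriv (deriv f) a := by
  by_contra! hneg
  have hmax : IsLocalMax f a := isLocalMax_of_deriv_deriv_neg hneg h.deriv_eq_zero hc
  have hconst : f =ᶠ[𝓝 a] fun _ => f a := by
    filter_upwards [h, hmax] with x h₁ h₂ using le_antisymm h₂ h₁
  have h₀ := hconst.deriv.deriv_eq
  simp at h₀
  linarith

/-- The potential `x ^ p / p - x ^ 2 / 2` attains its minimum over `(0, ∞)` at `1`. -/
theorem potential_one_le {p x : ℝ} (hp : 2 < p) (hx : 0 < x) :
    1 / p - 1 / 2 ≤ x ^ p / p - x ^ 2 / 2 := by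
  have hb := one_add_mul_self_le_rpow_one_add (s := x ^ 2 - 1) (p := p / 2)
    (by nlinarith [sq_nonneg x]) (by linarith)
  have hpow : (1 + (x ^ 2 - 1)) ^ (p / 2) = x ^ p := by
    rw [add_sub_cancel, ← Real.rpow_natCast x 2, ← Real.rpow_mul hx.le]
    congr 1
    push_cast
    ring
  rw [hpow] at hb
  have hdiv := div_le_div_of_nonneg_right hb (show 0 ≤ p by linarith)
  have hsplit : (1 + p / 2 * (x ^ 2 - 1)) / p = 1 / p + (x ^ 2 - 1) / 2 := by
    field_simp
  linarith

/-- The potential `x ^ p / p - x ^ 2 / 2` is negative on `(0, 1)`. -/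
theorem potential_neg {p x : ℝ} (hp : 2 < p) (hx : 0 < x) (hx1 : x < 1) :
    x ^ p / p - x ^ 2 / 2 < 0 := by
  have hlt : x ^ p < x ^ 2 := by
    rw [← Real.rpow_natCast x 2]
    exact Real.rpow_lt_rpow_of_exponent_gt hx hx1 (by exact_mod_cast hp)
  have hdiv : x ^ p / p ≤ x ^ p / 2 :=
    div_le_div_of_nonneg_left (Real.rpow_nonneg hx.le p) two_pos hp.le
  linarith

/-- The energy of `u`, normalized to vanish for the constant solution `1`. -/
noncomputable def relativeEnergy (p lam : ℝ) (u : ℝ → ℝ) (t : ℝ) : ℝ :=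
  deriv u t ^ 2 / 2 + lam * (u t ^ p / p - u t ^ 2 / 2 - (1 / p - 1 / 2))

theorem sq_deriv_le_two_mul_relativeEnergy {p lam : ℝ} (hp : 2 < p) (hlam : 0 < lam)
    {u : ℝ → ℝ} {t : ℝ} (ht : 0 < u t) :
    deriv u t ^ 2 ≤ 2 * relativeEnergy p lam u t := by
  have := mul_nonneg hlam.le (sub_nonneg.2 (potential_one_le hp ht))
  unfold relativeEnergy
  linarith

section

variable {m : ℕ} {p lam : ℝ} {u : ℝ → ℝ}

theorem IsYamabeSolution.hasDerivAt_relativeEnergy (hp : 2 < p)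
    (hu : IsYamabeSolution m p lam u) (hpos : ∀ t ∈ Icc (0 : ℝ) π, 0 < u t) {t : ℝ}
    (ht : t ∈ Ioo (0 : ℝ) π) :
    HasDerivAt (relativeEnergy p lam u)
      (-(((m : ℝ) - 1) * (cos t / sin t) * deriv u t ^ 2)) t := by
  obtain ⟨-, hd, hdd, hode⟩ := hu
  have h₁ := (hd t (Ioo_subset_Icc_self ht)).hasDerivAt
  have h₂ := (hdd t ht).hasDerivAt
  have hpow := h₁.rpow_const (p := p) (Or.inl (hpos t (Ioo_subset_Icc_self ht)).ne')
  have h := ((h₂.pow 2).div_const 2).add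
    ((((hpow.div_const p).sub ((h₁.pow 2).div_const 2)).sub_const (1 / p - 1 / 2)).const_mul lam)
  refine h.congr_deriv ?_
  have hcancel : deriv u t * p * u t ^ (p - 1) / p = deriv u t * u t ^ (p - 1) := by
    field_simp
  rw [hcancel]
  push_cast
  linear_combination deriv u t * hode t ht

theorem IsYamabeSolution.hasDerivAt_relativeEnergy_mul_sin_pow {k : ℕ} (hk : m = k + 1)
    (hp : 2 < p) (hu : IsYamabeSolution m p lam u) (hpos : ∀ t ∈ Icc (0 : ℝ) π, 0 < u t)
    {t : ℝ} (ht : t ∈ Ioo (0 : ℝ) π) :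
    HasDerivAt (fun t => relativeEnergy p lam u t * sin t ^ (2 * k))
      (k * (cos t / sin t) * sin t ^ (2 * k) *
        (2 * relativeEnergy p lam u t - deriv u t ^ 2)) t := by
  have hs : sin t ≠ 0 := (sin_pos_of_mem_Ioo ht).ne'
  refine ((hu.hasDerivAt_relativeEnergy hp hpos ht).mul
    ((Real.hasDerivAt_sin t).pow (2 * k))).congr_deriv ?_
  subst hk
  rcases k with _ | k
  · simp
  · have hexp : 2 * (k + 1) - 1 = 2 * k + 1 := by omega
    simp only [hexp, Pi.pow_apply]
    push_cast
    field_simp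
    ring

theorem IsYamabeSolution.relativeEnergy_eq_zero (hm : 1 ≤ m) (hp : 2 < p) (hlam : 0 < lam)
    (hu : IsYamabeSolution m p lam u) (hpos : ∀ t ∈ Icc (0 : ℝ) π, 0 < u t) {t₀ : ℝ}
    (ht₀ : t₀ ∈ Ioo (0 : ℝ) π) (h₀ : relativeEnergy p lam u t₀ = 0) {t : ℝ}
    (ht : t ∈ Ioo (0 : ℝ) π) : relativeEnergy p lam u t = 0 := by
  obtain ⟨k, hk⟩ := Nat.exists_eq_add_of_le' hm
  have hk' : (m : ℝ) - 1 = k := by rw [hk]; push_cast; ring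
  have hF := fun {s : ℝ} (hs : s ∈ Ioo (0 : ℝ) π) => hu.hasDerivAt_relativeEnergy hp hpos hs
  have hW := fun {s : ℝ} (hs : s ∈ Ioo (0 : ℝ) π) =>
    hu.hasDerivAt_relativeEnergy_mul_sin_pow hk hp hpos hs
  have hle : ∀ s ∈ Ioo (0 : ℝ) π, deriv u s ^ 2 ≤ 2 * relativeEnergy p lam u s := fun s hs =>
    sq_deriv_le_two_mul_relativeEnergy hp hlam (hpos s (Ioo_subset_Icc_self hs))
  have hnonneg : ∀ s ∈ Ioo (0 : ℝ) π, 0 ≤ relativeEnergy p lam u s := fun s hs => by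
    linarith [hle s hs, sq_nonneg (deriv u s)]
  have hpi := Real.pi_pos
  have hleft : Ioc 0 (π / 2) ⊆ Ioo 0 π := fun s hs => ⟨hs.1, by linarith [hs.2]⟩
  have hright : Ico (π / 2) π ⊆ Ioo 0 π := fun s hs => ⟨by linarith [hs.1], hs.2⟩
  have hcotl : ∀ s ∈ Ioc 0 (π / 2), 0 ≤ cos s / sin s := fun s hs =>
    div_nonneg (cos_nonneg_of_neg_pi_div_two_le_of_le (by linarith [hs.1]) hs.2)
      (sin_pos_of_mem_Ioo (hleft hs)).le
  have hcotr : ∀ s ∈ Ico (π / 2) π, cos s / sin s ≤ 0 := fun s hs =>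
    div_nonpos_of_nonpos_of_nonneg
      (cos_nonpos_of_pi_div_two_le_of_le hs.1 (by linarith [hs.2]))
      (sin_pos_of_mem_Ioo (hright hs)).le
  have hsin : ∀ s ∈ Ioo (0 : ℝ) π, 0 < sin s ^ (2 * k) := fun s hs =>
    pow_pos (sin_pos_of_mem_Ioo hs) _
  have hmid : π / 2 ∈ Ioo 0 π := ⟨by linarith, by linarith⟩
  have hFl : AntitoneOn (relativeEnergy p lam u) (Ioc 0 (π / 2)) := by
    refine antitoneOn_of_hasDerivWithinAt_nonpos (convex_Ioc _ _)
      (fun s hs => (hF (hleft hs)).continuousAt.continuousWithinAt)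
      (fun s hs => (hF (hleft (interior_subset hs))).hasDerivWithinAt) fun s hs => ?_
    rw [hk', neg_nonpos]
    have := hcotl s (interior_subset hs)
    positivity
  have hFr : MonotoneOn (relativeEnergy p lam u) (Ico (π / 2) π) := by
    refine monotoneOn_of_hasDerivWithinAt_nonneg (convex_Ico _ _)
      (fun s hs => (hF (hright hs)).continuousAt.continuousWithinAt)
      (fun s hs => (hF (hright (interior_subset hs))).hasDerivWithinAt) fun s hs => ?_
    rw [hk', neg_nonneg]
    exact mul_nonpos_of_nonpos_of_nonneg (mul_nonpos_of_nonneg_of_nonpos k.cast_nonneg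
      (hcotr s (interior_subset hs))) (sq_nonneg _)
  have hWl : MonotoneOn (fun t => relativeEnergy p lam u t * sin t ^ (2 * k))
      (Ioc 0 (π / 2)) := by
    refine monotoneOn_of_hasDerivWithinAt_nonneg (convex_Ioc _ _)
      (fun s hs => (hW (hleft hs)).continuousAt.continuousWithinAt)
      (fun s hs => (hW (hleft (interior_subset hs))).hasDerivWithinAt) fun s hs => ?_
    have hs' := hleft (interior_subset hs)
    exact mul_nonneg (mul_nonneg (mul_nonneg k.cast_nonneg (hcotl s (interior_subset hs)))
      (hsin s hs').le) (sub_nonneg.2 (hle s hs'))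
  have hWr : AntitoneOn (fun t => relativeEnergy p lam u t * sin t ^ (2 * k))
      (Ico (π / 2) π) := by
    refine antitoneOn_of_hasDerivWithinAt_nonpos (convex_Ico _ _)
      (fun s hs => (hW (hright hs)).continuousAt.continuousWithinAt)
      (fun s hs => (hW (hright (interior_subset hs))).hasDerivWithinAt) fun s hs => ?_
    have hs' := hright (interior_subset hs)
    exact mul_nonpos_of_nonpos_of_nonneg (mul_nonpos_of_nonpos_of_nonneg
      (mul_nonpos_of_nonneg_of_nonpos k.cast_nonneg (hcotr s (interior_subset hs)))
      (hsin s hs').le) (sub_nonneg.2 (hle s hs'))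
  have hmidl : π / 2 ∈ Ioc 0 (π / 2) := ⟨by linarith, le_rfl⟩
  have hmidr : π / 2 ∈ Ico (π / 2) π := ⟨le_rfl, by linarith⟩
  have hzero : relativeEnergy p lam u (π / 2) = 0 := by
    refine le_antisymm ?_ (hnonneg _ hmid)
    rw [← h₀]
    rcases le_total t₀ (π / 2) with h | h
    · exact hFl ⟨ht₀.1, h⟩ hmidl h
    · exact hFr hmidr ⟨h, ht₀.2⟩ h
  refine le_antisymm (nonpos_of_mul_nonpos_left ?_ (hsin t ht)) (hnonneg t ht)
  rcases le_total t (π / 2) with h | h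
  · simpa [hzero] using hWl ⟨ht.1, h⟩ hmidl h
  · simpa [hzero] using hWr hmidr ⟨h, ht.2⟩ h

/-- A positive solution with vanishing derivative and value `1` at an interior point is
identically `1`. -/
theorem IsYamabeSolution.eq_one (hm : 1 ≤ m) (hp : 2 < p) (hlam : 0 < lam)
    (hu : IsYamabeSolution m p lam u) (hpos : ∀ t ∈ Icc (0 : ℝ) π, 0 < u t) {t₀ : ℝ}
    (ht₀ : t₀ ∈ Ioo (0 : ℝ) π) (hval : u t₀ = 1) (hder : deriv u t₀ = 0) {t : ℝ}
    (ht : t ∈ Icc (0 : ℝ) π) : u t = 1 := by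
  have h₀ : relativeEnergy p lam u t₀ = 0 := by simp [relativeEnergy, hval, hder]
  have hzero : ∀ s ∈ interior (Icc (0 : ℝ) π), deriv u s = 0 := fun s hs => by
    rw [interior_Icc] at hs
    have hle := sq_deriv_le_two_mul_relativeEnergy hp hlam (hpos s (Ioo_subset_Icc_self hs))
    rw [hu.relativeEnergy_eq_zero hm hp hlam hpos ht₀ h₀ hs, mul_zero] at hle
    exact pow_eq_zero_iff two_ne_zero |>.1 (le_antisymm hle (sq_nonneg _))
  have hdiff : DifferentiableOn ℝ u (interior (Icc 0 π)) := fun s hs =>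
    (hu.2.1 s (interior_subset hs)).differentiableWithinAt
  have hmono := monotoneOn_of_deriv_nonneg (convex_Icc _ _) hu.1 hdiff
    fun s hs => (hzero s hs).ge
  have hanti := antitoneOn_of_deriv_nonpos (convex_Icc _ _) hu.1 hdiff
    fun s hs => (hzero s hs).le
  have ht₀' := Ioo_subset_Icc_self ht₀
  rw [← hval]
  rcases le_total t t₀ with h | h
  · exact le_antisymm (hmono ht ht₀' h) (hanti ht ht₀' h)
  · exact le_antisymm (hanti ht₀' ht h) (hmono ht₀' ht h)

end

/-- At a local minimum `t₀ ∈ (0, π)` of a positive, non-constant solution of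
the Yamabe ODE one has `u(t₀) < 1`, and the energy is negative there. -/
theorem local_min_lt_one_and_energy_neg (m : ℕ) (hm : 2 ≤ m) (p lam : ℝ)
    (hp : 2 < p) (hlam : 0 < lam) (u : ℝ → ℝ)
    (hu : IsYamabeSolution m p lam u)
    (hpos : ∀ t ∈ Icc (0 : ℝ) π, 0 < u t)
    (hne : ¬ ∀ t ∈ Icc (0 : ℝ) π, u t = 1)
    (t₀ : ℝ) (ht₀ : t₀ ∈ Ioo (0 : ℝ) π) (hmin : IsLocalMin u t₀) :
    u t₀ < 1 ∧
      (deriv u t₀) ^ 2 / 2 + lam * (u t₀ ^ p / p - (u t₀) ^ 2 / 2) < 0 := by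
  have hder := hmin.deriv_eq_zero
  have ht := Ioo_subset_Icc_self ht₀
  have hpos₀ := hpos t₀ ht
  have hsecond := hmin.deriv_deriv_nonneg (hu.2.1 t₀ ht).continuousAt
  have hode := hu.2.2.2 t₀ ht₀
  rw [hder, mul_zero, add_zero] at hode
  have hle : u t₀ ≤ 1 := by
    by_contra! hgt
    have hpow := Real.rpow_lt_rpow_of_exponent_lt hgt (show 1 < p - 1 by linarith)
    rw [Real.rpow_one] at hpow
    linarith [mul_pos hlam (sub_pos.2 hpow)]
  have hlt : u t₀ < 1 := hle.lt_of_ne fun h =>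
    hne fun t => hu.eq_one (by omega) hp hlam hpos ht₀ h hder
  refine ⟨hlt, ?_⟩
  rw [hder]
  have := mul_neg_of_pos_of_neg hlam (potential_neg hp hpos₀ hlt)
  linarith
end

section
/- Let α > 1 and let u be a solution of the Yamabe ODE with u(0) = α, u'(0) = 0, u(t) > 0 for all t ∈ [0,π/2), and u(π/2) = 0. Then u'(t) ≠ 0 for every t ∈ (0,π/2). -/
open Real Set

/-- At a critical point where the second derivative is negative, a function does not attain its
minimum over an interval ending there. -/
lemma exists_lt_of_deriv_deriv_neg {u : ℝ → ℝ} {a x : ℝ} (hax : a < x)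
    (hd : ∀ t ∈ Ioc a x, DifferentiableAt ℝ u t)
    (hx : deriv u x = 0) (hneg : deriv (deriv u) x < 0) :
    ∃ y ∈ Ioo a x, u y < u x := by
  have hev : ∀ᶠ y in nhdsWithin x (Iio x), 0 < deriv u y := by
    have hslope := (hasDerivAt_iff_tendsto_slope.1
      (differentiableAt_of_deriv_ne_zero hneg.ne).hasDerivAt).mono_left
        (nhdsLT_le_nhdsNE x)
    filter_upwards [hslope.eventually_lt_const hneg, self_mem_nhdsWithin] with y hy hyx
    rw [slope_def_field, hx, sub_zero] at hy
    by_contra hle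
    exact absurd hy (not_lt.2 (div_nonneg_of_nonpos (not_lt.1 hle) (sub_neg.2 hyx).le))
  obtain ⟨l, hl, hlx⟩ := (mem_nhdsLT_iff_exists_mem_Ico_Ioo_subset hax).1 hev
  obtain ⟨y, hly, hyx⟩ := exists_between hl.2
  have hay : a < y := hl.1.trans_lt hly
  refine ⟨y, ⟨hay, hyx⟩, ?_⟩
  refine strictMonoOn_of_deriv_pos (convex_Icc y x) (fun t ht => ?_) (fun t ht => ?_)
    (left_mem_Icc.2 hyx.le) (right_mem_Icc.2 hyx.le) hyx
  · exact (hd t ⟨hay.trans_le ht.1, ht.2⟩).continuousAt.continuousWithinAt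
  · rw [interior_Icc] at ht
    exact hlx ⟨hly.trans ht.1, ht.2⟩

/-- The energy `u' ^ 2 / 2 + λ (u ^ p / p - u ^ 2 / 2)` of a solution that is positive on
`(0, π / 2)` is nonincreasing there. -/
lemma IsYamabeSolution.antitoneOn_energy {m : ℕ} (hm : 1 ≤ m) {p lam : ℝ} (hp : 0 < p)
    {u : ℝ → ℝ} (hu : IsYamabeSolution m p lam u) (hpos : ∀ t ∈ Ioo (0 : ℝ) (π / 2), 0 < u t)
    {s : ℝ} (hs : 0 < s) :
    AntitoneOn (fun t => deriv u t ^ 2 / 2 + lam * (u t ^ p / p - u t ^ 2 / 2))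
      (Icc s (π / 2)) := by
  obtain ⟨-, hd, hdd, hode⟩ := hu
  have hpi := pi_pos
  have hderiv : ∀ t ∈ Ioo s (π / 2),
      HasDerivAt (fun t => deriv u t ^ 2 / 2 + lam * (u t ^ p / p - u t ^ 2 / 2))
        (-(((m : ℝ) - 1) * (cos t / sin t)) * deriv u t ^ 2) t := by
    intro t ht
    have ht0 : 0 < t := hs.trans ht.1
    have ht' : t ∈ Ioo 0 π := ⟨ht0, by linarith [ht.2]⟩
    have h1 := (hd t (Ioo_subset_Icc_self ht')).hasDerivAt
    have h2 := (hdd t ht').hasDerivAt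
    have h3 := h1.rpow_const (p := p) (Or.inl (hpos t ⟨ht0, ht.2⟩).ne')
    refine (((h2.pow 2).div_const 2).add
      (((h3.div_const p).sub ((h1.pow 2).div_const 2)).const_mul lam)).congr_deriv ?_
    have h := hode t ht'
    field_simp
    simp only [Nat.cast_ofNat, Nat.add_one_sub_one, pow_one]
    have : deriv (deriv u) t = -(((m : ℝ) - 1) * (cos t / sin t) * deriv u t)
        - lam * (u t ^ (p - 1) - u t) := by linarith
    rw [this]
    ring
  refine antitoneOn_of_deriv_nonpos (convex_Icc _ _) (fun t ht => ?_) (fun t ht => ?_)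
    (fun t ht => ?_)
  · have ht' : t ∈ Ioo 0 π := ⟨hs.trans_le ht.1, by linarith [ht.2]⟩
    have h1 := (hd t (Ioo_subset_Icc_self ht')).continuousAt
    have h2 := (hdd t ht').continuousAt
    have h3 := h1.rpow_const (p := p) (Or.inr hp.le)
    exact (((h2.pow 2).div_const 2).add
      (((h3.div_const p).sub ((h1.pow 2).div_const 2)).const_mul lam)).continuousWithinAt
  · rw [interior_Icc] at ht
    exact (hderiv t ht).differentiableAt.differentiableWithinAt
  · rw [interior_Icc] at ht
    rw [(hderiv t ht).deriv]
    have hm' : (0 : ℝ) ≤ (m : ℝ) - 1 := sub_nonneg.2 (by exact_mod_cast hm)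
    have hc : 0 ≤ cos t := cos_nonneg_of_mem_Icc ⟨by linarith [hs.trans ht.1], ht.2.le⟩
    have hsn : 0 ≤ sin t := sin_nonneg_of_nonneg_of_le_pi (hs.trans ht.1).le (by linarith [ht.2])
    have : 0 ≤ ((m : ℝ) - 1) * (cos t / sin t) * deriv u t ^ 2 := by positivity
    linarith

/-- If `u` vanishes at `π / 2` and is positive before, its critical values exceed `1`. -/
lemma IsYamabeSolution.one_lt_of_deriv_eq_zero {m : ℕ} (hm : 1 ≤ m) {p lam : ℝ} (hp : 2 < p)
    (hlam : 0 < lam) {u : ℝ → ℝ} (hu : IsYamabeSolution m p lam u)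
    (hpos : ∀ t ∈ Ioo (0 : ℝ) (π / 2), 0 < u t) (hvan : u (π / 2) = 0)
    {t : ℝ} (ht : t ∈ Ioo 0 (π / 2)) (hcrit : deriv u t = 0) : 1 < u t := by
  have h := hu.antitoneOn_energy hm (by linarith) hpos ht.1 (left_mem_Icc.2 ht.2.le)
    (right_mem_Icc.2 ht.2.le) ht.2.le
  simp only [hvan, hcrit, zero_rpow (by linarith : p ≠ 0)] at h
  have hut := hpos t ht
  by_contra hle
  have hpow : u t ^ p ≤ u t ^ 2 := by
    rw [← rpow_two]
    exact rpow_le_rpow_of_exponent_ge hut (not_lt.1 hle) hp.le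
  have hlt : u t ^ p / p - u t ^ 2 / 2 < 0 := by
    have h1 : u t ^ p / p ≤ u t ^ 2 / p := by gcongr
    have h2 : u t ^ 2 / p < u t ^ 2 / 2 := by gcongr
    linarith
  have := mul_neg_of_pos_of_neg hlam hlt
  have := sq_nonneg (deriv u (π / 2))
  norm_num at h
  linarith

/-- `sin ^ (m - 1) * u'` is strictly decreasing as long as `u > 1`. -/
lemma IsYamabeSolution.strictAntiOn_sin_pow_mul_deriv {m : ℕ} (hm : 1 ≤ m) {p lam : ℝ}
    (hp : 2 < p) (hlam : 0 < lam) {u : ℝ → ℝ} (hu : IsYamabeSolution m p lam u) {b : ℝ}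
    (hb : b < π) (hgt : ∀ t ∈ Ioo 0 b, 1 < u t) :
    StrictAntiOn (fun t => sin t ^ (m - 1) * deriv u t) (Ioc 0 b) := by
  obtain ⟨-, -, hdd, hode⟩ := hu
  refine strictAntiOn_of_deriv_neg (convex_Ioc _ _) (fun t ht => ?_) (fun t ht => ?_)
  · exact ((continuous_sin.pow _).continuousAt.mul
      (hdd t ⟨ht.1, ht.2.trans_lt hb⟩).continuousAt).continuousWithinAt
  · rw [interior_Ioc] at ht
    have ht' : t ∈ Ioo 0 π := ⟨ht.1, ht.2.trans hb⟩
    have hs : 0 < sin t := sin_pos_of_mem_Ioo ht'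
    have hu1 := hgt t ht
    have hd : HasDerivAt (fun t => sin t ^ (m - 1) * deriv u t)
        (-(sin t ^ (m - 1) * (lam * (u t ^ (p - 1) - u t)))) t := by
      refine (((hasDerivAt_sin t).pow (m - 1)).mul (hdd t ht').hasDerivAt).congr_deriv ?_
      have h : deriv (deriv u) t = -(((m : ℝ) - 1) * (cos t / sin t) * deriv u t)
        - lam * (u t ^ (p - 1) - u t) := by linarith [hode t ht']
      rw [h]
      obtain ⟨k, rfl⟩ := Nat.exists_eq_add_of_le' hm
      rcases k with _ | k
      · simp
      · simp only [Nat.add_sub_cancel]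
        push_cast
        field_simp
        simp only [Pi.pow_apply]
        ring
    rw [hd.deriv]
    have h1 : u t < u t ^ (p - 1) := by
      simpa using rpow_lt_rpow_of_exponent_lt hu1 (by linarith : (1 : ℝ) < p - 1)
    have := mul_pos (pow_pos hs (m - 1)) (mul_pos hlam (sub_pos.2 h1))
    linarith

/-- If `u` is a solution of the Yamabe ODE with `u(0) = α > 1`, `u'(0) = 0`,
positive on `[0, π/2)` and vanishing at `π/2`, then `u` has no critical point
in `(0, π/2)`. -/
theorem no_critical_point_of_vanishing (m : ℕ) (hm : 2 ≤ m) (p lam : ℝ)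
    (hp : 2 < p) (hlam : 0 < lam) (α : ℝ) (hα : 1 < α) (u : ℝ → ℝ)
    (hu : IsYamabeSolution m p lam u)
    (hu0 : u 0 = α) (hu0' : deriv u 0 = 0)
    (hpos : ∀ t ∈ Ico (0 : ℝ) (π / 2), 0 < u t)
    (hvan : u (π / 2) = 0) :
    ∀ t ∈ Ioo (0 : ℝ) (π / 2), deriv u t ≠ 0 := by
  intro T hT hcrit
  have hpi := pi_pos
  have hm1 : 1 ≤ m := by omega
  have hd := hu.2.1
  have hode := hu.2.2.2
  obtain ⟨x, hx, hmin⟩ := isCompact_Icc.exists_isMinOn (nonempty_Icc.2 hT.1.le)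
    (hu.1.mono (Icc_subset_Icc_right (by linarith [hT.2]) : Icc 0 T ⊆ Icc 0 π))
  rcases hx.1.eq_or_lt with rfl | hx0
  · have hanti := hu.strictAntiOn_sin_pow_mul_deriv hm1 hp hlam (b := T) (by linarith [hT.2])
      (fun t ht => hα.trans_le (hu0 ▸ hmin (Ioo_subset_Icc_self ht)))
    set g : ℝ → ℝ := fun t => sin t ^ (m - 1) * deriv u t
    have hT2 : T / 2 ∈ Ioc 0 T := ⟨by linarith [hT.1], by linarith [hT.1]⟩
    have hc : 0 < g (T / 2) := by
      have h := hanti hT2 (right_mem_Ioc.2 hT.1) (by linarith [hT.1])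
      simpa [g, hcrit] using h
    have hge : ∀ t ∈ Ioo 0 (T / 2), g (T / 2) ≤ deriv u t := by
      intro t ht
      have h : g (T / 2) < sin t ^ (m - 1) * deriv u t :=
        hanti ⟨ht.1, ht.2.le.trans hT2.2⟩ hT2 ht.2
      have hs : 0 < sin t := sin_pos_of_pos_of_lt_pi ht.1 (by linarith [ht.2, hT.2])
      have hpow : sin t ^ (m - 1) ≤ 1 := pow_le_one₀ hs.le (sin_le_one t)
      have hdpos : 0 < deriv u t := pos_of_mul_pos_right (hc.trans h) (pow_pos hs _).le
      nlinarith
    have hslope := ((hasDerivAt_iff_tendsto_slope.1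
      (hd 0 ⟨le_rfl, hpi.le⟩).hasDerivAt).mono_left
        (nhdsGT_le_nhdsNE 0))
    have hle : g (T / 2) ≤ deriv u 0 := by
      refine ge_of_tendsto hslope ?_
      filter_upwards [Ioo_mem_nhdsGT hT2.1] with t ht
      have hsub : Icc 0 t ⊆ Icc 0 π := Icc_subset_Icc_right (by linarith [ht.2, hT.2])
      obtain ⟨c, hc, hceq⟩ := exists_deriv_eq_slope u ht.1 (hu.1.mono hsub)
        (fun y hy => (hd y (hsub (Ioo_subset_Icc_self hy))).differentiableWithinAt)
      rw [slope_def_field, ← hceq]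
      exact hge c ⟨hc.1, hc.2.trans ht.2⟩
    linarith
  · have hxI : x ∈ Ioo 0 (π / 2) := ⟨hx0, hx.2.trans_lt hT.2⟩
    have hxcrit : deriv u x = 0 := by
      rcases hx.2.eq_or_lt with rfl | hxT
      · exact hcrit
      · exact (hmin.isLocalMin (Icc_mem_nhds hx0 hxT)).deriv_eq_zero
    have hx1 := hu.one_lt_of_deriv_eq_zero hm1 hp hlam
      (fun t ht => hpos t (Ioo_subset_Ico_self ht)) hvan hxI hxcrit
    have hneg : deriv (deriv u) x < 0 := by
      have h := hode x ⟨hx0, by linarith [hxI.2]⟩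
      have h1 : u x < u x ^ (p - 1) := by
        simpa using rpow_lt_rpow_of_exponent_lt hx1 (by linarith : (1 : ℝ) < p - 1)
      have := mul_pos hlam (sub_pos.2 h1)
      rw [hxcrit, mul_zero] at h
      linarith
    obtain ⟨y, hy, hyx⟩ := exists_lt_of_deriv_deriv_neg hx0
      (fun t ht => hd t ⟨ht.1.le, by linarith [ht.2, hxI.2]⟩) hxcrit hneg
    exact (hmin ⟨hy.1.le, hy.2.le.trans hx.2⟩).not_gt hyx
end

section
/- Let u be a solution of the Yamabe ODE with u(t) > 0 for all t ∈ [0,π], u'(0) = 0, and u'(π/2) = 0. Then u(π−t) = u(t) for all t ∈ [0,π]; in particular u'(π) = 0. -/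
open Real Set

/-- The Yamabe ODE written as a first-order system for `(u, u')`. -/
noncomputable def yamabeField (m : ℕ) (p lam t : ℝ) (z : ℝ × ℝ) : ℝ × ℝ :=
  (z.2, -(((m : ℝ) - 1) * (Real.cos t / Real.sin t) * z.2) - lam * (z.1 ^ (p - 1) - z.1))

/-- For `q ≥ 1` the power `x ^ q` is Lipschitz on `[0, M]`. -/
lemma abs_rpow_sub_rpow_le {q M x y : ℝ} (hq : 1 ≤ q) (hx : x ∈ Icc 0 M) (hy : y ∈ Icc 0 M) :
    |x ^ q - y ^ q| ≤ q * M ^ (q - 1) * |x - y| := by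
  have := (convex_Icc (0 : ℝ) M).norm_image_sub_le_of_norm_hasDerivWithin_le
    (f := fun x : ℝ => x ^ q) (f' := fun x => q * x ^ (q - 1)) (C := q * M ^ (q - 1))
    (fun z _ => (Real.hasDerivAt_rpow_const (Or.inr hq)).hasDerivWithinAt)
    (fun z hz => by
      have h0 : 0 ≤ q * z ^ (q - 1) := mul_nonneg (by linarith) (Real.rpow_nonneg hz.1 _)
      rw [Real.norm_eq_abs, abs_of_nonneg h0]
      exact mul_le_mul_of_nonneg_left (Real.rpow_le_rpow hz.1 hz.2 (by linarith)) (by linarith))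
    hy hx
  simpa [Real.norm_eq_abs] using this

/-- On compact subintervals of `(0, π)` the Yamabe vector field is uniformly Lipschitz on
`[0, M] × ℝ`. -/
lemma exists_lipschitzOnWith_yamabeField (m : ℕ) {p lam : ℝ} (hp : 2 < p) {a b : ℝ}
    (ha : 0 < a) (hb : b < π) (M : ℝ) :
    ∃ K : NNReal, ∀ t ∈ Ioo a b,
      LipschitzOnWith K (yamabeField m p lam t) (Icc 0 M ×ˢ univ) := by
  have hcont : ContinuousOn (fun t => ((m : ℝ) - 1) * (Real.cos t / Real.sin t)) (Icc a b) := by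
    refine continuousOn_const.mul (Real.continuousOn_cos.div Real.continuousOn_sin ?_)
    intro t ht
    exact (Real.sin_pos_of_pos_of_lt_pi (ha.trans_le ht.1) (ht.2.trans_lt hb)).ne'
  obtain ⟨C, hC⟩ := isCompact_Icc.exists_bound_of_continuousOn hcont
  set L := (p - 1) * M ^ (p - 1 - 1) with hL
  refine ⟨Real.toNNReal (1 + |C| + |lam| * (|L| + 1)), fun t ht => ?_⟩
  refine LipschitzOnWith.of_dist_le_mul fun x hx y hy => ?_
  rw [Real.coe_toNNReal _ (by positivity)]
  have hCt := (hC t (Ioo_subset_Icc_self ht)).trans (le_abs_self C)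
  rw [Real.norm_eq_abs] at hCt
  have hrpow := (abs_rpow_sub_rpow_le (by linarith : 1 ≤ p - 1) hx.1 hy.1).trans
    (mul_le_mul_of_nonneg_right (le_abs_self L) (abs_nonneg _))
  have h1 : |x.1 - y.1| ≤ dist x y := by
    rw [Prod.dist_eq, Real.dist_eq]; exact le_max_left _ _
  have h2 : |x.2 - y.2| ≤ dist x y := by
    rw [Prod.dist_eq, Real.dist_eq x.2]; exact le_max_right _ _
  have hd : 0 ≤ dist x y := dist_nonneg
  rw [Prod.dist_eq (x := yamabeField m p lam t x)]
  refine max_le ?_ ?_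
  · rw [Real.dist_eq]
    refine h2.trans (le_mul_of_one_le_left hd ?_)
    have : 0 ≤ |C| + |lam| * (|L| + 1) := by positivity
    linarith
  · rw [Real.dist_eq]
    set A := ((m : ℝ) - 1) * (Real.cos t / Real.sin t) with hA
    have hsplit : (yamabeField m p lam t x).2 - (yamabeField m p lam t y).2
        = -(A * (x.2 - y.2)) - lam * ((x.1 ^ (p - 1) - y.1 ^ (p - 1)) - (x.1 - y.1)) := by
      simp only [yamabeField, ← hA]; ring
    rw [hsplit]
    have e1 : |A * (x.2 - y.2)| ≤ |C| * dist x y := by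
      rw [abs_mul]; exact mul_le_mul hCt h2 (abs_nonneg _) (abs_nonneg _)
    have e2 : |lam * ((x.1 ^ (p - 1) - y.1 ^ (p - 1)) - (x.1 - y.1))|
        ≤ |lam| * ((|L| + 1) * dist x y) := by
      rw [abs_mul]
      refine mul_le_mul_of_nonneg_left ?_ (abs_nonneg _)
      have := mul_le_mul_of_nonneg_left h1 (abs_nonneg L)
      have := abs_sub (x.1 ^ (p - 1) - y.1 ^ (p - 1)) (x.1 - y.1)
      linarith
    have := abs_sub (-(A * (x.2 - y.2)))
      (lam * ((x.1 ^ (p - 1) - y.1 ^ (p - 1)) - (x.1 - y.1)))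
    rw [abs_neg] at this
    linarith

lemma pi_sub_mem_Ioo {t : ℝ} (ht : t ∈ Ioo 0 π) : π - t ∈ Ioo 0 π :=
  ⟨by linarith [ht.2], by linarith [ht.1]⟩

lemma IsYamabeSolution.hasDerivAt_prodMk {m : ℕ} {p lam : ℝ} {u : ℝ → ℝ}
    (hu : IsYamabeSolution m p lam u) {t : ℝ} (ht : t ∈ Ioo 0 π) :
    HasDerivAt (fun s => (u s, deriv u s)) (yamabeField m p lam t (u t, deriv u t)) t := by
  obtain ⟨-, hd, hdd, hode⟩ := hu
  refine (hd t (Ioo_subset_Icc_self ht)).hasDerivAt.prodMk ?_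
  convert (hdd t ht).hasDerivAt using 1
  linarith [hode t ht]

/-- The Yamabe system is invariant under the reflection `t ↦ π - t`. -/
lemma IsYamabeSolution.hasDerivAt_prodMk_pi_sub {m : ℕ} {p lam : ℝ} {u : ℝ → ℝ}
    (hu : IsYamabeSolution m p lam u) {t : ℝ} (ht : t ∈ Ioo 0 π) :
    HasDerivAt (fun s => (u (π - s), -deriv u (π - s)))
      (yamabeField m p lam t (u (π - t), -deriv u (π - t))) t := by
  obtain ⟨-, hd, hdd, hode⟩ := hu
  have ht' := pi_sub_mem_Ioo ht
  have hs : HasDerivAt (fun s : ℝ => π - s) (-1) t := (hasDerivAt_id t).const_sub π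
  have h1 := (hd _ (Ioo_subset_Icc_self ht')).hasDerivAt.comp t hs
  have h2 := ((hdd _ ht').hasDerivAt.comp t hs).neg
  refine HasDerivAt.prodMk ?_ ?_
  · simpa [Function.comp_def] using h1
  · refine h2.congr_deriv ?_
    have := hode _ ht'
    rw [Real.cos_pi_sub, Real.sin_pi_sub, neg_div] at this
    linarith

/-- A positive solution with `u'(π/2) = 0` is symmetric on the open interval `(0, π)`. -/
lemma IsYamabeSolution.eqOn_Ioo_pi_sub {m : ℕ} {p lam : ℝ} {u : ℝ → ℝ} (hp : 2 < p)
    (hu : IsYamabeSolution m p lam u) (hpos : ∀ t ∈ Icc (0 : ℝ) π, 0 < u t)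
    (huhalf : deriv u (π / 2) = 0) :
    EqOn (fun t => u (π - t)) u (Ioo 0 π) := by
  intro t ht
  obtain ⟨M, hM⟩ := isCompact_Icc.exists_bound_of_continuousOn hu.1
  have hmem : ∀ s ∈ Ioo 0 π, u s ∈ Icc 0 M := fun s hs =>
    ⟨(hpos s (Ioo_subset_Icc_self hs)).le,
      (le_abs_self _).trans (hM s (Ioo_subset_Icc_self hs))⟩
  have hpi := Real.pi_pos
  obtain ⟨a, ha0, ha⟩ := exists_between (lt_min ht.1 (half_pos hpi))
  obtain ⟨b, hb, hbπ⟩ := exists_between (max_lt ht.2 (half_lt_self hpi))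
  rw [lt_min_iff] at ha
  rw [max_lt_iff] at hb
  have hsub : ∀ s ∈ Ioo a b, s ∈ Ioo 0 π := fun s hs => ⟨ha0.trans hs.1, hs.2.trans hbπ⟩
  obtain ⟨K, hK⟩ := exists_lipschitzOnWith_yamabeField m (lam := lam) hp ha0 hbπ M
  have hhalf : π - π / 2 = π / 2 := by ring
  have heq := ODE_solution_unique_of_mem_Ioo (t₀ := π / 2) hK ⟨ha.2, hb.2⟩
    (f := fun s => (u (π - s), -deriv u (π - s))) (g := fun s => (u s, deriv u s))
    (fun s hs => ⟨hu.hasDerivAt_prodMk_pi_sub (hsub s hs),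
      hmem _ (pi_sub_mem_Ioo (hsub s hs)), mem_univ _⟩)
    (fun s hs => ⟨hu.hasDerivAt_prodMk (hsub s hs), hmem _ (hsub s hs), mem_univ _⟩)
    (by simp [hhalf, huhalf])
  exact congrArg Prod.fst (heq ⟨ha.1, hb.1⟩)

/-- A positive solution of the Yamabe ODE with `u'(0) = 0` and `u'(π/2) = 0`
is symmetric about `t = π/2`; in particular `u'(π) = 0`. -/
theorem solution_symmetric_of_deriv_half_pi (m : ℕ) (hm : 2 ≤ m) (p lam : ℝ)
    (hp : 2 < p) (hlam : 0 < lam) (u : ℝ → ℝ)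
    (hu : IsYamabeSolution m p lam u)
    (hpos : ∀ t ∈ Icc (0 : ℝ) π, 0 < u t)
    (hu0' : deriv u 0 = 0) (huhalf : deriv u (π / 2) = 0) :
    (∀ t ∈ Icc (0 : ℝ) π, u (π - t) = u t) ∧ deriv u π = 0 := by
  have hpi := Real.pi_pos
  have hmaps : MapsTo (fun t => π - t) (Icc 0 π) (Icc 0 π) := fun t ht =>
    ⟨by linarith [ht.2], by linarith [ht.1]⟩
  have hrefl : ContinuousOn (fun t => u (π - t)) (Icc 0 π) :=
    hu.1.comp (by fun_prop) hmaps
  have hsymm : EqOn (fun t => u (π - t)) u (Icc 0 π) :=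
    (hu.eqOn_Ioo_pi_sub hp hpos huhalf).of_subset_closure hrefl hu.1 Ioo_subset_Icc_self
      (closure_Ioo hpi.ne).ge
  refine ⟨hsymm, ?_⟩
  have hmem : π ∈ Icc 0 π := right_mem_Icc.2 hpi.le
  have h0 : HasDerivAt u 0 (π - π) := by
    rw [sub_self]
    simpa only [hu0'] using (hu.2.1 0 (left_mem_Icc.2 hpi.le)).hasDerivAt
  have hcomp : HasDerivAt (fun t => u (π - t)) 0 π := by
    simpa [Function.comp_def] using h0.comp π ((hasDerivAt_id π).const_sub π)
  have hwithin : HasDerivWithinAt u 0 (Icc 0 π) π :=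
    hcomp.hasDerivWithinAt.congr (fun t ht => (hsymm ht).symm) (hsymm hmem).symm
  exact (uniqueDiffOn_Icc hpi π hmem).eq_deriv _
    (hu.2.1 π hmem).hasDerivAt.hasDerivWithinAt hwithin
end

section
/- There exists ε ∈ (0,1) such that for every α ∈ (0,ε), every solution u of the Yamabe ODE with u(0) = α, u'(0) = 0 and u(t) > 0 for all t ∈ [0,π/2] satisfies u(t) < 1 for all t ∈ [0,π/2] and u'(t) > 0 for all t ∈ (0,π/2); in particular u has no local extrema in (0,π/2). -/
open Real Set

open Filter Topology in
/-- By the mean value theorem, the derivative of a function differentiable on `[0, b]` takes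
values converging to its value at `0` along suitable points decreasing to `0`. -/
lemma exists_tendsto_deriv_right_zero {u : ℝ → ℝ} {b : ℝ} (hb : 0 < b)
    (hd : ∀ t ∈ Icc (0 : ℝ) b, DifferentiableAt ℝ u t) :
    ∃ s : ℝ → ℝ, Tendsto s (𝓝[>] 0) (𝓝[>] 0) ∧
      Tendsto (fun x => deriv u (s x)) (𝓝[>] 0) (𝓝 (deriv u 0)) := by
  have key : ∀ x : ℝ, ∃ s, x ∈ Ioo 0 b → s ∈ Ioo 0 x ∧ deriv u s = slope u 0 x := by
    intro x
    by_cases hx : x ∈ Ioo 0 b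
    · obtain ⟨s, hs, hs'⟩ := exists_deriv_eq_slope u hx.1
        (fun t ht => (hd t ⟨ht.1, ht.2.trans hx.2.le⟩).continuousAt.continuousWithinAt)
        (fun t ht => (hd t ⟨ht.1.le, ht.2.le.trans hx.2.le⟩).differentiableWithinAt)
      exact ⟨s, fun _ => ⟨hs, by rw [hs', slope_def_field]⟩⟩
    · exact ⟨0, fun h => absurd h hx⟩
  choose s hs using key
  have hev : ∀ᶠ x in 𝓝[>] (0 : ℝ), x ∈ Ioo 0 b := Ioo_mem_nhdsGT hb
  refine ⟨s, tendsto_nhdsWithin_iff.2 ⟨?_, ?_⟩, ?_⟩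
  · refine tendsto_of_tendsto_of_tendsto_of_le_of_le' tendsto_const_nhds
      (tendsto_id.mono_left nhdsWithin_le_nhds) ?_ ?_
    · filter_upwards [hev] with x hx using (hs x hx).1.1.le
    · filter_upwards [hev] with x hx using (hs x hx).1.2.le
  · filter_upwards [hev] with x hx using (hs x hx).1.1
  · have h := (hd 0 ⟨le_rfl, hb.le⟩).hasDerivAt.tendsto_slope.mono_left
      (nhdsWithin_mono (0 : ℝ) (fun x (hx : 0 < x) => hx.ne'))
    refine h.congr' ?_
    filter_upwards [hev] with x hx using (hs x hx).2.symm

open Filter Topology in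
/-- The energy of a positive solution with vanishing initial slope does not exceed its
initial value on `(0, π/2)`. -/
lemma IsYamabeSolution.energy_le {m : ℕ} (hm : 2 ≤ m) {p lam : ℝ} (hp : 2 < p) {u : ℝ → ℝ}
    (hu : IsYamabeSolution m p lam u) (hu0 : deriv u 0 = 0)
    (hpos : ∀ t ∈ Icc (0 : ℝ) (π / 2), 0 < u t) {t : ℝ} (ht : t ∈ Ioo 0 (π / 2)) :
    deriv u t ^ 2 / 2 + lam * (u t ^ p / p - u t ^ 2 / 2) ≤
      lam * (u 0 ^ p / p - u 0 ^ 2 / 2) := by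
  obtain ⟨-, hd, hdd, hode⟩ := hu
  have hpi := Real.pi_pos
  have hm' : (2 : ℝ) ≤ m := by exact_mod_cast hm
  set E : ℝ → ℝ := fun t => deriv u t ^ 2 / 2 + lam * (u t ^ p / p - u t ^ 2 / 2) with hE
  have hEd : ∀ x ∈ Ioo 0 (π / 2),
      HasDerivAt E (-(((m : ℝ) - 1) * (Real.cos x / Real.sin x) * deriv u x ^ 2)) x := by
    intro x hx
    have hxI : x ∈ Ioo 0 π := ⟨hx.1, by linarith [hx.2]⟩
    have h1 := (hd x ⟨hxI.1.le, hxI.2.le⟩).hasDerivAt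
    have h2 := (hdd x hxI).hasDerivAt
    have hup := hpos x ⟨hx.1.le, hx.2.le⟩
    have h3 := ((h2.pow 2).div_const 2).add
      ((((h1.rpow_const (p := p) (Or.inl hup.ne')).div_const p).sub
        ((h1.pow 2).div_const 2)).const_mul lam)
    refine h3.congr_deriv ?_
    have hp0 : p ≠ 0 := by linarith
    have h4 : deriv u x * p * u x ^ (p - 1) / p = deriv u x * u x ^ (p - 1) := by
      field_simp
    rw [h4]
    simp only [Nat.cast_ofNat, Nat.add_one_sub_one, pow_one]
    linear_combination deriv u x * hode x hxI
  have hanti : AntitoneOn E (Ioo 0 (π / 2)) := by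
    refine antitoneOn_of_deriv_nonpos (convex_Ioo _ _)
      (fun x hx => (hEd x hx).continuousAt.continuousWithinAt) ?_ ?_
    · rw [interior_Ioo]
      exact fun x hx => (hEd x hx).differentiableAt.differentiableWithinAt
    · rw [interior_Ioo]
      intro x hx
      rw [(hEd x hx).deriv, neg_nonpos]
      have hc : 0 < Real.cos x := Real.cos_pos_of_mem_Ioo ⟨by linarith [hx.1], hx.2⟩
      have hs : 0 < Real.sin x := Real.sin_pos_of_pos_of_lt_pi hx.1 (by linarith [hx.2])
      have : (0 : ℝ) ≤ (m : ℝ) - 1 := by linarith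
      positivity
  obtain ⟨s, hs, hs'⟩ := exists_tendsto_deriv_right_zero hpi hd
  have hu_s : Tendsto (fun x => u (s x)) (𝓝[>] 0) (𝓝 (u 0)) :=
    (hd 0 ⟨le_rfl, hpi.le⟩).continuousAt.tendsto.comp (hs.mono_right nhdsWithin_le_nhds)
  have hup0 := hpos 0 ⟨le_rfl, by positivity⟩
  have hlim : Tendsto (fun x => E (s x)) (𝓝[>] 0)
      (𝓝 (deriv u 0 ^ 2 / 2 + lam * (u 0 ^ p / p - u 0 ^ 2 / 2))) :=
    ((hs'.pow 2).div_const 2).add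
      ((((hu_s.rpow_const (Or.inl hup0.ne')).div_const p).sub
        ((hu_s.pow 2).div_const 2)).const_mul lam)
  have hle := ge_of_tendsto hlim (b := E t) <| by
    filter_upwards [hs.eventually (Ioo_mem_nhdsGT ht.1)] with x hx
    exact hanti ⟨hx.1, hx.2.trans ht.2⟩ ht hx.2.le
  simpa [hu0, hE] using hle

/-- A positive solution with vanishing initial slope and initial value below `1` grows at most
exponentially on `[0, π/2]`. -/
lemma IsYamabeSolution.le_mul_exp {m : ℕ} (hm : 2 ≤ m) {p lam : ℝ} (hp : 2 < p)
    (hlam : 0 < lam) {u : ℝ → ℝ} (hu : IsYamabeSolution m p lam u) (hu1 : u 0 < 1)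
    (hu0 : deriv u 0 = 0) (hpos : ∀ t ∈ Icc (0 : ℝ) (π / 2), 0 < u t)
    {t : ℝ} (ht : t ∈ Icc 0 (π / 2)) :
    u t ≤ u 0 * Real.exp (√lam * t) := by
  have hpi := Real.pi_pos
  have h0 : (0 : ℝ) ∈ Icc 0 (π / 2) := ⟨le_rfl, by positivity⟩
  have hup0 := hpos 0 h0
  have hd : ∀ x ∈ Icc 0 (π / 2), HasDerivAt (fun x => u x * Real.exp (-(√lam * x)))
      ((deriv u x - √lam * u x) * Real.exp (-(√lam * x))) x := by
    intro x hx
    have h1 := (hu.2.1 x ⟨hx.1, by linarith [hx.2]⟩).hasDerivAt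
    have h2 := (((hasDerivAt_id x).const_mul (√lam)).neg).exp
    refine (h1.mul h2).congr_deriv ?_
    simp only [id, Pi.neg_apply]
    ring
  have hanti : AntitoneOn (fun x => u x * Real.exp (-(√lam * x))) (Icc 0 (π / 2)) := by
    refine antitoneOn_of_deriv_nonpos (convex_Icc _ _)
      (fun x hx => (hd x hx).continuousAt.continuousWithinAt) ?_ ?_
    · rw [interior_Icc]
      exact fun x hx =>
        (hd x (Ioo_subset_Icc_self hx)).differentiableAt.differentiableWithinAt
    · rw [interior_Icc]
      intro x hx
      rw [(hd x (Ioo_subset_Icc_self hx)).deriv]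
      refine mul_nonpos_of_nonpos_of_nonneg ?_ (Real.exp_pos _).le
      have hup := hpos x (Ioo_subset_Icc_self hx)
      have hE := hu.energy_le hm hp hu0 hpos hx
      have h1 : u 0 ^ p ≤ u 0 ^ 2 := by
        rw [← Real.rpow_two]
        exact Real.rpow_le_rpow_of_exponent_ge hup0 hu1.le hp.le
      have h2 : u 0 ^ p / p ≤ u 0 ^ 2 / 2 := by gcongr
      have h3 : lam * (u 0 ^ p / p - u 0 ^ 2 / 2) ≤ 0 :=
        mul_nonpos_of_nonneg_of_nonpos hlam.le (by linarith)
      have h4 : 0 ≤ lam * (u x ^ p / p) := by positivity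
      have h5 : deriv u x ≤ √lam * u x := by
        apply le_of_sq_le_sq _ (by positivity)
        rw [mul_pow, Real.sq_sqrt hlam.le]
        linarith
      linarith
  have h := hanti h0 ht ht.1
  simp only [mul_zero, neg_zero, Real.exp_zero, mul_one, Real.exp_neg] at h
  rwa [← div_eq_mul_inv, div_le_iff₀ (Real.exp_pos _)] at h

open Filter Topology in
/-- A solution with vanishing initial slope and values in `(0, 1)` on `[0, π/2]` has positive
derivative on `(0, π/2)`. -/
lemma IsYamabeSolution.deriv_pos {m : ℕ} (hm : 2 ≤ m) {p lam : ℝ} (hp : 2 < p)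
    (hlam : 0 < lam) {u : ℝ → ℝ} (hu : IsYamabeSolution m p lam u) (hu0 : deriv u 0 = 0)
    (hpos : ∀ t ∈ Icc (0 : ℝ) (π / 2), 0 < u t) (hlt : ∀ t ∈ Icc (0 : ℝ) (π / 2), u t < 1)
    {t : ℝ} (ht : t ∈ Ioo 0 (π / 2)) : 0 < deriv u t := by
  obtain ⟨-, hd, hdd, hode⟩ := hu
  have hpi := Real.pi_pos
  have hsin : ∀ x ∈ Ioo 0 (π / 2), 0 < Real.sin x := fun x hx =>
    Real.sin_pos_of_pos_of_lt_pi hx.1 (by linarith [hx.2])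
  obtain ⟨n, rfl⟩ : ∃ n, m = n + 2 := ⟨m - 2, by omega⟩
  set w : ℝ → ℝ := fun x => Real.sin x ^ (n + 1) * deriv u x with hw
  have hwd : ∀ x ∈ Ioo 0 (π / 2),
      HasDerivAt w (Real.sin x ^ (n + 1) * (lam * (u x - u x ^ (p - 1)))) x := by
    intro x hx
    have hxI : x ∈ Ioo 0 π := ⟨hx.1, by linarith [hx.2]⟩
    refine (((Real.hasDerivAt_sin x).pow (n + 1)).mul (hdd x hxI).hasDerivAt).congr_deriv ?_
    have hs := (hsin x hx).ne'
    have h1 : Real.sin x ^ (n + 1) * (Real.cos x / Real.sin x) =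
        Real.sin x ^ n * Real.cos x := by
      field_simp
      ring
    have h2 := hode x hxI
    push_cast at h2
    simp only [Nat.add_one_sub_one, Nat.cast_add, Nat.cast_one, Pi.pow_apply]
    linear_combination Real.sin x ^ (n + 1) * h2 - (n + 1) * deriv u x * h1
  have hmono : StrictMonoOn w (Ioo 0 (π / 2)) := by
    refine strictMonoOn_of_deriv_pos (convex_Ioo _ _)
      (fun x hx => (hwd x hx).continuousAt.continuousWithinAt) ?_
    rw [interior_Ioo]
    intro x hx
    rw [(hwd x hx).deriv]
    have hxI := Ioo_subset_Icc_self hx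
    have h1 : u x ^ (p - 1) < u x := by
      simpa using Real.rpow_lt_rpow_of_exponent_gt (hpos x hxI) (hlt x hxI)
        (show 1 < p - 1 by linarith)
    exact mul_pos (pow_pos (hsin x hx) _) (mul_pos hlam (sub_pos.2 h1))
  obtain ⟨s, hs, hs'⟩ := exists_tendsto_deriv_right_zero hpi hd
  have hlim : Tendsto (fun x => w (s x)) (𝓝[>] 0) (𝓝 (Real.sin 0 ^ (n + 1) * deriv u 0)) :=
    ((Real.continuous_sin.tendsto 0 |>.comp (hs.mono_right nhdsWithin_le_nhds)).pow _).mul hs'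
  have ht2 : t / 2 ∈ Ioo 0 (π / 2) := ⟨by linarith [ht.1], by linarith [ht.1, ht.2]⟩
  have hle := le_of_tendsto hlim (b := w (t / 2)) <| by
    filter_upwards [hs.eventually (Ioo_mem_nhdsGT ht2.1)] with x hx
    exact hmono.monotoneOn ⟨hx.1, hx.2.trans ht2.2⟩ ht2 hx.2.le
  rw [hu0, mul_zero] at hle
  have hwt : 0 < w t := hle.trans_lt (hmono ht2 ht (by linarith [ht.1]))
  exact (mul_pos_iff_of_pos_left (pow_pos (hsin t ht) _)).1 hwt

/-- For initial values `α` close to `0`, positive solutions of the Yamabe ODE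
stay below `1` and are strictly increasing on `(0, π/2)`; in particular they
have no local extrema in `(0, π/2)`. -/
theorem small_initial_value_increasing (m : ℕ) (hm : 2 ≤ m) (p lam : ℝ)
    (hp : 2 < p) (hlam : 0 < lam) :
    ∃ ε ∈ Ioo (0 : ℝ) 1, ∀ α ∈ Ioo (0 : ℝ) ε, ∀ u : ℝ → ℝ,
      IsYamabeSolution m p lam u → u 0 = α → deriv u 0 = 0 →
      (∀ t ∈ Icc (0 : ℝ) (π / 2), 0 < u t) →
      (∀ t ∈ Icc (0 : ℝ) (π / 2), u t < 1) ∧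
      (∀ t ∈ Ioo (0 : ℝ) (π / 2), 0 < deriv u t) ∧
      (∀ t ∈ Ioo (0 : ℝ) (π / 2), ¬ IsLocalExtr u t) := by
  have hpi := Real.pi_pos
  refine ⟨Real.exp (-(√lam * (π / 2))), ⟨Real.exp_pos _, ?_⟩, ?_⟩
  · rw [Real.exp_lt_one_iff, neg_lt_zero]
    positivity
  intro α hα u hu hu0 hdu0 hpos
  have hε : Real.exp (-(√lam * (π / 2))) ≤ 1 := by
    rw [Real.exp_le_one_iff, neg_nonpos]
    positivity
  have hlt : ∀ t ∈ Icc (0 : ℝ) (π / 2), u t < 1 := by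
    intro t ht
    calc u t ≤ u 0 * Real.exp (√lam * t) :=
          hu.le_mul_exp hm hp hlam (hu0 ▸ hα.2.trans_le hε) hdu0 hpos ht
      _ ≤ α * Real.exp (√lam * (π / 2)) := by
          rw [hu0]
          have := hα.1
          gcongr
          exact ht.2
      _ < Real.exp (-(√lam * (π / 2))) * Real.exp (√lam * (π / 2)) := by
          gcongr
          exact hα.2
      _ = 1 := by rw [← Real.exp_add, neg_add_cancel, Real.exp_zero]
  have hderiv : ∀ t ∈ Ioo (0 : ℝ) (π / 2), 0 < deriv u t :=
    fun t ht => hu.deriv_pos hm hp hlam hdu0 hpos hlt ht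
  exact ⟨hlt, hderiv, fun t ht h => (hderiv t ht).ne' h.deriv_eq_zero⟩
end
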